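/- For every convex body K ⊂ R^2 of unit area, lim_{n→∞} n^{-1/3} log E|Q(X_n)| = 3 · 2^{-2/3} · A(K), where Q(X_n) is the collection of convex polygons spanned by an n-point uniform sample X_n from K. -/

import Mathlib

open MeasureTheory Set Filter
noncomputable section

/-- Euclidean space `ℝ^d`. -/
abbrev E (d : ℕ) := EuclideanSpace ℝ (Fin d)

/-- A set of points is in convex position if no point lies in the convex hull of the others. -/
def ConvexPosition {d : ℕ} (X : Set (E d)) : Prop :=
  ∀ x ∈ X, x ∉ convexHull ℝ (X \ {x})

/-- The uniform (normalized Lebesgue) measure on `K`. -/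
def unifOn (d : ℕ) (K : Set (E d)) : Measure (E d) :=
  (volume K)⁻¹ • volume.restrict K

/-- The distribution of `n` independent uniform points in `K`. -/
def sampleMeasure (d n : ℕ) (K : Set (E d)) : Measure (Fin n → E d) :=
  Measure.pi fun _ => unifOn d K

/-- `p(n,K)`: probability that `n` i.i.d. uniform points in `K` are in convex position. -/
def pConvex (d n : ℕ) (K : Set (E d)) : ℝ :=
  (sampleMeasure d n K {x | ConvexPosition (Set.range x)}).toReal

/-- The (convex) floating body: points of `S` not cut off by any halfplane slicing
off volume at most `δ` from `S`. -/
def floatingBody (S : Set (E 2)) (δ : ℝ) : Set (E 2) :=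
  {x ∈ S | ∀ (f : E 2 →L[ℝ] ℝ) (c : ℝ),
    volume {y ∈ S | c < f y} ≤ ENNReal.ofReal δ → f x ≤ c}

/-- The affine perimeter of a planar convex body, defined via the floating-body
asymptotics `Area(S \ S_δ) ∼ (3/(4√2))^{2/3} AP(S) δ^{2/3}` (equivalent to
`∫_{∂S} κ^{1/3} ds` for smooth bodies). -/
def affinePerimeter (S : Set (E 2)) : ℝ :=
  (4 * Real.sqrt 2 / 3) ^ ((2:ℝ)/3) *
    limUnder (nhdsWithin 0 (Set.Ioi 0)) fun δ : ℝ =>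
      ((volume S).toReal - (volume (floatingBody S δ)).toReal) / δ ^ ((2:ℝ)/3)

/-- `A(K)`: the supremum of affine perimeters of convex compact subsets of `K`. -/
def maxAffinePerimeter (K : Set (E 2)) : ℝ :=
  sSup {a | ∃ S, S ⊆ K ∧ Convex ℝ S ∧ IsCompact S ∧ a = affinePerimeter S}

/-- The number of convex polytopes spanned by the sample `x`: the number of subsets of
at least 3 of the points that are in convex position. -/
def numPolytopes (d n : ℕ) (x : Fin n → E d) : ℕ :=
  Set.ncard {s : Finset (Fin n) | 3 ≤ s.card ∧ ConvexPosition (x '' ↑s)}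

noncomputable section

/-- linear functional with given coefficients -/
def lc (u : ℝ × ℝ) (x : E 2) : ℝ := u.1 * x 0 + u.2 * x 1

/-- determinant of two functionals -/
def dt (u v : ℝ × ℝ) : ℝ := u.1 * v.2 - u.2 * v.1

lemma lc_add (u : ℝ × ℝ) (x y : E 2) : lc u (x + y) = lc u x + lc u y := by
  simp [lc]; ring

lemma lc_smul (u : ℝ × ℝ) (c : ℝ) (x : E 2) : lc u (c • x) = c * lc u x := by
  simp [lc]; ring

lemma lc_sub (u : ℝ × ℝ) (x y : E 2) : lc u (x - y) = lc u x - lc u y := by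
  simp [lc]; ring

lemma continuous_lc (u : ℝ × ℝ) : Continuous (lc u) := by
  unfold lc; fun_prop

lemma measurable_lc (u : ℝ × ℝ) : Measurable (lc u) := (continuous_lc u).measurable

/-- bundled version -/
def lcL (u : ℝ × ℝ) : E 2 →L[ℝ] ℝ where
  toFun := lc u
  map_add' := lc_add u
  map_smul' := by intro c x; simp [lc_smul]
  cont := continuous_lc u

@[simp] lemma lcL_apply (u : ℝ × ℝ) (x : E 2) : lcL u x = lc u x := rfl

lemma exists_lc (f : E 2 →L[ℝ] ℝ) : ∃ u : ℝ × ℝ, ∀ x, f x = lc u x := by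
  refine ⟨(f (EuclideanSpace.single 0 1), f (EuclideanSpace.single 1 1)), fun x => ?_⟩
  have : x = x 0 • EuclideanSpace.single (0 : Fin 2) (1 : ℝ) + x 1 • EuclideanSpace.single (1 : Fin 2) (1 : ℝ) := by
    ext i; fin_cases i <;> simp
  conv_lhs => rw [this]
  rw [map_add, map_smul, map_smul]
  simp [lc]; ring

/-- point of the plane from coordinates -/
def mkE (x y : ℝ) : E 2 := !₂[x, y]

@[simp] lemma mkE_zero (x y : ℝ) : mkE x y 0 = x := rfl
@[simp] lemma mkE_one (x y : ℝ) : mkE x y 1 = y := rfl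

lemma E2_ext {x y : E 2} (h0 : x 0 = y 0) (h1 : x 1 = y 1) : x = y := by
  ext i; fin_cases i <;> simp [h0, h1]

/-- the standard volume preserving identification -/
def toProd : E 2 ≃ᵐ ℝ × ℝ := (MeasurableEquiv.toLp 2 (Fin 2 → ℝ)).symm.trans MeasurableEquiv.finTwoArrow

@[simp] lemma toProd_apply (x : E 2) : toProd x = (x 0, x 1) := rfl
@[simp] lemma toProd_symm_apply (x : ℝ × ℝ) : toProd.symm x = mkE x.1 x.2 := by
  apply toProd.injective; simp

lemma mp_toProd : MeasurePreserving toProd volume volume :=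
  (EuclideanSpace.volume_preserving_symm_measurableEquiv_toLp (Fin 2)).trans
    (volume_preserving_finTwoArrow ℝ)

/-- affine coordinates -/
def cmap (u v : ℝ × ℝ) (e f : ℝ) (x : E 2) : ℝ × ℝ := (lc u x + e, lc v x + f)

lemma continuous_cmap (u v : ℝ × ℝ) (e f : ℝ) : Continuous (cmap u v e f) := by
  unfold cmap; exact ((continuous_lc u).add continuous_const).prodMk ((continuous_lc v).add continuous_const)

lemma map_cmap (u v : ℝ × ℝ) (e f : ℝ) (h : dt u v ≠ 0) :
    Measure.map (cmap u v e f) volume = ENNReal.ofReal (|dt u v|⁻¹) • (volume : Measure (ℝ × ℝ)) := by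
  set L : (ℝ × ℝ) →ₗ[ℝ] (ℝ × ℝ) := Matrix.toLin (Module.Basis.finTwoProd ℝ) (Module.Basis.finTwoProd ℝ) !![u.1, u.2; v.1, v.2] with hL
  have hdet : LinearMap.det L = dt u v := by
    rw [hL, LinearMap.det_toLin, Matrix.det_fin_two_of]; rfl
  have hm := Measure.map_linearMap_addHaar_eq_smul_addHaar (volume : Measure (ℝ × ℝ)) (f := L) (by rw [hdet]; exact h)
  have hcomp : cmap u v e f = (fun z => z + ((e, f) : ℝ × ℝ)) ∘ L ∘ toProd := by
    funext x
    simp [cmap, hL, Matrix.toLin_finTwoProd_apply, lc]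
  have hLm : Measurable L := (LinearMap.continuous_of_finiteDimensional L).measurable
  rw [hcomp, ← Measure.map_map (by fun_prop) (hLm.comp toProd.measurable), ← Measure.map_map hLm toProd.measurable,
    mp_toProd.map_eq, hm, Measure.map_smul, hdet, map_add_right_eq_self, abs_inv]

lemma vol_cmap (u v : ℝ × ℝ) (e f : ℝ) (h : dt u v ≠ 0) {s : Set (ℝ × ℝ)} (hs : MeasurableSet s) :
    volume (cmap u v e f ⁻¹' s) = ENNReal.ofReal (|dt u v|⁻¹) * volume s := by
  rw [← Measure.map_apply (continuous_cmap u v e f).measurable hs, map_cmap u v e f h]; rfl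

end

noncomputable section

lemma measure_sym {α G : Type*} [MeasurableSpace α] [Fintype G] (μ : Measure α) (T : G → α → α)
    (hT : ∀ g, MeasurePreserving (T g) μ μ) (C A : Set α) (hC : MeasurableSet C)
    (hdis : Pairwise fun g h => Disjoint (T g ⁻¹' C) (T h ⁻¹' C))
    (hsub : ∀ g, T g ⁻¹' C ⊆ A) (hcov : μ (A \ ⋃ g, T g ⁻¹' C) = 0) :
    (Fintype.card G : ENNReal) * μ C = μ A := by
  have h1 : μ (⋃ g, T g ⁻¹' C) = ∑ g : G, μ (T g ⁻¹' C) := by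
    rw [measure_iUnion hdis (fun g => (hT g).measurable hC), tsum_fintype]
  have h2 : μ A = μ (⋃ g, T g ⁻¹' C) := by
    apply le_antisymm
    · calc μ A ≤ μ ((A \ ⋃ g, T g ⁻¹' C) ∪ ⋃ g, T g ⁻¹' C) := measure_mono (by
            intro x hx; by_cases h : x ∈ ⋃ g, T g ⁻¹' C
            · exact Or.inr h
            · exact Or.inl ⟨hx, h⟩)
        _ ≤ _ := measure_union_le _ _
        _ = _ := by rw [hcov, zero_add]
    · exact measure_mono (iUnion_subset hsub)
  rw [h2, h1]
  simp [fun g => (hT g).measure_preimage hC.nullMeasurableSet]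

variable {k : ℕ}

/-- extended sequence: `0`, the coordinates, `1` -/
def extS (X : Fin k → ℝ) (m : ℕ) : ℝ :=
  if m = 0 then 0 else if h : m - 1 < k then X ⟨m - 1, h⟩ else 1

def gap (X : Fin k → ℝ) (i : ℕ) : ℝ := extS X (i + 1) - extS X i

@[simp] lemma ext_zero (X : Fin k → ℝ) : extS X 0 = 0 := by simp [extS]
lemma ext_succ (X : Fin k → ℝ) (j : Fin k) : extS X (j + 1) = X j := by simp [extS]
lemma ext_last (X : Fin k → ℝ) : extS X (k + 1) = 1 := by simp [extS]

lemma ext_lin (r : ℝ) (X Y : Fin k → ℝ) (m : ℕ) :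
    extS (r • X + (1 - r) • Y) m = r * extS X m + (1 - r) * extS Y m := by
  unfold extS; split_ifs <;> simp

lemma continuous_ext (m : ℕ) : Continuous fun X : Fin k → ℝ => extS X m := by
  unfold extS; split_ifs <;> fun_prop

lemma continuous_gap (m : ℕ) : Continuous fun X : Fin k → ℝ => gap X m :=
  (continuous_ext _).sub (continuous_ext _)

lemma gap_lin (r : ℝ) (X Y : Fin k → ℝ) (m : ℕ) :
    gap (r • X + (1 - r) • Y) m = r * gap X m + (1 - r) * gap Y m := by
  unfold gap; rw [ext_lin, ext_lin]; ring

lemma sum_gap (X : Fin k → ℝ) (m : ℕ) : ∑ i ∈ Finset.range m, gap X i = extS X m := by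
  unfold gap; rw [Finset.sum_range_sub]; simp

lemma sum_gap_all (X : Fin k → ℝ) : ∑ i : Fin (k + 1), gap X i = 1 := by
  rw [Fin.sum_univ_eq_sum_range (fun i => gap X i), sum_gap, ext_last]

lemma gap_inj {X Y : Fin k → ℝ} (h : ∀ i : Fin (k + 1), gap X i = gap Y i) : X = Y := by
  funext j
  rw [← ext_succ X j, ← ext_succ Y j, ← sum_gap, ← sum_gap]
  apply Finset.sum_congr rfl
  intro i hi
  have := h ⟨i, by have := Finset.mem_range.1 hi; omega⟩
  simpa using this

/-- the sequence with given gaps -/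
def fromGap (d : Fin (k + 1) → ℝ) (j : Fin k) : ℝ :=
  ∑ i : Fin (k + 1), if i.val ≤ j.val then d i else 0

lemma ext_fromGap (d : Fin (k + 1) → ℝ) (hd : ∑ i, d i = 1) (m : ℕ) (hm : m ≤ k + 1) :
    extS (fromGap d) m = ∑ i : Fin (k + 1), if i.val < m then d i else 0 := by
  rcases Nat.eq_zero_or_pos m with rfl | h0
  · simp
  rcases Nat.lt_or_ge k m with h | h
  · have : m = k + 1 := by omega
    subst this
    rw [ext_last, ← hd]
    apply Finset.sum_congr rfl; intro i _; simp [i.2]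
  · obtain ⟨j, rfl⟩ : ∃ j, m = j + 1 := ⟨m - 1, by omega⟩
    have := ext_succ (fromGap d) ⟨j, by omega⟩
    simp only at this
    rw [this, fromGap]
    apply Finset.sum_congr rfl; intro i _; simp

lemma gap_fromGap (d : Fin (k + 1) → ℝ) (hd : ∑ i, d i = 1) (i : Fin (k + 1)) :
    gap (fromGap d) i = d i := by
  unfold gap
  rw [ext_fromGap d hd _ (by omega), ext_fromGap d hd _ (by omega), ← Finset.sum_sub_distrib]
  rw [Finset.sum_eq_single i]
  · simp
  · intro b _ hb
    have : b.val ≠ i.val := fun h => hb (Fin.ext h)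
    by_cases h : b.val < i.val
    · simp [h, Nat.lt_succ_of_lt h]
    · have : ¬ b.val < i.val + 1 := by omega
      simp [h, this]
  · simp

/-- permutation of edges -/
def tperm (σ : Equiv.Perm (Fin (k + 1))) (X : Fin k → ℝ) : Fin k → ℝ :=
  fromGap fun i => gap X (σ i)

lemma gap_tperm (σ : Equiv.Perm (Fin (k + 1))) (X : Fin k → ℝ) (i : Fin (k + 1)) :
    gap (tperm σ X) i = gap X (σ i) := by
  unfold tperm
  rw [gap_fromGap]
  rw [Equiv.sum_comp σ (fun i => gap X i), sum_gap_all]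

lemma tperm_inv (σ : Equiv.Perm (Fin (k + 1))) (X : Fin k → ℝ) : tperm σ⁻¹ (tperm σ X) = X := by
  apply gap_inj; intro i; rw [gap_tperm, gap_tperm]; simp

lemma tperm_injective (σ : Equiv.Perm (Fin (k + 1))) : Function.Injective (tperm (k := k) σ) :=
  Function.LeftInverse.injective (tperm_inv σ)

lemma tperm_lin (σ : Equiv.Perm (Fin (k + 1))) (r : ℝ) (X Y : Fin k → ℝ) :
    tperm σ (r • X + (1 - r) • Y) = r • tperm σ X + (1 - r) • tperm σ Y := by
  apply gap_inj; intro i; rw [gap_tperm, gap_lin, gap_lin, gap_tperm, gap_tperm]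

lemma continuous_tperm (σ : Equiv.Perm (Fin (k + 1))) : Continuous (tperm (k := k) σ) := by
  unfold tperm fromGap
  refine continuous_pi fun j => continuous_finsetSum _ fun i _ => ?_
  split_ifs
  · exact continuous_gap _
  · fun_prop

def tpermL (σ : Equiv.Perm (Fin (k + 1))) : (Fin k → ℝ) →ₗ[ℝ] (Fin k → ℝ) where
  toFun X := tperm σ X - tperm σ 0
  map_add' X Y := by
    have h1 := tperm_lin σ (1/2) ((2:ℝ) • X) ((2:ℝ) • Y)
    have h2 := tperm_lin σ 2 X 0
    have h3 := tperm_lin σ 2 Y 0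
    have e1 : (1/2 : ℝ) • (2:ℝ) • X + (1 - 1/2 : ℝ) • (2:ℝ) • Y = X + Y := by
      ext i; simp; ring
    rw [e1] at h1
    simp only [smul_zero, add_zero] at h2 h3
    rw [h1, h2, h3]; ext i; simp; ring
  map_smul' r X := by
    have h2 := tperm_lin σ r X 0
    simp only [smul_zero, add_zero] at h2
    rw [h2]; ext i; simp; ring

/-- monotone sequences in the unit interval -/
def Mset (k : ℕ) : Set (Fin k → ℝ) := {X | ∀ i : Fin (k + 1), 0 < gap X i}

lemma measurableSet_Mset : MeasurableSet (Mset k) := by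
  apply IsOpen.measurableSet
  simp only [Mset, ofPred_forall]
  exact isOpen_iInter_of_finite fun i => isOpen_lt continuous_const (continuous_gap _)

lemma ext_strictMono {X : Fin k → ℝ} (hX : X ∈ Mset k) {i j : ℕ} (hij : i < j) (hj : j ≤ k + 1) :
    extS X i < extS X j := by
  induction j with
  | zero => omega
  | succ j ih =>
    have h := hX ⟨j, by omega⟩
    simp only [gap] at h
    rcases Nat.lt_or_ge i j with h' | h'
    · have := ih h' (by omega); linarith
    · have : i = j := by omega
      subst this; linarith

lemma mem_Mset_iff (X : Fin k → ℝ) : X ∈ Mset k ↔ StrictMono X ∧ ∀ j, X j ∈ Ioo (0:ℝ) 1 := by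
  constructor
  · intro h
    refine ⟨fun i j hij => ?_, fun j => ⟨?_, ?_⟩⟩
    · rw [← ext_succ X i, ← ext_succ X j]
      exact ext_strictMono h (by simpa using hij) (by omega)
    · rw [← ext_succ X j, ← ext_zero X]; exact ext_strictMono h (by omega) (by omega)
    · rw [← ext_succ X j, ← ext_last X]; exact ext_strictMono h (by omega) (by omega)
  · rintro ⟨h1, h2⟩ i
    unfold gap
    rcases Nat.eq_zero_or_pos i.val with h0 | h0
    · rw [h0, ext_zero]
      by_cases hk : 0 < k
      · have := ext_succ X ⟨0, hk⟩
        simp only at this; rw [this]; simpa using (h2 _).1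
      · have : k = 0 := by omega
        subst this; rw [ext_last]; norm_num
    · obtain ⟨m, hm⟩ : ∃ m, i.val = m + 1 := ⟨i.val - 1, by omega⟩
      rw [hm]
      have e1 := ext_succ X ⟨m, by omega⟩
      simp only at e1; rw [e1]
      by_cases hk : m + 1 < k
      · have e2 := ext_succ X ⟨m + 1, hk⟩
        simp only at e2; rw [e2]
        have := h1 (show (⟨m, by omega⟩ : Fin k) < ⟨m + 1, hk⟩ by simp)
        linarith
      · have : m + 1 = k := by omega
        have e3 : extS X (m + 1 + 1) = 1 := by rw [this]; exact ext_last X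
        rw [e3]; linarith [(h2 ⟨m, by omega⟩).2]

lemma strictMono_comp_perm_eq {m : ℕ} {f : Fin m → ℝ} {σ τ : Equiv.Perm (Fin m)}
    (h1 : StrictMono (f ∘ σ)) (h2 : StrictMono (f ∘ τ)) : σ = τ := by
  have h := StrictMono.range_inj h1 h2
  rw [Set.range_comp, Set.range_comp, σ.surjective.range_eq, τ.surjective.range_eq] at h
  have h3 := h.1 rfl
  have hf : Function.Injective f := by
    have := h1.injective.comp σ.symm.injective
    simpa [Function.comp_def] using this
  ext1 i
  exact hf (congrFun h3 i)

lemma exists_perm_strictMono {m : ℕ} {f : Fin m → ℝ} (hf : Function.Injective f) :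
    ∃ σ : Equiv.Perm (Fin m), StrictMono (f ∘ σ) :=
  ⟨Tuple.sort f, (Tuple.monotone_sort f).strictMono_of_injective (hf.comp (Tuple.sort f).injective)⟩

lemma vol_Mset : (Nat.factorial k : ENNReal) * volume (Mset k) = 1 := by
  have h := measure_sym (G := Equiv.Perm (Fin k)) (volume : Measure (Fin k → ℝ))
    (fun σ X => X ∘ σ) (fun σ => ?_) (Mset k) (Set.pi univ fun _ => Ioo (0:ℝ) 1) measurableSet_Mset
    ?_ ?_ ?_
  · rw [Fintype.card_perm, Fintype.card_fin] at h
    rw [h, Real.volume_pi_Ioo]; simp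
  · have h0 := volume_measurePreserving_piCongrLeft (fun _ : Fin k => ℝ) σ.symm
    have e : (fun X : Fin k → ℝ => X ∘ σ) = MeasurableEquiv.piCongrLeft (fun _ : Fin k => ℝ) σ.symm := by
      funext X i
      have := MeasurableEquiv.piCongrLeft_apply_apply (β := fun _ : Fin k => ℝ) σ.symm X (σ i)
      simpa using this.symm
    rw [e]; exact h0
  · intro σ τ hne
    rw [Set.disjoint_left]
    intro X h1 h2
    rw [mem_preimage, mem_Mset_iff] at h1 h2
    exact hne (strictMono_comp_perm_eq h1.1 h2.1)
  · intro σ X hX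
    rw [mem_preimage, mem_Mset_iff] at hX
    intro j _
    simpa using hX.2 (σ.symm j)
  · have hnull : ∀ i j : Fin k, i ≠ j → volume {X : Fin k → ℝ | X i = X j} = 0 := by
      intro i j hij
      let S : Submodule ℝ (Fin k → ℝ) :=
        LinearMap.ker ((LinearMap.proj i : (Fin k → ℝ) →ₗ[ℝ] ℝ) - LinearMap.proj j)
      have hS : S ≠ ⊤ := by
        intro hS
        have : (Pi.single i 1 : Fin k → ℝ) ∈ S := by rw [hS]; trivial
        simp [S, LinearMap.mem_ker, hij] at this
      have := Measure.addHaar_submodule (volume : Measure (Fin k → ℝ)) S hS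
      convert this using 2
      ext X; simp [S, LinearMap.mem_ker, sub_eq_zero]
    refine measure_mono_null (t := ⋃ i, ⋃ j, ⋃ (_ : i ≠ j), {X : Fin k → ℝ | X i = X j}) ?_ ?_
    · rintro X ⟨h1, h2⟩
      by_contra h3
      simp only [mem_iUnion, mem_ofPred_eq, not_exists] at h3
      have hinj : Function.Injective X := by
        intro i j hij; by_contra hne; exact h3 i j hne hij
      obtain ⟨σ, hσ⟩ := exists_perm_strictMono hinj
      apply h2
      rw [mem_iUnion]
      refine ⟨σ, ?_⟩
      rw [mem_preimage, mem_Mset_iff]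
      exact ⟨hσ, fun j => h1 _ trivial⟩
    · simp only [measure_iUnion_null_iff]
      exact hnull

lemma vol_Mset' : volume (Mset k) = (Nat.factorial k : ENNReal)⁻¹ := by
  have h := vol_Mset (k := k)
  rw [mul_comm] at h
  exact ENNReal.eq_inv_of_mul_eq_one_left h

lemma tperm_preimage (σ : Equiv.Perm (Fin (k + 1))) : tperm σ ⁻¹' Mset k = Mset k := by
  ext X
  simp only [mem_preimage, Mset, mem_ofPred_eq, gap_tperm]
  exact σ.forall_congr_left (p := fun i => 0 < gap X (σ i)) |>.trans (by simp)

lemma mp_tperm (σ : Equiv.Perm (Fin (k + 1))) :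
    MeasurePreserving (tperm σ) (volume : Measure (Fin k → ℝ)) volume := by
  refine ⟨(continuous_tperm σ).measurable, ?_⟩
  have hinj : Function.Injective (tpermL σ) := by
    intro X Y h
    apply tperm_injective σ
    have : tperm σ X - tperm σ 0 = tperm σ Y - tperm σ 0 := h
    exact sub_left_injective this
  have hdet : LinearMap.det (tpermL σ) ≠ 0 := by
    have := (LinearEquiv.ofInjectiveEndo (tpermL σ) hinj).isUnit_det'
    exact this.ne_zero
  have hm := Measure.map_linearMap_addHaar_eq_smul_addHaar (volume : Measure (Fin k → ℝ)) hdet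
  have hcomp : tperm σ = (fun z => z + tperm σ 0) ∘ tpermL σ := by
    funext X; simp [tpermL]
  have hLm : Measurable (tpermL σ) := (LinearMap.continuous_of_finiteDimensional _).measurable
  have h1 : Measure.map (tperm σ) (volume : Measure (Fin k → ℝ)) = ENNReal.ofReal |(LinearMap.det (tpermL σ))⁻¹| • volume := by
    conv_lhs => rw [hcomp]
    rw [← Measure.map_map (by fun_prop) hLm, hm, Measure.map_smul, map_add_right_eq_self]
  have h2 : volume (Mset k) = ENNReal.ofReal |(LinearMap.det (tpermL σ))⁻¹| * volume (Mset k) := by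
    conv_lhs => rw [← tperm_preimage σ, ← Measure.map_apply (continuous_tperm σ).measurable measurableSet_Mset, h1]
    rfl
  have h3 : ENNReal.ofReal |(LinearMap.det (tpermL σ))⁻¹| = 1 := by
    have hne : volume (Mset k) ≠ 0 := by rw [vol_Mset']; simp
    have hnt : volume (Mset k) ≠ ⊤ := by rw [vol_Mset']; simp [Nat.factorial_ne_zero]
    rw [mul_comm] at h2
    exact (ENNReal.mul_right_inj hne hnt).1 (by rw [← h2, mul_one])
  rw [h1, h3, one_smul]

/-- convex chains -/
def Chain (k : ℕ) : Set ((Fin k → ℝ) × (Fin k → ℝ)) :=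
  {p | p.1 ∈ Mset k ∧ p.2 ∈ Mset k ∧ StrictMono fun i : Fin (k + 1) => gap p.1 i / gap p.2 i}

lemma measurableSet_Chain : MeasurableSet (Chain k) := by
  have h1 : MeasurableSet {p : (Fin k → ℝ) × (Fin k → ℝ) | p.1 ∈ Mset k} := measurable_fst measurableSet_Mset
  have h2 : MeasurableSet {p : (Fin k → ℝ) × (Fin k → ℝ) | p.2 ∈ Mset k} := measurable_snd measurableSet_Mset
  have hm : ∀ i : ℕ, Measurable fun p : (Fin k → ℝ) × (Fin k → ℝ) => gap p.1 i / gap p.2 i := fun i =>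
    ((continuous_gap i).measurable.comp measurable_fst).div ((continuous_gap i).measurable.comp measurable_snd)
  refine h1.inter (h2.inter ?_)
  have : {p : (Fin k → ℝ) × (Fin k → ℝ) | StrictMono fun i : Fin (k + 1) => gap p.1 i / gap p.2 i}
    = ⋂ i : Fin (k+1), ⋂ j : Fin (k+1), ⋂ (_ : i < j), {p | gap p.1 i / gap p.2 i < gap p.1 j / gap p.2 j} := by
    ext p; simp [StrictMono]
  change MeasurableSet {p : (Fin k → ℝ) × (Fin k → ℝ) | StrictMono fun i : Fin (k + 1) => gap p.1 i / gap p.2 i}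
  rw [this]
  exact MeasurableSet.iInter fun i => MeasurableSet.iInter fun j => MeasurableSet.iInter fun _ =>
    measurableSet_lt (hm _) (hm _)

lemma null_ratio (i j : Fin (k + 1)) (hij : i ≠ j) :
    volume {p : (Fin k → ℝ) × (Fin k → ℝ) | (p.1 ∈ Mset k ∧ p.2 ∈ Mset k) ∧ gap p.1 i / gap p.2 i = gap p.1 j / gap p.2 j} = 0 := by
  have hms : MeasurableSet {p : (Fin k → ℝ) × (Fin k → ℝ) | p.1 ∈ Mset k ∧ gap p.1 i * gap p.2 j = gap p.1 j * gap p.2 i} := by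
    refine (measurable_fst measurableSet_Mset).inter (measurableSet_eq_fun ?_ ?_)
    · exact ((continuous_gap i).measurable.comp measurable_fst).mul ((continuous_gap j).measurable.comp measurable_snd)
    · exact ((continuous_gap j).measurable.comp measurable_fst).mul ((continuous_gap i).measurable.comp measurable_snd)
  refine measure_mono_null (t := {p : (Fin k → ℝ) × (Fin k → ℝ) | p.1 ∈ Mset k ∧ gap p.1 i * gap p.2 j = gap p.1 j * gap p.2 i}) ?_ ?_
  · rintro p ⟨⟨h1, h2⟩, h3⟩
    refine ⟨h1, ?_⟩
    have := h2 i
    have := h2 j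
    field_simp at h3
    linarith
  · rw [Measure.volume_eq_prod, Measure.measure_prod_null hms]
    refine Eventually.of_forall fun X => ?_
    simp only [preimage_ofPred_eq, Pi.zero_apply]
    by_cases hX : X ∈ Mset k
    · let S : AffineSubspace ℝ (Fin k → ℝ) :=
        { carrier := {Y | gap X i * gap Y j = gap X j * gap Y i}
          smul_vsub_vadd_mem' := by
            intro c p₁ p₂ p₃ h1 h2 h3
            simp only [mem_ofPred_eq] at h1 h2 h3 ⊢
            have e : c • (p₁ -ᵥ p₂) +ᵥ p₃ = (1/2 : ℝ) • ((2 : ℝ) • ((c : ℝ) • p₁ + (1 - c) • p₃) + (1 - (2:ℝ)) • p₃) + (1 - 1/2 : ℝ) • ((2 : ℝ) • ((-c : ℝ) • p₂ + (1 - -c) • p₃) + (1 - (2:ℝ)) • p₃) := by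
              ext m; simp; ring
            rw [e]
            simp only [gap_lin]
            linear_combination c * h1 - c * h2 + h3 }
      have hS : S ≠ ⊤ := by
        intro hS
        have hmem : fromGap (Pi.single j 1) ∈ S := by rw [hS]; trivial
        have hmem' : gap X i * gap (fromGap (Pi.single j (1:ℝ))) j = gap X j * gap (fromGap (Pi.single j (1:ℝ))) i := hmem
        rw [gap_fromGap _ (by simp), gap_fromGap _ (by simp)] at hmem'
        simp [hij] at hmem'
        have := hX i
        linarith
      have := Measure.addHaar_affineSubspace (volume : Measure (Fin k → ℝ)) S hS
      refine measure_mono_null ?_ this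
      rintro Y ⟨_, hY⟩
      exact hY
    · simp [hX]

lemma vol_Chain : volume (Chain k) = ((Nat.factorial k : ENNReal) ^ 2 * (Nat.factorial (k + 1)))⁻¹ := by
  have h := measure_sym (G := Equiv.Perm (Fin (k + 1))) (volume : Measure ((Fin k → ℝ) × (Fin k → ℝ)))
    (fun σ => Prod.map (tperm σ) (tperm σ)) (fun σ => (mp_tperm σ).prod (mp_tperm σ)) (Chain k) (Mset k ×ˢ Mset k)
    measurableSet_Chain ?_ ?_ ?_
  · rw [Fintype.card_perm, Fintype.card_fin, Measure.volume_eq_prod, Measure.prod_prod, vol_Mset'] at h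
    have hk : (Nat.factorial k : ENNReal) ≠ 0 := by simp [Nat.factorial_ne_zero]
    have hk1 : (Nat.factorial (k+1) : ENNReal) ≠ 0 := by simp [Nat.factorial_ne_zero]
    rw [ENNReal.mul_inv (Or.inl (by simp [hk])) (Or.inl (by simp)), pow_two, ENNReal.mul_inv (Or.inl (by simp [hk])) (Or.inl (by simp)), ← h, mul_comm, ← mul_assoc,
      ENNReal.inv_mul_cancel hk1 (by simp), one_mul, Measure.volume_eq_prod]
  · intro σ τ hne
    rw [Set.disjoint_left]
    rintro p ⟨_, _, h1⟩ ⟨_, _, h2⟩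
    simp only [Prod.map_fst, Prod.map_snd, gap_tperm] at h1 h2
    exact hne (strictMono_comp_perm_eq (f := fun i => gap p.1 i / gap p.2 i) h1 h2)
  · rintro σ p ⟨h1, h2, _⟩
    rw [Prod.map_fst, ← mem_preimage, tperm_preimage] at h1
    rw [Prod.map_snd, ← mem_preimage, tperm_preimage] at h2
    exact ⟨h1, h2⟩
  · refine measure_mono_null (t := ⋃ i : Fin (k+1), ⋃ j : Fin (k+1), ⋃ (_ : i ≠ j), {p : (Fin k → ℝ) × (Fin k → ℝ) | (p.1 ∈ Mset k ∧ p.2 ∈ Mset k) ∧ gap p.1 i / gap p.2 i = gap p.1 j / gap p.2 j}) ?_ ?_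
    · rintro p ⟨h1, h2⟩
      by_contra h3
      simp only [mem_iUnion, mem_ofPred_eq, not_exists, not_and] at h3
      have hinj : Function.Injective fun i : Fin (k + 1) => gap p.1 i / gap p.2 i := by
        intro i j hij; by_contra hne; exact h3 i j hne ⟨h1.1, h1.2⟩ hij
      obtain ⟨σ, hσ⟩ := exists_perm_strictMono hinj
      apply h2
      rw [mem_iUnion]
      refine ⟨σ, ?_, ?_, ?_⟩
      · rw [Prod.map_fst, ← mem_preimage, tperm_preimage]; exact h1.1
      · rw [Prod.map_snd, ← mem_preimage, tperm_preimage]; exact h1.2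
      · simp only [Prod.map_fst, Prod.map_snd, gap_tperm]; exact hσ
    · simp only [measure_iUnion_null_iff]
      exact null_ratio

end

noncomputable section

lemma pi_smul_measure {α : Type*} [MeasurableSpace α] (μ : Measure α) [SigmaFinite μ] (c : ℝ) (k : ℕ) :
    Measure.pi (fun _ : Fin k => ENNReal.ofReal c • μ) = (ENNReal.ofReal c) ^ k • Measure.pi (fun _ : Fin k => μ) := by
  have : SigmaFinite (ENNReal.ofReal c • μ) := SMul.sigmaFinite (μ := μ) c.toNNReal
  apply Measure.pi_eq
  intro s hs
  simp [Measure.smul_apply, Measure.pi_pi, Finset.prod_mul_distrib]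

lemma map_comp_inj {α ι κ : Type*} [MeasurableSpace α] [Fintype ι] [Fintype κ] (ν : Measure α)
    [IsProbabilityMeasure ν] (e : κ → ι) (he : Function.Injective e) :
    MeasurePreserving (fun (x : ι → α) (j : κ) => x (e j)) (Measure.pi fun _ => ν) (Measure.pi fun _ => ν) := by
  refine ⟨by fun_prop, ?_⟩
  have h1 := ProbabilityTheory.iIndepFun_pi (μ := fun _ : ι => ν) (X := fun _ x => x) (fun i => aemeasurable_id)
  have h2 := h1.precomp he
  have h3 := (ProbabilityTheory.iIndepFun_iff_map_fun_eq_pi_map (fun i => (measurable_pi_apply (e i)).aemeasurable)).1 h2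
  rw [h3]
  congr 1
  funext j
  exact (measurePreserving_eval (fun _ : ι => ν) (e j)).map_eq

lemma pi_sigma {α ι : Type*} [MeasurableSpace α] [Fintype ι] (k : ι → ℕ) (ν : Measure α)
    [IsProbabilityMeasure ν] (C : ∀ i, Set (Fin (k i) → α)) (hC : ∀ i, MeasurableSet (C i)) :
    Measure.pi (fun _ : (Σ i, Fin (k i)) => ν) {y | ∀ i, (fun j => y ⟨i, j⟩) ∈ C i}
      = ∏ i, Measure.pi (fun _ : Fin (k i) => ν) (C i) := by
  have h := Measure.infinitePi_map_piCurry (ι := ι) (κ := fun i => Fin (k i)) (X := fun _ _ => α) (fun _ _ => ν)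
  simp only [Measure.infinitePi_eq_pi] at h
  have hms : MeasurableSet (Set.pi univ C) := MeasurableSet.univ_pi hC
  rw [← Measure.pi_pi (fun i => Measure.pi (fun _ : Fin (k i) => ν)) C, ← h,
    Measure.map_apply (MeasurableEquiv.measurable _) hms]
  congr 1
  ext y
  simp only [mem_ofPred_eq, mem_preimage, Set.mem_pi, mem_univ, forall_const]
  exact Iff.rfl

lemma unifOn_eq (K : Set (E 2)) (harea : volume K = 1) : unifOn 2 K = volume.restrict K := by
  simp [unifOn, harea]

lemma sample_eq (K : Set (E 2)) (harea : volume K = 1) (n : ℕ) :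
    sampleMeasure 2 n K = Measure.pi (fun _ : Fin n => (volume : Measure (E 2)).restrict K) := by
  simp [sampleMeasure, unifOn_eq K harea]

lemma prob_restrict (K : Set (E 2)) (harea : volume K = 1) :
    IsProbabilityMeasure ((volume : Measure (E 2)).restrict K) := ⟨by simpa using harea⟩

lemma ae_ne (K : Set (E 2)) (harea : volume K = 1) (n : ℕ) (u : ℝ × ℝ) (hu : u ≠ 0) (i j : Fin n) (hij : i ≠ j) :
    ∀ᵐ x ∂(sampleMeasure 2 n K), lc u (x i) ≠ lc u (x j) := by
  rw [sample_eq K harea, ← Measure.restrict_pi_pi]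
  apply ae_restrict_of_ae
  let L : (Fin n → E 2) →ₗ[ℝ] ℝ :=
    { toFun := fun x => lc u (x i) - lc u (x j)
      map_add' := by intro x y; simp [lc_add]; ring
      map_smul' := by intro c x; simp [lc_smul]; ring }
  have hS : LinearMap.ker L ≠ ⊤ := by
    intro hS
    have h1 : (Pi.single i (mkE u.1 u.2) : Fin n → E 2) ∈ LinearMap.ker L := by rw [hS]; trivial
    have h2 : lc u ((Pi.single i (mkE u.1 u.2) : Fin n → E 2) i) - lc u ((Pi.single i (mkE u.1 u.2) : Fin n → E 2) j) = 0 := h1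
    rw [Pi.single_eq_same, Pi.single_eq_of_ne hij.symm] at h2
    simp [lc] at h2
    apply hu
    have h3 : u.1 = 0 := by nlinarith [sq_nonneg u.1, sq_nonneg u.2]
    have h4 : u.2 = 0 := by nlinarith [sq_nonneg u.1, sq_nonneg u.2]
    exact Prod.ext h3 h4
  have := Measure.addHaar_submodule (volume : Measure (Fin n → E 2)) (LinearMap.ker L) hS
  rw [ae_iff]
  refine measure_mono_null ?_ this
  intro x hx
  simp only [mem_ofPred_eq, not_not] at hx
  change lc u (x i) - lc u (x j) = 0
  rw [hx, sub_self]

/-- strict extreme position -/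
def SP {n : ℕ} (s : Finset (Fin n)) (x : Fin n → E 2) : Prop :=
  ∀ p ∈ s, ∃ w : ℝ × ℝ, ∀ q ∈ s, q ≠ p → lc w (x q) < lc w (x p)

lemma SP.convexPosition {n : ℕ} {s : Finset (Fin n)} {x : Fin n → E 2} (h : SP s x) :
    ConvexPosition (x '' ↑s) := by
  rintro _ ⟨p, hp, rfl⟩ hmem
  obtain ⟨w, hw⟩ := h p hp
  have hc : Convex ℝ {y : E 2 | lc w y < lc w (x p)} :=
    convex_halfSpace_lt (lcL w).isLinear _
  have : convexHull ℝ (x '' ↑s \ {x p}) ⊆ {y : E 2 | lc w y < lc w (x p)} := by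
    apply convexHull_min _ hc
    rintro _ ⟨⟨q, hq, rfl⟩, hne⟩
    exact hw q hq (fun h => hne (by rw [h]; rfl))
  have h2 : lc w (x p) < lc w (x p) := this hmem
  exact lt_irrefl _ h2

lemma convexPosition_SP {n : ℕ} {s : Finset (Fin n)} {x : Fin n → E 2} (h : ConvexPosition (x '' ↑s))
    (hinj : Function.Injective x) : SP s x := by
  intro p hp
  have h1 := h (x p) ⟨p, hp, rfl⟩
  have hfin : (x '' ↑s \ {x p}).Finite := ((s.finite_toSet).image x).sdiff
  obtain ⟨f, u, hf, hu⟩ := geometric_hahn_banach_closed_point (convex_convexHull ℝ _)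
    (hfin.isCompact_convexHull ℝ).isClosed h1
  obtain ⟨w, hw⟩ := exists_lc f
  refine ⟨w, fun q hq hne => ?_⟩
  have := hf (x q) (subset_convexHull ℝ _ ⟨⟨q, hq, rfl⟩, fun h => hne (hinj h)⟩)
  rw [← hw, ← hw]; linarith

lemma ae_injective (K : Set (E 2)) (harea : volume K = 1) (n : ℕ) :
    ∀ᵐ x ∂(sampleMeasure 2 n K), Function.Injective x := by
  have : ∀ᵐ x ∂(sampleMeasure 2 n K), ∀ i j : Fin n, i ≠ j → lc (1, 0) (x i) ≠ lc (1, 0) (x j) := by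
    rw [ae_all_iff]; intro i; rw [ae_all_iff]; intro j
    by_cases hij : i = j
    · simp [hij]
    · filter_upwards [ae_ne K harea n (1, 0) (by simp) i j hij] with x hx _ using hx
  filter_upwards [this] with x hx i j hij
  by_contra hne
  exact hx i j hne (by rw [hij])

lemma isOpen_SP {n : ℕ} (s : Finset (Fin n)) : IsOpen {x : Fin n → E 2 | SP s x} := by
  have : {x : Fin n → E 2 | SP s x} = ⋂ p ∈ s, ⋃ w : ℝ × ℝ, ⋂ q ∈ s, {x | q ≠ p → lc w (x q) < lc w (x p)} := by
    ext x; simp [SP]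
  rw [this]
  refine isOpen_biInter_finset fun p _ => isOpen_iUnion fun w => isOpen_biInter_finset fun q _ => ?_
  by_cases hq : q = p
  · simp [hq]
  · simp only [ne_eq, hq, not_false_eq_true, forall_const]
    exact isOpen_lt ((continuous_lc w).comp (continuous_apply q)) ((continuous_lc w).comp (continuous_apply p))

open Classical in
/-- the number of sets in strict position -/
def numSP (n : ℕ) (x : Fin n → E 2) : ℕ :=
  (Finset.univ.filter fun s : Finset (Fin n) => 3 ≤ s.card ∧ SP s x).card

lemma num_eq {n : ℕ} {x : Fin n → E 2} (hx : Function.Injective x) : numPolytopes 2 n x = numSP n x := by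
  classical
  unfold numPolytopes numSP
  rw [← Set.ncard_coe_finset]
  congr 1
  ext s
  simp only [mem_ofPred_eq, Finset.coe_filter, Finset.mem_univ, true_and]
  exact and_congr_right fun _ => ⟨fun h => convexPosition_SP h hx, fun h => h.convexPosition⟩

lemma measurable_numSP (n : ℕ) : Measurable fun x => (numSP n x : ENNReal) := by
  classical
  have : (fun x => (numSP n x : ENNReal)) = fun x => ∑ s : Finset (Fin n),
      if 3 ≤ s.card then Set.indicator {x | SP s x} 1 x else 0 := by
    funext x
    simp only [numSP, Finset.card_filter]
    push_cast
    apply Finset.sum_congr rfl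
    intro s _
    by_cases h1 : 3 ≤ s.card <;> by_cases h2 : SP s x <;> simp [h1, h2]
  rw [this]
  refine Finset.measurable_sum _ fun s _ => ?_
  split_ifs
  · exact measurable_one.indicator (isOpen_SP s).measurableSet
  · exact measurable_const

/-- the expectation -/
def EQ (K : Set (E 2)) (n : ℕ) : ℝ := ∫ x, (numPolytopes 2 n x : ℝ) ∂(sampleMeasure 2 n K)

lemma EQ_eq (K : Set (E 2)) (harea : volume K = 1) (n : ℕ) :
    ENNReal.ofReal (EQ K n) = ∫⁻ x, (numSP n x : ENNReal) ∂(sampleMeasure 2 n K) := by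
  have := prob_restrict K harea
  have : IsProbabilityMeasure (sampleMeasure 2 n K) := by rw [sample_eq K harea]; infer_instance
  have h1 : EQ K n = ∫ x, (numSP n x : ℝ) ∂(sampleMeasure 2 n K) := by
    apply integral_congr_ae
    filter_upwards [ae_injective K harea n] with x hx
    rw [num_eq hx]
  have hmeas : Measurable fun x => (numSP n x : ℝ) := by
    have := (measurable_numSP n).ennreal_toReal
    simpa using this
  rw [h1, integral_eq_lintegral_of_nonneg_ae (Eventually.of_forall fun x => by positivity) hmeas.aestronglyMeasurable,
    ENNReal.ofReal_toReal]
  · congr 1; funext x; simp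
  · have hle : ∫⁻ x, ENNReal.ofReal (numSP n x : ℝ) ∂(sampleMeasure 2 n K) ≤ ∫⁻ x, ((Fintype.card (Finset (Fin n)) : ℕ) : ENNReal) ∂(sampleMeasure 2 n K) := by
      apply lintegral_mono
      intro x
      simp only [ENNReal.ofReal_natCast, Nat.cast_le]
      exact Finset.card_le_univ _
    refine ne_top_of_le_ne_top ?_ hle
    simp

lemma EQ_nonneg (K : Set (E 2)) (n : ℕ) : 0 ≤ EQ K n := integral_nonneg fun x => by positivity

end

noncomputable section

lemma eq_of_lc {u v : ℝ × ℝ} (h : dt u v ≠ 0) {x y : E 2} (h1 : lc u x = lc u y) (h2 : lc v x = lc v y) : x = y := by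
  unfold lc dt at *
  apply E2_ext
  · apply mul_left_cancel₀ h; linear_combination v.2 * h1 - u.2 * h2
  · apply mul_left_cancel₀ h; linear_combination u.1 * h2 - v.1 * h1

lemma gap_prefix {k : ℕ} {X Y : Fin k → ℝ} (h : (X, Y) ∈ Chain k) (m : Fin k) :
    ∃ r : ℝ, 0 < r ∧ (∀ i : ℕ, i ≤ m → 0 < - gap X i + r * gap Y i) ∧
      (∀ i : ℕ, m < i → i ≤ k → - gap X i + r * gap Y i < 0) := by
  obtain ⟨h1, h2, h3⟩ := h
  simp only at h1 h2 h3
  have hlt := h3 (show (⟨m, by omega⟩ : Fin (k+1)) < ⟨m + 1, by omega⟩ by simp)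
  simp only at hlt
  obtain ⟨r, hr1, hr2⟩ := exists_between hlt
  have hpos : 0 < gap X m / gap Y m := div_pos (h1 ⟨m, by omega⟩) (h2 ⟨m, by omega⟩)
  refine ⟨r, hpos.trans hr1, fun i hi => ?_, fun i hi hik => ?_⟩
  · have hle := h3.monotone (show (⟨i, by omega⟩ : Fin (k+1)) ≤ ⟨m, by omega⟩ by simpa using hi)
    simp only at hle
    have hY : 0 < gap Y i := h2 ⟨i, by omega⟩
    have : gap X i / gap Y i < r := hle.trans_lt hr1
    rw [div_lt_iff₀ hY] at this; linarith
  · have hle := h3.monotone (show (⟨m + 1, by omega⟩ : Fin (k+1)) ≤ ⟨i, by omega⟩ by simp; omega)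
    simp only at hle
    have hY : 0 < gap Y i := h2 ⟨i, by omega⟩
    have : r < gap X i / gap Y i := hr2.trans_le hle
    rw [lt_div_iff₀ hY] at this; linarith

lemma chain_max {k : ℕ} {X Y : Fin k → ℝ} (h : (X, Y) ∈ Chain k) (m : Fin k) :
    ∃ r : ℝ, 0 < r ∧ ∀ l : ℕ, l ≤ k + 1 → l ≠ m + 1 →
      - extS X l + r * extS Y l < - extS X (m + 1) + r * extS Y (m + 1) := by
  obtain ⟨r, hr, h1, h2⟩ := gap_prefix h m
  refine ⟨r, hr, fun l hl hne => ?_⟩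
  have key : ∀ d i : ℕ, i ≤ m → (m : ℕ) - i = d → - extS X i + r * extS Y i < - extS X (m + 1) + r * extS Y (m + 1) := by
    intro d
    induction d with
    | zero =>
      intro i hi hd
      have : i = m := by omega
      subst this
      have := h1 m le_rfl
      unfold gap at this; linarith
    | succ d ih =>
      intro i hi hd
      have h3 := ih (i + 1) (by omega) (by omega)
      have := h1 i hi
      unfold gap at this; linarith
  have key2 : ∀ i, i + (m + 2) ≤ k + 1 → - extS X (i + (m + 2)) + r * extS Y (i + (m + 2)) < - extS X (m + 1) + r * extS Y (m + 1) := by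
    intro i
    induction i with
    | zero =>
      intro hi
      have := h2 (m + 1) (by omega) (by omega)
      unfold gap at this
      rw [zero_add, show (m:ℕ) + 2 = m + 1 + 1 from rfl]; linarith
    | succ i ih =>
      intro hi
      have h3 := ih (by omega)
      have := h2 (i + (m + 2)) (by omega) (by omega)
      unfold gap at this
      rw [show i + 1 + ((m:ℕ) + 2) = i + (m + 2) + 1 by ring]; linarith
  rcases Nat.lt_or_ge l (m + 1) with hlt | hge
  · exact key _ l (by omega) rfl
  · obtain ⟨i, rfl⟩ : ∃ i, l = i + (m + 2) := ⟨l - (m + 2), by omega⟩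
    exact key2 i hl

lemma chain_le {k : ℕ} {X Y : Fin k → ℝ} (h : (X, Y) ∈ Chain k) (m : Fin k) : X m ≤ Y m := by
  obtain ⟨r, hr, hm⟩ := chain_max h m
  have h0 := hm 0 (by omega) (by omega)
  have h1 := hm (k + 1) le_rfl (by omega)
  rw [ext_succ, ext_succ, ext_zero, ext_zero] at h0
  rw [ext_succ, ext_succ, ext_last, ext_last] at h1
  have hY := ((mem_Mset_iff _).1 h.2.1).2 m
  simp only [mem_Ioo] at hY
  rcases le_or_gt r 1 with h2 | h2
  · nlinarith
  · nlinarith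

/-- triangle data -/
structure Tri where
  (p q c : E 2)
  (uL uR : ℝ × ℝ)

namespace Tri
variable (t : Tri)

def a : ℝ := lc t.uL t.p - lc t.uL t.q
def b : ℝ := lc t.uR t.q - lc t.uR t.p
def T : ℝ := t.a * t.b / (2 * dt t.uL t.uR)
def Xc (x : E 2) : ℝ := (lc t.uL t.p - lc t.uL x) / t.a
def Yc (x : E 2) : ℝ := (lc t.uR x - lc t.uR t.p) / t.b

def Ok : Prop := lc t.uL t.c = lc t.uL t.p ∧ lc t.uR t.c = lc t.uR t.q ∧ 0 < t.a ∧ 0 < t.b ∧ 0 < dt t.uL t.uR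

def ChainIn (k : ℕ) : Set (Fin k → E 2) := {x | ((fun i => t.Xc (x i)), fun i => t.Yc (x i)) ∈ Chain k}

variable {t}

lemma Ok.T_pos (h : t.Ok) : 0 < t.T := by
  obtain ⟨_, _, h1, h2, h3⟩ := h
  unfold T; positivity

lemma continuous_Xc : Continuous t.Xc := (continuous_const.sub (continuous_lc _)).div_const _
lemma continuous_Yc : Continuous t.Yc := ((continuous_lc _).sub continuous_const).div_const _

lemma measurableSet_ChainIn (k : ℕ) : MeasurableSet (t.ChainIn k) := by
  have : Measurable fun x : Fin k → E 2 => ((fun i => t.Xc (x i)), fun i => t.Yc (x i)) := by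
    refine Measurable.prodMk ?_ ?_
    · exact measurable_pi_lambda _ fun i => continuous_Xc.measurable.comp (measurable_pi_apply i)
    · exact measurable_pi_lambda _ fun i => continuous_Yc.measurable.comp (measurable_pi_apply i)
  exact this measurableSet_Chain

lemma vol_ChainIn (ha : 0 < t.a) (hb : 0 < t.b) (hd : 0 < dt t.uL t.uR) (k : ℕ) :
    volume (t.ChainIn k) = ENNReal.ofReal (2 * t.T) ^ k * volume (Chain k) := by
  set u : ℝ × ℝ := (-t.uL.1 / t.a, -t.uL.2 / t.a)
  set v : ℝ × ℝ := (t.uR.1 / t.b, t.uR.2 / t.b)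
  have hdt : dt u v = - (dt t.uL t.uR / (t.a * t.b)) := by
    simp only [dt, u, v]; field_simp; ring
  set ψ := cmap u v (lc t.uL t.p / t.a) (-lc t.uR t.p / t.b) with hψ
  have hψe : ∀ x, ψ x = (t.Xc x, t.Yc x) := by
    intro x
    simp only [hψ, cmap, Xc, Yc, Prod.mk.injEq]
    constructor
    · simp only [lc, u]; ring
    · simp only [lc, v]; ring
  have hne : dt u v ≠ 0 := by rw [hdt, neg_ne_zero]; positivity
  have hc : |dt u v|⁻¹ = 2 * t.T := by
    rw [hdt, abs_neg, abs_of_pos (by positivity)]; unfold T; field_simp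
  have hmap := map_cmap u v (lc t.uL t.p / t.a) (-lc t.uR t.p / t.b) hne
  rw [← hψ, hc] at hmap
  have hψm : Measurable ψ := (continuous_cmap _ _ _ _).measurable
  have hsf : SigmaFinite (Measure.map ψ (volume : Measure (E 2))) := by
    rw [hmap]; exact SMul.sigmaFinite (μ := (volume : Measure (ℝ × ℝ))) (2 * t.T).toNNReal
  have h1 : Measure.map (fun (x : Fin k → E 2) i => ψ (x i)) volume = ENNReal.ofReal (2 * t.T) ^ k • (volume : Measure (Fin k → ℝ × ℝ)) := by
    have := Measure.pi_map_pi (μ := fun _ : Fin k => (volume : Measure (E 2))) (f := fun _ => ψ) (hμ := fun _ => hsf) (fun _ => hψm.aemeasurable)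
    rw [hmap] at this
    rw [pi_smul_measure] at this
    exact this
  have h2 := volume_measurePreserving_arrowProdEquivProdArrow ℝ ℝ (Fin k)
  have h3 : t.ChainIn k = (fun (x : Fin k → E 2) i => ψ (x i)) ⁻¹' ((MeasurableEquiv.arrowProdEquivProdArrow ℝ ℝ (Fin k)) ⁻¹' Chain k) := by
    ext x
    simp only [ChainIn, mem_preimage, mem_ofPred_eq, hψe]
    exact Iff.rfl
  have h4 : Measurable (fun (x : Fin k → E 2) i => ψ (x i)) := measurable_pi_lambda _ fun i => hψm.comp (measurable_pi_apply i)
  rw [h3, ← Measure.map_apply h4 (h2.measurable measurableSet_Chain), h1,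
    Measure.smul_apply, h2.measure_preimage measurableSet_Chain.nullMeasurableSet]
  rfl

/-- the closed triangle -/
def InT (t : Tri) (x : E 2) : Prop := ∃ α β γ : ℝ, 0 ≤ α ∧ 0 ≤ β ∧ 0 ≤ γ ∧ α + β + γ = 1 ∧ x = α • t.p + β • t.q + γ • t.c

lemma InT.of_coord (h : t.Ok) {x : E 2} (h1 : 0 ≤ t.Xc x) (h2 : t.Xc x ≤ t.Yc x) (h3 : t.Yc x ≤ 1) : t.InT x := by
  obtain ⟨e1, e2, ha, hb, hd⟩ := h
  refine ⟨1 - t.Yc x, t.Xc x, t.Yc x - t.Xc x, by linarith, h1, by linarith, by ring, ?_⟩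
  have eX : lc t.uL x = lc t.uL t.p - t.a * t.Xc x := by unfold Xc; field_simp; ring
  have eY : lc t.uR x = lc t.uR t.p + t.b * t.Yc x := by unfold Yc; field_simp; ring
  apply eq_of_lc hd.ne'
  · simp only [lc_add, lc_smul]; rw [e1, eX]; unfold a; ring
  · simp only [lc_add, lc_smul]; rw [e2, eY]; unfold b; ring

lemma InT.mem {K : Set (E 2)} (hK : Convex ℝ K) {x : E 2} (h : t.InT x) (hp : t.p ∈ K) (hq : t.q ∈ K) (hc : t.c ∈ K) : x ∈ K := by
  obtain ⟨α, β, γ, h1, h2, h3, h4, rfl⟩ := h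
  have := hK.sum_mem (t := Finset.univ) (w := ![α, β, γ]) (z := ![t.p, t.q, t.c]) (by intro i _; fin_cases i <;> simpa)
    (by simp [Fin.sum_univ_three, h4]) (by intro i _; fin_cases i <;> simpa)
  simpa [Fin.sum_univ_three] using this

lemma InT.lc_le {x : E 2} (h : t.InT x) (w : ℝ × ℝ) (M : ℝ) (hp : lc w t.p ≤ M) (hq : lc w t.q ≤ M) (hc : lc w t.c ≤ M) : lc w x ≤ M := by
  obtain ⟨α, β, γ, h1, h2, h3, h4, rfl⟩ := h
  simp only [lc_add, lc_smul]
  calc α * lc w t.p + β * lc w t.q + γ * lc w t.c ≤ α * M + β * M + γ * M := by gcongr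
    _ = M := by rw [← add_mul, ← add_mul, h4, one_mul]

/-- combination of the two functionals -/
def w (t : Tri) (α β : ℝ) : ℝ × ℝ := (α * t.uL.1 + β * t.uR.1, α * t.uL.2 + β * t.uR.2)

lemma lc_w (α β : ℝ) (x : E 2) : lc (t.w α β) x = α * lc t.uL x + β * lc t.uR x := by
  simp [lc, w]; ring

end Tri

/-- configuration of triangles in convex position -/
def Cfg {ι : Type} (K : Set (E 2)) (t : ι → Tri) : Prop :=
  (∀ i, (t i).Ok ∧ (t i).p ∈ K ∧ (t i).q ∈ K ∧ (t i).c ∈ K) ∧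
  ∀ i j, i ≠ j → ∀ α β : ℝ, 0 ≤ α → 0 ≤ β → ∀ r, (r = (t i).p ∨ r = (t i).q ∨ r = (t i).c) →
    lc ((t j).w α β) r ≤ max (lc ((t j).w α β) (t j).p) (lc ((t j).w α β) (t j).q)

lemma Cfg.compat {ι : Type} {K : Set (E 2)} {t : ι → Tri} (h : Cfg K t) {i j : ι} (hij : i ≠ j) {α β : ℝ} (hα : 0 ≤ α)
    (hβ : 0 ≤ β) {x : E 2} (hx : (t i).InT x) :
    lc ((t j).w α β) x ≤ max (lc ((t j).w α β) (t j).p) (lc ((t j).w α β) (t j).q) :=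
  hx.lc_le _ _ (h.2 i j hij α β hα hβ _ (Or.inl rfl)) (h.2 i j hij α β hα hβ _ (Or.inr (Or.inl rfl)))
    (h.2 i j hij α β hα hβ _ (Or.inr (Or.inr rfl)))

lemma Tri.chain_inT {t : Tri} (h : t.Ok) {k : ℕ} {x : Fin k → E 2} (hx : x ∈ t.ChainIn k) (m : Fin k) : t.InT (x m) := by
  have h1 := ((mem_Mset_iff _).1 hx.1).2 m
  have h2 := ((mem_Mset_iff _).1 hx.2.1).2 m
  exact Tri.InT.of_coord h h1.1.le (chain_le hx m) h2.2.le

lemma Tri.chain_w {t : Tri} (h : t.Ok) {k : ℕ} {x : Fin k → E 2} (hx : x ∈ t.ChainIn k) (m : Fin k) :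
    ∃ α β : ℝ, 0 ≤ α ∧ 0 ≤ β ∧ max (lc (t.w α β) t.p) (lc (t.w α β) t.q) < lc (t.w α β) (x m) ∧
      ∀ l, l ≠ m → lc (t.w α β) (x l) < lc (t.w α β) (x m) := by
  obtain ⟨r, hr, hm⟩ := chain_max hx m
  obtain ⟨e1, e2, ha, hb, hd⟩ := h
  have key : ∀ y : E 2, lc (t.w (1 / t.a) (r / t.b)) y = - t.Xc y + r * t.Yc y + (lc t.uL t.p / t.a + r * lc t.uR t.p / t.b) := by
    intro y; rw [Tri.lc_w]; unfold Tri.Xc Tri.Yc; field_simp; ring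
  refine ⟨1 / t.a, r / t.b, by positivity, by positivity, ?_, ?_⟩
  · have h0 := hm 0 (by omega) (by omega)
    have h1 := hm (k + 1) le_rfl (by omega)
    rw [ext_succ, ext_succ, ext_zero, ext_zero] at h0
    rw [ext_succ, ext_succ, ext_last, ext_last] at h1
    have hp : t.Xc t.p = 0 ∧ t.Yc t.p = 0 := by simp [Tri.Xc, Tri.Yc]
    have hq : t.Xc t.q = 1 ∧ t.Yc t.q = 1 := ⟨div_self ha.ne', div_self hb.ne'⟩
    rw [key, key, key, hp.1, hp.2, hq.1, hq.2, max_lt_iff]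
    constructor <;> linarith
  · intro l hl
    have h0 := hm (l + 1) (by omega) (by intro h; apply hl; ext; omega)
    rw [ext_succ, ext_succ, ext_succ, ext_succ] at h0
    rw [key, key]; linarith

section count
variable {ι : Type} [Fintype ι] {K : Set (E 2)} {t : ι → Tri} {k : ι → ℕ}

/-- joint chains -/
def Chains (t : ι → Tri) (k : ι → ℕ) : Set ((Σ i, Fin (k i)) → E 2) := {y | ∀ i, (fun j => y ⟨i, j⟩) ∈ (t i).ChainIn (k i)}

lemma chains_w (h : Cfg K t) {y : (Σ i, Fin (k i)) → E 2} (hy : y ∈ Chains t k) (z : Σ i, Fin (k i)) :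
    ∃ α β : ℝ, 0 ≤ α ∧ 0 ≤ β ∧ max (lc ((t z.1).w α β) (t z.1).p) (lc ((t z.1).w α β) (t z.1).q) < lc ((t z.1).w α β) (y z) ∧
      ∀ z', z' ≠ z → lc ((t z.1).w α β) (y z') < lc ((t z.1).w α β) (y z) := by
  obtain ⟨i, m⟩ := z
  obtain ⟨α, β, hα, hβ, h1, h2⟩ := Tri.chain_w (h.1 i).1 (hy i) m
  refine ⟨α, β, hα, hβ, h1, ?_⟩
  rintro ⟨j, l⟩ hne
  by_cases hij : j = i
  · subst hij
    exact h2 l (by rintro rfl; exact hne rfl)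
  · exact (h.compat hij hα hβ (Tri.chain_inT (h.1 j).1 (hy j) l)).trans_lt h1

lemma measurableSet_Chains : MeasurableSet (Chains t k) := by
  have : Chains t k = ⋂ i, (fun (y : (Σ i, Fin (k i)) → E 2) (j : Fin (k i)) => y ⟨i, j⟩) ⁻¹' (t i).ChainIn (k i) := by
    ext y; simp [Chains]
  rw [this]
  exact MeasurableSet.iInter fun i => (measurable_pi_lambda _ fun j => measurable_pi_apply _) (Tri.measurableSet_ChainIn _)

lemma chains_unique (h : Cfg K t) {n : ℕ} {x : Fin n → E 2} {e e' : (Σ i, Fin (k i)) ↪ Fin n}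
    (h1 : x ∘ e ∈ Chains t k) (h2 : x ∘ e' ∈ Chains t k) (hr : Finset.univ.map e = Finset.univ.map e') : e = e' := by
  have hfst : ∀ z z', e z = e' z' → z.1 = z'.1 := by
    intro z z' hzz
    by_contra hne
    obtain ⟨α, β, hα, hβ, h3, _⟩ := chains_w h h1 z
    have h4 := h.compat (Ne.symm hne) hα hβ (Tri.chain_inT (h.1 z'.1).1 (h2 z'.1) z'.2)
    simp only [Function.comp] at h3 h4
    rw [hzz] at h3
    exact absurd h4 (not_le.2 h3)
  have hex : ∀ z, ∃ z', e' z' = e z := by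
    intro z
    have : e z ∈ Finset.univ.map e' := by rw [← hr]; simp
    simpa using this
  have hex' : ∀ z, ∃ z', e z' = e' z := by
    intro z
    have : e' z ∈ Finset.univ.map e := by rw [hr]; simp
    simpa using this
  ext1 ⟨i, m⟩
  have m1 : StrictMono fun j => (t i).Xc (x (e ⟨i, j⟩)) := ((mem_Mset_iff _).1 (h1 i).1).1
  have m2 : StrictMono fun j => (t i).Xc (x (e' ⟨i, j⟩)) := ((mem_Mset_iff _).1 (h2 i).1).1
  have hrange : range (fun j => (t i).Xc (x (e ⟨i, j⟩))) = range fun j => (t i).Xc (x (e' ⟨i, j⟩)) := by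
    apply Subset.antisymm
    · rintro _ ⟨j, rfl⟩
      obtain ⟨⟨i', j'⟩, hz⟩ := hex ⟨i, j⟩
      have := hfst _ _ hz.symm
      simp only at this
      subst this
      exact ⟨j', by simp only [hz]⟩
    · rintro _ ⟨j, rfl⟩
      obtain ⟨⟨i', j'⟩, hz⟩ := hex' ⟨i, j⟩
      have := hfst _ _ hz
      simp only at this
      subst this
      exact ⟨j', by simp only [hz]⟩
  have heq := (StrictMono.range_inj m1 m2).1 hrange
  obtain ⟨⟨i', j'⟩, hz⟩ := hex ⟨i, m⟩
  have := hfst _ _ hz.symm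
  simp only at this
  subst this
  have h5 := congrFun heq m
  simp only [← hz] at h5
  have := m2.injective h5
  rw [← hz, this]

open Classical in
lemma numSP_ge (h : Cfg K t) {n : ℕ} (x : Fin n → E 2) (hk : 3 ≤ Fintype.card (Σ i, Fin (k i))) :
    (Finset.univ.filter fun e : (Σ i, Fin (k i)) ↪ Fin n => x ∘ e ∈ Chains t k).card ≤ numSP n x := by
  unfold numSP
  apply Finset.card_le_card_of_injOn (fun e => Finset.univ.map e)
  · intro e he
    simp only [Finset.coe_filter, Finset.mem_univ, true_and, mem_ofPred_eq] at he ⊢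
    refine ⟨by rw [Finset.card_map, Finset.card_univ]; exact hk, ?_⟩
    intro p hp
    obtain ⟨z, _, rfl⟩ := Finset.mem_map.1 hp
    obtain ⟨α, β, _, _, _, h3⟩ := chains_w h he z
    refine ⟨(t z.1).w α β, fun q hq hne => ?_⟩
    obtain ⟨z', _, rfl⟩ := Finset.mem_map.1 hq
    exact h3 z' (by rintro rfl; exact hne rfl)
  · intro e he e' he' hee
    simp only [Finset.coe_filter, Finset.mem_univ, true_and, mem_ofPred_eq] at he he'
    exact chains_unique h he he' hee

lemma pi_chainIn (hK : Convex ℝ K) {t : Tri} (h : t.Ok) (hp : t.p ∈ K) (hq : t.q ∈ K) (hc : t.c ∈ K) (k : ℕ) :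
    Measure.pi (fun _ : Fin k => (volume : Measure (E 2)).restrict K) (t.ChainIn k) =
      ENNReal.ofReal (2 * t.T) ^ k * volume (Chain k) := by
  rw [← Measure.restrict_pi_pi, Measure.restrict_apply (Tri.measurableSet_ChainIn k), inter_eq_left.2]
  · exact Tri.vol_ChainIn h.2.2.1 h.2.2.2.1 h.2.2.2.2 k
  · intro x hx i _
    exact (Tri.chain_inT h hx i).mem hK hp hq hc

lemma EQ_ge (hK : Convex ℝ K) (harea : volume K = 1) (h : Cfg K t) (n : ℕ) (k : ι → ℕ) (hk : 3 ≤ ∑ i, k i) :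
    (n.descFactorial (∑ i, k i) : ENNReal) * ∏ i, (ENNReal.ofReal (2 * (t i).T) ^ (k i) * volume (Chain (k i)))
      ≤ ENNReal.ofReal (EQ K n) := by
  classical
  have := prob_restrict K harea
  rw [EQ_eq K harea]
  have hcard : Fintype.card (Σ i, Fin (k i)) = ∑ i, k i := by simp
  calc _ = ∑ e : (Σ i, Fin (k i)) ↪ Fin n, sampleMeasure 2 n K {x | x ∘ e ∈ Chains t k} := by
        have : ∀ e : (Σ i, Fin (k i)) ↪ Fin n, sampleMeasure 2 n K {x | x ∘ e ∈ Chains t k} =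
            ∏ i, (ENNReal.ofReal (2 * (t i).T) ^ (k i) * volume (Chain (k i))) := by
          intro e
          rw [sample_eq K harea]
          have h1 := (map_comp_inj ((volume : Measure (E 2)).restrict K) e e.injective).measure_preimage
            (measurableSet_Chains (t := t) (k := k)).nullMeasurableSet
          have h2 := pi_sigma k ((volume : Measure (E 2)).restrict K) (fun i => (t i).ChainIn (k i)) (fun i => Tri.measurableSet_ChainIn _)
          refine h1.trans (h2.trans ?_)
          apply Finset.prod_congr rfl
          intro i _
          obtain ⟨h3, h4, h5, h6⟩ := h.1 i
          exact pi_chainIn hK h3 h4 h5 h6 _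
        simp only [this]
        rw [Finset.sum_const, Finset.card_univ, Fintype.card_embedding_eq, hcard, Fintype.card_fin, nsmul_eq_mul]
    _ = ∫⁻ x, ∑ e : (Σ i, Fin (k i)) ↪ Fin n, Set.indicator {x | x ∘ e ∈ Chains t k} 1 x ∂(sampleMeasure 2 n K) := by
        have hms : ∀ e : (Σ i, Fin (k i)) ↪ Fin n, MeasurableSet {x : Fin n → E 2 | x ∘ e ∈ Chains t k} := fun e =>
          (measurable_pi_lambda _ fun j => measurable_pi_apply (e j) : Measurable fun (x : Fin n → E 2) => x ∘ e) measurableSet_Chains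
        rw [lintegral_finsetSum _ (fun e _ => measurable_one.indicator (hms e))]
        apply Finset.sum_congr rfl
        intro e _
        rw [lintegral_indicator_one (hms e)]
    _ ≤ _ := by
        apply lintegral_mono
        intro x
        have h1 := numSP_ge h x (k := k) (by rw [hcard]; exact hk)
        refine le_trans (le_of_eq ?_) (Nat.cast_le.2 h1)
        rw [Finset.card_filter]
        push_cast
        apply Finset.sum_congr rfl
        intro e _
        by_cases he : x ∘ e ∈ Chains t k <;> simp [he]

end count
end

noncomputable section

lemma log_fact_le (k : ℕ) (hk : 1 ≤ k) : Real.log (k.factorial) ≤ k * Real.log k - k + Real.log k + 1 := by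
  induction k, hk using Nat.le_induction with
  | base => simp
  | succ k hk ih =>
    have hk0 : (0:ℝ) < k := by exact_mod_cast hk
    have hk1 : (0:ℝ) < k + 1 := by positivity
    rw [Nat.factorial_succ]
    push_cast
    rw [Real.log_mul (by positivity) (by positivity)]
    have h1 := Real.log_le_sub_one_of_pos (show 0 < (k:ℝ) / (k + 1) by positivity)
    rw [Real.log_div hk0.ne' hk1.ne'] at h1
    have h2 : (k + 1 : ℝ) * (Real.log k - Real.log (k + 1)) ≤ (k + 1) * (k / (k + 1) - 1) :=
      mul_le_mul_of_nonneg_left h1 hk1.le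
    have h3 : (k + 1 : ℝ) * (k / (k + 1) - 1) = -1 := by field_simp; ring
    nlinarith

lemma term_lower (y : ℝ) (hy : 0 < y) :
    3 * y - 6 - 4 * Real.log (y + 1) ≤ (⌊y⌋₊ : ℝ) * (3 * Real.log y) - 3 * Real.log (⌊y⌋₊.factorial) - Real.log (⌊y⌋₊ + 1) := by
  have hl : 0 ≤ Real.log (y + 1) := Real.log_nonneg (by linarith)
  have hfl := Nat.floor_le hy.le
  have hlt := Nat.lt_floor_add_one y
  rcases Nat.eq_zero_or_pos ⌊y⌋₊ with h0 | h0
  · rw [h0] at hlt ⊢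
    simp at hlt ⊢; linarith
  · have hk0 : (0:ℝ) < ⌊y⌋₊ := by exact_mod_cast h0
    have h1 := log_fact_le _ h0
    have h2 : Real.log ⌊y⌋₊ ≤ Real.log y := Real.log_le_log hk0 hfl
    have h3 : Real.log y ≤ Real.log (y + 1) := Real.log_le_log hy (by linarith)
    have h4 : Real.log (⌊y⌋₊ + 1) ≤ Real.log (y + 1) := Real.log_le_log (by positivity) (by linarith)
    nlinarith [mul_le_mul_of_nonneg_left h2 hk0.le]

lemma log_desc_ge (n k : ℕ) (hn : 0 < n) (hk : 2 * k ≤ n) :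
    k * Real.log n - 2 * (k:ℝ) ^ 2 / n ≤ Real.log (n.descFactorial k) := by
  have h1 : ((n:ℝ) - k) ^ k ≤ n.descFactorial k := by
    have := Nat.pow_sub_le_descFactorial n k
    have h2 : ((n + 1 - k : ℕ) : ℝ) ^ k ≤ n.descFactorial k := by exact_mod_cast this
    refine le_trans ?_ h2
    rw [Nat.cast_sub (by omega)]
    push_cast
    have hk' : (2:ℝ) * k ≤ n := by exact_mod_cast hk
    have : (0:ℝ) ≤ k := by positivity
    gcongr
    · linarith
    · linarith
  have hn0 : (0:ℝ) < n := by exact_mod_cast hn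
  have hk' : (2:ℝ) * k ≤ n := by exact_mod_cast hk
  have hk0 : (0:ℝ) ≤ k := by positivity
  have hpos : 0 < (n:ℝ) - k := by linarith
  have h3 := Real.log_le_log (by positivity) h1
  rw [Real.log_pow] at h3
  refine le_trans ?_ h3
  have h4 := Real.one_sub_inv_le_log_of_pos (show 0 < ((n:ℝ) - k) / n by positivity)
  rw [Real.log_div hpos.ne' hn0.ne', inv_div] at h4
  have h5 : -(2 * k / n) ≤ 1 - (n:ℝ) / (n - k) := by
    rw [neg_le_sub_iff_le_add, div_le_iff₀ hpos]
    have : (1 + 2 * (k:ℝ) / n) * (n - k) = n + k * (n - 2 * k) / n := by field_simp; ring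
    rw [this]
    have : 0 ≤ (k:ℝ) * (n - 2 * k) / n := by
      apply div_nonneg _ hn0.le
      apply mul_nonneg hk0; linarith
    linarith
  have h6 := mul_le_mul_of_nonneg_left (h5.trans h4) hk0
  have : (k:ℝ) * -(2 * k / n) = - (2 * k ^ 2 / n) := by ring
  rw [this] at h6
  linarith

lemma tendsto_cbrt : Tendsto (fun n : ℕ => (n:ℝ) ^ ((1:ℝ)/3)) atTop atTop :=
  (tendsto_rpow_atTop (by norm_num)).comp tendsto_natCast_atTop_atTop

lemma tendsto_log_div (c : ℝ) (hc : 0 < c) : Tendsto (fun s : ℝ => Real.log (c * s + 1) / s) atTop (nhds 0) := by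
  have h1 : Tendsto (fun x : ℝ => Real.log x / x) atTop (nhds 0) := by
    have := Real.isLittleO_log_id_atTop.tendsto_div_nhds_zero
    simpa using this
  have h2 : Tendsto (fun s : ℝ => c * s + 1) atTop atTop :=
    tendsto_atTop_add_const_right _ _ (tendsto_id.const_mul_atTop hc)
  have h3 : Tendsto (fun s : ℝ => c + s⁻¹) atTop (nhds (c + 0)) := tendsto_const_nhds.add tendsto_inv_atTop_zero
  have h4 := (h1.comp h2).mul h3
  rw [zero_mul] at h4
  refine h4.congr' ?_
  filter_upwards [eventually_gt_atTop 0] with s hs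
  simp only [Function.comp]
  field_simp

theorem lower_c {ι : Type} [Fintype ι] [Nonempty ι] {K : Set (E 2)} {t : ι → Tri} (hK : Convex ℝ K) (harea : volume K = 1)
    (h : Cfg K t) : ∀ ε > 0, ∀ᶠ n : ℕ in atTop,
      3 * ∑ i, (2 * (t i).T) ^ ((1:ℝ)/3) - ε ≤ (n:ℝ) ^ (-(1:ℝ)/3) * Real.log (EQ K n) := by
  classical
  intro ε hε
  set c : ι → ℝ := fun i => (2 * (t i).T) ^ ((1:ℝ)/3) with hc
  have hT : ∀ i, 0 < (t i).T := fun i => (h.1 i).1.T_pos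
  have hcpos : ∀ i, 0 < c i := fun i => by have := hT i; simp only [hc]; positivity
  set C := ∑ i, c i with hC
  have hCpos : 0 < C := Finset.sum_pos (fun i _ => hcpos i) Finset.univ_nonempty
  set g : ℝ → ℝ := fun s => 3 * C - 2 * C ^ 2 / s ^ 2 - (6 * Fintype.card ι) / s - ∑ i, 4 * (Real.log (c i * s + 1) / s) with hg
  have hgl : Tendsto g atTop (nhds (3 * C - 0 - 0 - ∑ i : ι, 4 * 0)) := by
    refine ((tendsto_const_nhds.sub ?_).sub ?_).sub ?_
    · exact tendsto_const_nhds.div_atTop (tendsto_pow_atTop (by norm_num))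
    · exact tendsto_const_nhds.div_atTop tendsto_id
    · exact tendsto_finsetSum _ fun i _ => (tendsto_log_div (c i) (hcpos i)).const_mul 4
  simp only [mul_zero, Finset.sum_const_zero, sub_zero] at hgl
  have hev := (hgl.comp tendsto_cbrt).eventually (lt_mem_nhds (show 3 * C - ε < 3 * C by linarith))
  obtain ⟨i0⟩ := ‹Nonempty ι›
  have hbig := (tendsto_cbrt.const_mul_atTop (hcpos i0)).eventually_ge_atTop 3
  have hbig2 := tendsto_cbrt.eventually_ge_atTop (1 + 2 * C)
  filter_upwards [hev, hbig, hbig2, eventually_gt_atTop 0] with n h1 h2 h3 hn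
  refine h1.le.trans ?_
  simp only [Function.comp]
  have hn0 : (0:ℝ) < n := by exact_mod_cast hn
  set s := (n:ℝ) ^ ((1:ℝ)/3) with hs
  have hs0 : 0 < s := by positivity
  have hs3 : s ^ 3 = n := by
    rw [hs, ← Real.rpow_natCast, ← Real.rpow_mul hn0.le]; norm_num
  have hsinv : (n:ℝ) ^ (-(1:ℝ)/3) = s⁻¹ := by
    rw [hs, ← Real.rpow_neg hn0.le]; norm_num
  have hc3 : ∀ i, c i ^ 3 = 2 * (t i).T := by
    intro i
    have := hT i
    simp only [hc]
    rw [← Real.rpow_natCast, ← Real.rpow_mul (by positivity)]; norm_num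
  set k : ι → ℕ := fun i => ⌊c i * s⌋₊ with hk
  have hkle : ∀ i, (k i : ℝ) ≤ c i * s := fun i => Nat.floor_le (by have := hcpos i; positivity)
  have hksum : ((∑ i, k i : ℕ) : ℝ) ≤ C * s := by
    push_cast; rw [hC, Finset.sum_mul]; exact Finset.sum_le_sum fun i _ => hkle i
  have hk3 : 3 ≤ ∑ i, k i := by
    have h4 : 3 ≤ k i0 := Nat.le_floor (by exact_mod_cast h2)
    exact h4.trans (Finset.single_le_sum (f := k) (fun i _ => Nat.zero_le _) (Finset.mem_univ i0))
  have hs1 : 1 ≤ s := by linarith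
  have hkn : 2 * ∑ i, k i ≤ n := by
    have : (2:ℝ) * ((∑ i, k i : ℕ) : ℝ) ≤ n := by
      rw [← hs3]
      nlinarith [mul_le_mul_of_nonneg_right h3 (by positivity : 0 ≤ s), mul_nonneg hs0.le (sub_nonneg.2 hs1), mul_nonneg (sq_nonneg s) (sub_nonneg.2 hs1)]
    exact_mod_cast this
  have hge := EQ_ge hK harea h n k hk3
  -- real version of the lower bound
  set V : ι → ℝ := fun i => (2 * (t i).T) ^ (k i) / (((k i).factorial : ℝ) ^ 2 * ((k i + 1).factorial : ℝ)) with hV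
  have hVe : ∀ i, ENNReal.ofReal (2 * (t i).T) ^ (k i) * volume (Chain (k i)) = ENNReal.ofReal (V i) := by
    intro i
    have := hT i
    rw [vol_Chain, hV]
    simp only
    rw [ENNReal.ofReal_div_of_pos (by positivity), ENNReal.ofReal_pow (by positivity), ENNReal.div_eq_inv_mul, mul_comm,
      ENNReal.ofReal_mul (p := ((k i).factorial : ℝ) ^ 2) (by positivity), ENNReal.ofReal_pow (by positivity), ENNReal.ofReal_natCast, ENNReal.ofReal_natCast]
  have hVpos : ∀ i, 0 < V i := by
    intro i
    have := hT i
    simp only [hV]; positivity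
  have hge2 : (n.descFactorial (∑ i, k i) : ℝ) * ∏ i, V i ≤ EQ K n := by
    simp only [hVe] at hge
    rw [← ENNReal.ofReal_prod_of_nonneg (fun i _ => (hVpos i).le), ← ENNReal.ofReal_natCast, ← ENNReal.ofReal_mul (by positivity)] at hge
    exact (ENNReal.ofReal_le_ofReal_iff (EQ_nonneg K n)).1 hge
  have hdpos : (0:ℝ) < n.descFactorial (∑ i, k i) := by
    have : 0 < n.descFactorial (∑ i, k i) := Nat.descFactorial_pos.2 (by omega)
    exact_mod_cast this
  have hprodpos : 0 < ∏ i, V i := Finset.prod_pos fun i _ => hVpos i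
  have hlog := Real.log_le_log (by positivity) hge2
  rw [Real.log_mul hdpos.ne' hprodpos.ne', Real.log_prod (fun i _ => (hVpos i).ne')] at hlog
  have hd := log_desc_ge n (∑ i, k i) hn hkn
  have hVlog : ∀ i, 3 * (c i * s) - 6 - 4 * Real.log (c i * s + 1) - k i * Real.log n ≤ Real.log (V i) := by
    intro i
    have hTi := hT i
    have hci := hcpos i
    have h5 := term_lower (c i * s) (by positivity)
    have h6 : Real.log (V i) = k i * Real.log (2 * (t i).T) - (2 * Real.log ((k i).factorial) + (Real.log (k i + 1) + Real.log ((k i).factorial))) := by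
      simp only [hV]
      rw [Real.log_div (by positivity) (by positivity), Real.log_pow, Real.log_mul (x := ((k i).factorial : ℝ) ^ 2) (by positivity) (by positivity), Real.log_pow,
        Nat.factorial_succ]
      push_cast
      rw [Real.log_mul (x := (k i : ℝ) + 1) (by positivity) (by positivity)]
    have h7 : 3 * Real.log (c i * s) = Real.log (2 * (t i).T) + Real.log n := by
      rw [← hc3 i, ← hs3, ← Real.log_mul (by positivity) (by positivity), ← mul_pow, Real.log_pow]; norm_num
    rw [h7] at h5
    rw [h6]
    simp only [hk] at *
    linarith
  have hsum := Finset.sum_le_sum (fun i (_ : i ∈ Finset.univ) => hVlog i)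
  have hsq : 2 * ((∑ i, k i : ℕ) : ℝ) ^ 2 / n ≤ 2 * C ^ 2 / s := by
    rw [← hs3, div_le_div_iff₀ (by positivity) hs0]
    have : ((∑ i, k i : ℕ) : ℝ) ^ 2 ≤ (C * s) ^ 2 := by gcongr
    nlinarith
  rw [hsinv, ← div_eq_inv_mul, le_div_iff₀ hs0]
  have hgs : g s * s = 3 * C * s - 2 * C ^ 2 / s - 6 * Fintype.card ι - ∑ i, 4 * Real.log (c i * s + 1) := by
    simp only [hg, sub_mul, Finset.sum_mul]
    congr 1
    · field_simp
    · apply Finset.sum_congr rfl; intro i _; field_simp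
  rw [hgs]
  have hsum2 : ∑ i, (3 * (c i * s) - 6 - 4 * Real.log (c i * s + 1) - k i * Real.log n) =
      3 * C * s - 6 * Fintype.card ι - ∑ i, 4 * Real.log (c i * s + 1) - ((∑ i, k i : ℕ) : ℝ) * Real.log n := by
    push_cast
    simp only [Finset.sum_sub_distrib, Finset.sum_const, Finset.card_univ, nsmul_eq_mul, ← Finset.mul_sum, ← Finset.sum_mul]
    rw [hC]
    ring
  rw [hsum2] at hsum
  linarith

end

noncomputable section

lemma vol_Ico_between (a b : ℝ) (f g : ℝ → ℝ) (hf : Continuous f) (hg : Continuous g) :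
    MeasurableSet {z : ℝ × ℝ | z.1 ∈ Ioo a b ∧ z.2 ∈ Ico (f z.1) (g z.1)} ∧
    volume {z : ℝ × ℝ | z.1 ∈ Ioo a b ∧ z.2 ∈ Ico (f z.1) (g z.1)} = ∫⁻ x in Ioo a b, ENNReal.ofReal (g x - f x) := by
  have hm : MeasurableSet {z : ℝ × ℝ | z.1 ∈ Ioo a b ∧ z.2 ∈ Ico (f z.1) (g z.1)} := by
    apply (measurableSet_Ioo.preimage measurable_fst).inter
    exact (measurableSet_le (hf.measurable.comp measurable_fst) measurable_snd).inter
      (measurableSet_lt measurable_snd (hg.measurable.comp measurable_fst))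
  refine ⟨hm, ?_⟩
  rw [Measure.volume_eq_prod, Measure.prod_apply hm, ← lintegral_indicator measurableSet_Ioo]
  congr 1
  funext x
  by_cases hx : x ∈ Ioo a b
  · rw [indicator_of_mem hx]
    have : Prod.mk x ⁻¹' {z : ℝ × ℝ | z.1 ∈ Ioo a b ∧ z.2 ∈ Ico (f z.1) (g z.1)} = Ico (f x) (g x) := by
      ext y; simp [hx.1, hx.2]
    rw [this, Real.volume_Ico]
  · rw [indicator_of_notMem hx]
    have : Prod.mk x ⁻¹' {z : ℝ × ℝ | z.1 ∈ Ioo a b ∧ z.2 ∈ Ico (f z.1) (g z.1)} = ∅ := by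
      ext y
      simp only [mem_preimage, mem_ofPred_eq, mem_empty_iff_false, iff_false]
      exact fun h => hx h.1
    rw [this, measure_empty]

namespace Tri
variable (t : Tri)
def Pc (x : E 2) : ℝ := t.Xc x + t.Yc x - 1
def Qc (x : E 2) : ℝ := t.Xc x + 1 - t.Yc x
variable {t}

lemma continuous_Pc : Continuous t.Pc := (continuous_Xc.add continuous_Yc).sub continuous_const
lemma continuous_Qc : Continuous t.Qc := (continuous_Xc.add continuous_const).sub continuous_Yc

lemma vol_PQ (h : t.Ok) {s : Set (ℝ × ℝ)} (hs : MeasurableSet s) :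
    volume ((fun x => (t.Pc x, t.Qc x)) ⁻¹' s) = ENNReal.ofReal t.T * volume s := by
  obtain ⟨_, _, ha, hb, hd⟩ := h
  set u : ℝ × ℝ := (-t.uL.1 / t.a + t.uR.1 / t.b, -t.uL.2 / t.a + t.uR.2 / t.b)
  set v : ℝ × ℝ := (-t.uL.1 / t.a - t.uR.1 / t.b, -t.uL.2 / t.a - t.uR.2 / t.b)
  have hdt : dt u v = 2 * dt t.uL t.uR / (t.a * t.b) := by
    simp only [dt, u, v]; field_simp; ring
  have he : (fun x => (t.Pc x, t.Qc x)) = cmap u v (lc t.uL t.p / t.a - lc t.uR t.p / t.b - 1) (lc t.uL t.p / t.a + 1 + lc t.uR t.p / t.b) := by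
    funext x
    simp only [cmap, Pc, Qc, Xc, Yc, Prod.mk.injEq]
    constructor
    · simp only [lc, u]; ring
    · simp only [lc, v]; ring
  rw [he, vol_cmap _ _ _ _ (by rw [hdt]; positivity) hs]
  congr 2
  rw [hdt, abs_of_pos (by positivity)]; unfold T; field_simp

/-- arc point -/
def arc (t : Tri) (s : ℝ) : E 2 := ((1 - s) ^ 2 / 4) • t.p + ((1 + s) ^ 2 / 4) • t.q + ((1 - s ^ 2) / 2) • t.c

lemma continuous_arc : Continuous t.arc := by unfold arc; fun_prop

lemma arc_inT {s : ℝ} (hs : s ∈ Icc (-1:ℝ) 1) : t.InT (t.arc s) :=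
  ⟨_, _, _, by positivity, by positivity, by nlinarith [hs.1, hs.2], by ring, rfl⟩

lemma coord_comb (h : t.Ok) (α β γ : ℝ) (hs : α + β + γ = 1) :
    t.Pc (α • t.p + β • t.q + γ • t.c) = β - α ∧ t.Qc (α • t.p + β • t.q + γ • t.c) = α + β := by
  obtain ⟨e1, e2, ha, hb, hd⟩ := h
  have hX : t.Xc (α • t.p + β • t.q + γ • t.c) = β := by
    unfold Xc
    rw [div_eq_iff ha.ne']
    simp only [lc_add, lc_smul, e1, a]
    linear_combination (- lc t.uL t.p) * hs
  have hY : t.Yc (α • t.p + β • t.q + γ • t.c) = β + γ := by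
    unfold Yc
    rw [div_eq_iff hb.ne']
    simp only [lc_add, lc_smul, e2, b]
    linear_combination (lc t.uR t.p) * hs
  unfold Pc Qc
  rw [hX, hY]
  constructor <;> linarith

lemma eq_of_PQ (h : t.Ok) {x y : E 2} (h1 : t.Pc x = t.Pc y) (h2 : t.Qc x = t.Qc y) : x = y := by
  obtain ⟨e1, e2, ha, hb, hd⟩ := h
  unfold Pc Qc at *
  have hX : t.Xc x = t.Xc y := by linarith
  have hY : t.Yc x = t.Yc y := by linarith
  unfold Xc at hX
  unfold Yc at hY
  rw [div_left_inj' ha.ne'] at hX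
  rw [div_left_inj' hb.ne'] at hY
  exact eq_of_lc hd.ne' (by linarith) (by linarith)

lemma lc_PQ (h : t.Ok) (σ : ℝ) : ∃ C : ℝ, ∀ x, lc (t.w ((1 - σ) / t.a) ((1 + σ) / t.b)) x = C - (t.Qc x - σ * t.Pc x) := by
  obtain ⟨e1, e2, ha, hb, hd⟩ := h
  refine ⟨(1 - σ) * lc t.uL t.p / t.a + (1 + σ) * lc t.uR t.p / t.b + 1 + σ, fun x => ?_⟩
  rw [lc_w]; unfold Qc Pc Xc Yc; field_simp; ring

lemma vol_cap (h : t.Ok) (σ η : ℝ) (hη : 0 ≤ η) :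
    volume {x : E 2 | t.Pc x ∈ Ioo (σ - η) (σ + η) ∧ t.Qc x ∈ Ico ((t.Pc x ^ 2 + 1) / 2) (σ * t.Pc x + (1 - σ ^ 2) / 2 + η ^ 2 / 2)}
      = ENNReal.ofReal (t.T * (2 * η ^ 3 / 3)) := by
  obtain ⟨hm, hv⟩ := vol_Ico_between (σ - η) (σ + η) (fun P => (P ^ 2 + 1) / 2) (fun P => σ * P + (1 - σ ^ 2) / 2 + η ^ 2 / 2)
    (by fun_prop) (by fun_prop)
  have := vol_PQ h hm
  rw [hv, ← ofReal_integral_eq_lintegral_ofReal, ← integral_Ioc_eq_integral_Ioo, ← intervalIntegral.integral_of_le (by linarith)] at this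
  · have hi : ∫ x in (σ - η)..(σ + η), (σ * x + (1 - σ ^ 2) / 2 + η ^ 2 / 2 - (x ^ 2 + 1) / 2) = 2 * η ^ 3 / 3 := by
      rw [intervalIntegral.integral_eq_sub_of_hasDerivAt (f := fun x => σ * x ^ 2 / 2 + (1 - σ ^ 2) / 2 * x + η ^ 2 / 2 * x - (x ^ 3 / 3 + x) / 2)]
      · ring
      · intro x _
        have h1 := ((((hasDerivAt_pow 2 x).const_mul σ).div_const 2).add ((hasDerivAt_id x).const_mul ((1 - σ ^ 2) / 2))).add
          ((hasDerivAt_id x).const_mul (η ^ 2 / 2))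
        have h2 := (((hasDerivAt_pow 3 x).div_const 3).add (hasDerivAt_id x)).div_const 2
        refine (h1.sub h2).congr_deriv ?_
        norm_num; ring
      · apply Continuous.intervalIntegrable; fun_prop
    rw [hi, ← ENNReal.ofReal_mul h.T_pos.le] at this
    exact this
  · apply Continuous.integrableOn_Ioc (by fun_prop) |>.mono_set Ioo_subset_Ioc_self
  · rw [EventuallyLE, ae_restrict_iff' measurableSet_Ioo]
    refine ae_of_all _ fun x hx => ?_
    simp only [Pi.zero_apply]
    nlinarith [mul_pos (sub_pos.2 hx.1) (sub_pos.2 hx.2)]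

/-- band near the arc -/
def band (t : Tri) (η : ℝ) : Set (E 2) :=
  {x : E 2 | t.Pc x ∈ Ioo (-(1 - η)) (1 - η) ∧ t.Qc x ∈ Ico ((t.Pc x ^ 2 + 1) / 2) ((t.Pc x ^ 2 + 1 + η ^ 2) / 2)}

lemma vol_band (h : t.Ok) (η : ℝ) (hη : η ≤ 1) : MeasurableSet (t.band η) ∧
    volume (t.band η) = ENNReal.ofReal (t.T * (1 - η) * η ^ 2) := by
  obtain ⟨hm, hv⟩ := vol_Ico_between (-(1 - η)) (1 - η) (fun P => (P ^ 2 + 1) / 2) (fun P => (P ^ 2 + 1 + η ^ 2) / 2)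
    (by fun_prop) (by fun_prop)
  refine ⟨(continuous_Pc.prodMk continuous_Qc).measurable hm, ?_⟩
  have := vol_PQ h hm
  have h1 : ∀ x : ℝ, (x ^ 2 + 1 + η ^ 2) / 2 - (x ^ 2 + 1) / 2 = η ^ 2 / 2 := by intro x; ring
  simp only [h1] at hv
  rw [hv, setLIntegral_const, Real.volume_Ioo, ← ENNReal.ofReal_mul (by positivity), ← ENNReal.ofReal_mul h.T_pos.le] at this
  refine this.trans ?_
  congr 1; ring

lemma band_lt {η : ℝ} (h0 : 0 ≤ η) (h1 : η ≤ 1) {x : E 2} (hx : x ∈ t.band η) : t.Qc x < 1 := by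
  obtain ⟨⟨h2, h3⟩, h4, h5⟩ := hx
  nlinarith

lemma band_inT (h : t.Ok) {η : ℝ} (h0 : 0 ≤ η) (h1 : η ≤ 1) {x : E 2} (hx : x ∈ t.band η) : t.InT x ∧
    x ∈ convexHull ℝ (t.arc '' Icc (-1) 1) := by
  have hQ := band_lt h0 h1 hx
  obtain ⟨⟨h2, h3⟩, h4, h5⟩ := hx
  set P := t.Pc x with hP
  set Q := t.Qc x with hQ'
  have hxe : x = ((Q - P) / 2) • t.p + ((Q + P) / 2) • t.q + (1 - Q) • t.c := by
    obtain ⟨e1, e2⟩ := coord_comb h ((Q - P) / 2) ((Q + P) / 2) (1 - Q) (by ring)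
    apply eq_of_PQ h
    · rw [e1]; linarith
    · rw [e2]; linarith
  have hA : 0 ≤ Q - P := by nlinarith [sq_nonneg (P - 1)]
  have hB : 0 ≤ Q + P := by nlinarith [sq_nonneg (P + 1)]
  refine ⟨⟨_, _, _, by linarith, by linarith, by linarith, by ring, hxe⟩, ?_⟩
  have hP2 : P ^ 2 < 1 := by nlinarith
  set τ := (1 - Q) / ((1 - P ^ 2) / 2) with hτ
  have hD : 0 < (1 - P ^ 2) / 2 := by linarith
  have hτ1 : τ ≤ 1 := by rw [hτ, div_le_one hD]; linarith
  have hτ0 : 0 ≤ τ := div_nonneg (by linarith) hD.le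
  have hτe : τ * ((1 - P ^ 2) / 2) = 1 - Q := div_mul_cancel₀ _ hD.ne'
  have hc := convex_convexHull ℝ (t.arc '' Icc (-1) 1)
  have m1 : t.arc P ∈ convexHull ℝ (t.arc '' Icc (-1) 1) := subset_convexHull _ _ ⟨P, ⟨by nlinarith, by nlinarith⟩, rfl⟩
  have m2 : t.p ∈ convexHull ℝ (t.arc '' Icc (-1) 1) := subset_convexHull _ _ ⟨-1, ⟨by norm_num, by norm_num⟩, by norm_num [arc]⟩
  have m3 : t.q ∈ convexHull ℝ (t.arc '' Icc (-1) 1) := subset_convexHull _ _ ⟨1, ⟨by norm_num, by norm_num⟩, by norm_num [arc]⟩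
  have m4 := hc m2 m3 (show 0 ≤ (1 - P) / 2 by nlinarith) (show 0 ≤ (1 + P) / 2 by nlinarith) (by ring)
  have m5 := hc m1 m4 hτ0 (sub_nonneg.2 hτ1) (by ring)
  convert m5 using 1
  rw [hxe]
  unfold arc
  have c1 : (Q - P) / 2 = τ * ((1 - P) ^ 2 / 4) + (1 - τ) * ((1 - P) / 2) := by linear_combination (1/2) * hτe
  have c2 : (Q + P) / 2 = τ * ((1 + P) ^ 2 / 4) + (1 - τ) * ((1 + P) / 2) := by linear_combination (1/2) * hτe
  rw [c1, c2, ← hτe]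
  module

end Tri

section partd
variable {ι : Type} {K : Set (E 2)} {t : ι → Tri}

/-- convex hull of the arcs -/
def arcHull (t : ι → Tri) : Set (E 2) := closure (convexHull ℝ (⋃ i, (t i).arc '' Icc (-1) 1))

lemma arcHull_le (h : Cfg K t) (j : ι) {σ : ℝ} (hσ : σ ∈ Icc (-1:ℝ) 1) {x : E 2} (hx : x ∈ arcHull t) :
    (1 - σ ^ 2) / 2 ≤ (t j).Qc x - σ * (t j).Pc x := by
  have hok := (h.1 j).1
  obtain ⟨C, hC⟩ := Tri.lc_PQ hok σ
  set W := (t j).w ((1 - σ) / (t j).a) ((1 + σ) / (t j).b) with hW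
  suffices hsub : arcHull t ⊆ {x | lc W x ≤ C - (1 - σ ^ 2) / 2} by
    have := hsub hx
    rw [mem_ofPred_eq, hC] at this
    linarith
  apply closure_minimal _ (isClosed_le (continuous_lc W) continuous_const)
  apply convexHull_min
  · apply iUnion_subset
    rintro i _ ⟨s, hs, rfl⟩
    rw [mem_ofPred_eq]
    by_cases hij : i = j
    · subst hij
      rw [hC]
      obtain ⟨e1, e2⟩ := Tri.coord_comb hok ((1 - s) ^ 2 / 4) ((1 + s) ^ 2 / 4) ((1 - s ^ 2) / 2) (by ring)
      unfold Tri.arc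
      rw [e1, e2]
      nlinarith [sq_nonneg (s - σ)]
    · have := h.compat hij (α := (1 - σ) / (t j).a) (β := (1 + σ) / (t j).b) (div_nonneg (by linarith [hσ.2]) hok.2.2.1.le)
        (div_nonneg (by linarith [hσ.1]) hok.2.2.2.1.le) (Tri.arc_inT hs)
      refine this.trans ?_
      rw [← hW]
      have ep := Tri.coord_comb hok 1 0 0 (by norm_num)
      have eq := Tri.coord_comb hok 0 1 0 (by norm_num)
      simp only [one_smul, zero_smul, add_zero, zero_add] at ep eq
      rw [hC, hC, ep.1, ep.2, eq.1, eq.2]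
      apply max_le <;> nlinarith [hσ.1, hσ.2]
  · exact (convex_Iic (C - (1 - σ ^ 2) / 2)).is_linear_preimage (f := lcL W) ⟨map_add _, map_smul _⟩

lemma arcHull_compact [Finite ι] : IsCompact (arcHull t) :=
  by
  have hc : IsCompact (⋃ i, (t i).arc '' Icc (-1) 1) := isCompact_iUnion fun _ => isCompact_Icc.image Tri.continuous_arc
  exact ((isBounded_convexHull (s := ⋃ i, (t i).arc '' Icc (-1) 1)).2 hc.isBounded).isCompact_closure

lemma arcHull_convex : Convex ℝ (arcHull t) := (convex_convexHull ℝ _).closure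

lemma arcHull_subset (hK : Convex ℝ K) (hKc : IsClosed K) (h : Cfg K t) : arcHull t ⊆ K := by
  apply closure_minimal _ hKc
  apply convexHull_min _ hK
  apply iUnion_subset
  rintro i _ ⟨s, hs, rfl⟩
  obtain ⟨_, h1, h2, h3⟩ := h.1 i
  exact (Tri.arc_inT hs).mem hK h1 h2 h3

lemma band_not_floating (h : Cfg K t) (j : ι) {η δ : ℝ} (h0 : 0 < η) (h1 : η ≤ 1) (hδ : (t j).T * (2 * η ^ 3 / 3) ≤ δ) {x : E 2}
    (hx : x ∈ (t j).band η) : x ∉ floatingBody (arcHull t) δ := by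
  rintro ⟨_, hf⟩
  obtain ⟨⟨hP1, hP2⟩, hQ1, hQ2⟩ := hx
  have hok := (h.1 j).1
  set σ := (t j).Pc x with hσ
  obtain ⟨C, hC⟩ := Tri.lc_PQ hok σ
  set W := (t j).w ((1 - σ) / (t j).a) ((1 + σ) / (t j).b) with hW
  have := hf (lcL W) (C - (1 - σ ^ 2) / 2 - η ^ 2 / 2) ?_
  · rw [lcL_apply, hC, ← hσ] at this
    nlinarith
  · refine le_trans ?_ (ENNReal.ofReal_le_ofReal hδ)
    rw [← Tri.vol_cap hok σ η h0.le]
    apply measure_mono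
    rintro y ⟨hyS, hy⟩
    rw [lcL_apply, hC] at hy
    have hb : ∀ s ∈ Icc (-1:ℝ) 1, (1 - s ^ 2) / 2 ≤ (t j).Qc y - s * (t j).Pc y := fun s hs => arcHull_le h j hs hyS
    set P := (t j).Pc y with hP
    set Q := (t j).Qc y with hQ
    have hPle : P ≤ 1 := by
      by_contra hcon
      push Not at hcon
      have := hb 1 (by norm_num)
      nlinarith [mul_pos (show 0 < 1 - σ by linarith) (show 0 < P - 1 by linarith)]
    have hPge : -1 ≤ P := by
      by_contra hcon
      push Not at hcon
      have := hb (-1) (by norm_num)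
      nlinarith [mul_pos (show 0 < 1 + σ by linarith) (show 0 < - P - 1 by linarith)]
    have hq := hb P ⟨hPge, hPle⟩
    have hlt : (P - σ) ^ 2 < η ^ 2 := by nlinarith
    have := abs_lt_of_sq_lt_sq hlt h0.le
    rw [abs_lt] at this
    refine ⟨⟨by linarith, by linarith⟩, by nlinarith, by nlinarith⟩

theorem part_d [Fintype ι] (h : Cfg K t) : ∀ ε > 0, ∀ᶠ δ in nhdsWithin (0:ℝ) (Ioi 0),
    ((3:ℝ)/2) ^ ((2:ℝ)/3) * ∑ i, (t i).T ^ ((1:ℝ)/3) - ε ≤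
      ((volume (arcHull t)).toReal - (volume (floatingBody (arcHull t) δ)).toReal) / δ ^ ((2:ℝ)/3) := by
  intro ε hε
  have hT : ∀ i, 0 < (t i).T := fun i => (h.1 i).1.T_pos
  set η : ι → ℝ → ℝ := fun i δ => (3 * δ / (2 * (t i).T)) ^ ((1:ℝ)/3) with hη
  have hηt : ∀ i, Tendsto (η i) (nhdsWithin 0 (Ioi 0)) (nhds 0) := by
    intro i
    have hc : Continuous (η i) := by
      apply Continuous.rpow_const
      · fun_prop
      · intro x; right; norm_num
    have := hc.tendsto 0
    simp only [hη, mul_zero, zero_div] at this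
    rw [Real.zero_rpow (by norm_num)] at this
    exact this.mono_left nhdsWithin_le_nhds
  have hlim : Tendsto (fun δ => ((3:ℝ)/2) ^ ((2:ℝ)/3) * ∑ i, (t i).T ^ ((1:ℝ)/3) * (1 - η i δ)) (nhdsWithin 0 (Ioi 0))
      (nhds (((3:ℝ)/2) ^ ((2:ℝ)/3) * ∑ i, (t i).T ^ ((1:ℝ)/3) * (1 - 0))) :=
    (tendsto_finsetSum _ fun i _ => (tendsto_const_nhds.sub (hηt i)).const_mul _).const_mul _
  simp only [sub_zero, mul_one] at hlim
  have hev := hlim.eventually (lt_mem_nhds (show ((3:ℝ)/2) ^ ((2:ℝ)/3) * ∑ i, (t i).T ^ ((1:ℝ)/3) - ε < _ by linarith))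
  have hev2 : ∀ᶠ δ in nhdsWithin (0:ℝ) (Ioi 0), ∀ i, η i δ < 1 :=
    eventually_all.2 fun i => (hηt i).eventually (gt_mem_nhds one_pos)
  filter_upwards [hev, hev2, self_mem_nhdsWithin] with δ h1 h2 hδ
  replace hδ : 0 < δ := hδ
  refine h1.le.trans ?_
  have hη0 : ∀ i, 0 < η i δ := by intro i; have := hT i; simp only [hη]; positivity
  have hη3 : ∀ i, (t i).T * (2 * (η i δ) ^ 3 / 3) = δ := by
    intro i
    have := hT i
    have h3 : (η i δ) ^ 3 = 3 * δ / (2 * (t i).T) := by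
      simp only [hη]
      rw [← Real.rpow_natCast, ← Real.rpow_mul (by positivity)]; norm_num
    rw [h3]; field_simp
  have hη2 : ∀ i, (t i).T * (1 - η i δ) * (η i δ) ^ 2 = ((3:ℝ)/2) ^ ((2:ℝ)/3) * ((t i).T ^ ((1:ℝ)/3) * (1 - η i δ)) * δ ^ ((2:ℝ)/3) := by
    intro i
    have hTi := hT i
    have h3 : (η i δ) ^ 2 * (t i).T = ((3:ℝ)/2) ^ ((2:ℝ)/3) * (t i).T ^ ((1:ℝ)/3) * δ ^ ((2:ℝ)/3) := by
      simp only [hη]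
      rw [← Real.rpow_natCast, ← Real.rpow_mul (by positivity), show 3 * δ / (2 * (t i).T) = (3 / 2) * δ * ((t i).T)⁻¹ by field_simp,
        Real.mul_rpow (by positivity) (by positivity), Real.mul_rpow (by positivity) (by positivity), Real.inv_rpow hTi.le]
      norm_num
      have h4 : (t i).T = (t i).T ^ ((1:ℝ)/3) * (t i).T ^ ((2:ℝ)/3) := by
        rw [← Real.rpow_add hTi]; norm_num
      have h5 : (t i).T ^ ((2:ℝ)/3) ≠ 0 := by positivity
      conv_lhs => rw [mul_assoc _ _ (t i).T]; arg 2; arg 2; rw [h4]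
      field_simp
    linear_combination (1 - η i δ) * h3
  -- measures
  have hSfin : volume (arcHull t) ≠ ⊤ := (arcHull_compact (t := t)).measure_lt_top.ne
  have hB : ∀ i, MeasurableSet ((t i).band (η i δ)) := fun i => (Tri.vol_band (h.1 i).1 _ (h2 i).le).1
  have hU : MeasurableSet (⋃ i, (t i).band (η i δ)) := MeasurableSet.iUnion hB
  have hUS : (⋃ i, (t i).band (η i δ)) ⊆ arcHull t := by
    apply iUnion_subset
    intro i x hx
    exact subset_closure <| convexHull_mono (subset_iUnion (fun i => (t i).arc '' Icc (-1) 1) i) (Tri.band_inT (h.1 i).1 (hη0 i).le (h2 i).le hx).2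
  have hdisj : Pairwise (Function.onFun Disjoint fun i => (t i).band (η i δ)) := by
    intro i j hij
    rw [Function.onFun, Set.disjoint_left]
    intro x hxi hxj
    have hok := (h.1 j).1
    have hlt := Tri.band_lt (hη0 j).le (h2 j).le hxj
    have hin := (Tri.band_inT (h.1 i).1 (hη0 i).le (h2 i).le hxi).1
    obtain ⟨C, hC⟩ := Tri.lc_PQ hok 0
    have hcm := h.compat hij (α := (1 - 0) / (t j).a) (β := (1 + 0) / (t j).b) (div_nonneg (by norm_num) hok.2.2.1.le)
        (div_nonneg (by norm_num) hok.2.2.2.1.le) hin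
    have ep := Tri.coord_comb hok 1 0 0 (by norm_num)
    have eq := Tri.coord_comb hok 0 1 0 (by norm_num)
    simp only [one_smul, zero_smul, add_zero, zero_add] at ep eq
    rw [hC, hC, hC, ep.1, ep.2, eq.1, eq.2, le_max_iff] at hcm
    rcases hcm with hcm | hcm <;> linarith
  have hvolU : volume (⋃ i, (t i).band (η i δ)) = ENNReal.ofReal (∑ i, (t i).T * (1 - η i δ) * (η i δ) ^ 2) := by
    rw [measure_iUnion hdisj hB, tsum_fintype, ENNReal.ofReal_sum_of_nonneg]
    · exact Finset.sum_congr rfl fun i _ => (Tri.vol_band (h.1 i).1 _ (h2 i).le).2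
    · intro i _
      have := hT i
      have := h2 i
      have : 0 ≤ 1 - η i δ := by linarith
      positivity
  have hle : volume (floatingBody (arcHull t) δ) ≤ volume (arcHull t) - volume (⋃ i, (t i).band (η i δ)) := by
    rw [← measure_sdiff hUS hU.nullMeasurableSet (ne_top_of_le_ne_top hSfin (measure_mono hUS))]
    apply measure_mono
    intro x hx
    refine ⟨hx.1, ?_⟩
    rw [mem_iUnion]
    rintro ⟨i, hi⟩
    exact band_not_floating h i (hη0 i) (h2 i).le (hη3 i).le hi hx
  have hle2 := ENNReal.toReal_mono (ne_top_of_le_ne_top hSfin tsub_le_self) hle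
  rw [ENNReal.toReal_sub_of_le (measure_mono hUS) hSfin, hvolU, ENNReal.toReal_ofReal] at hle2
  · rw [le_div_iff₀ (by positivity)]
    simp only [hη2, ← Finset.sum_mul, ← Finset.mul_sum] at hle2
    linarith
  · apply Finset.sum_nonneg
    intro i _
    have := hT i
    have := h2 i
    have : 0 ≤ 1 - η i δ := by linarith
    positivity

end partd
end

noncomputable section

/-- converse chain lemma in coordinates -/
lemma chain_of_max {k : ℕ} {X Y : Fin k → ℝ} (hX : StrictMono X) (hX0 : ∀ i, 0 < X i) (hY1 : ∀ i, Y i < 1)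
    (hw : ∀ i, ∃ μ ν : ℝ, 0 < μ ∧ 0 < ν ∧ 0 < - μ * X i + ν * Y i ∧ - μ + ν < - μ * X i + ν * Y i ∧
      ∀ l, l ≠ i → - μ * X l + ν * Y l < - μ * X i + ν * Y i) : (X, Y) ∈ Chain k := by
  have hMX : X ∈ Mset k := by
    rw [mem_Mset_iff]
    refine ⟨hX, fun j => ⟨hX0 j, ?_⟩⟩
    obtain ⟨μ, ν, hμ, hν, h1, h2, _⟩ := hw j
    have := hY1 j
    by_contra hcon
    push Not at hcon
    nlinarith
  have hMY : Y ∈ Mset k := by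
    rw [mem_Mset_iff]
    refine ⟨fun i j hij => ?_, fun j => ⟨?_, hY1 j⟩⟩
    · obtain ⟨μ, ν, hμ, hν, h1, h2, h3⟩ := hw j
      have := h3 i hij.ne
      have := hX hij
      by_contra hcon
      push Not at hcon
      nlinarith
    · obtain ⟨μ, ν, hμ, hν, h1, h2, _⟩ := hw j
      have := hX0 j
      by_contra hcon
      push Not at hcon
      nlinarith
  refine ⟨hMX, hMY, ?_⟩
  rw [Fin.strictMono_iff_lt_succ]
  intro i
  obtain ⟨μ, ν, hμ, hν, h1, h2, h3⟩ := hw i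
  have key : ∀ l : ℕ, l ≤ k + 1 → l ≠ i + 1 → - μ * extS X l + ν * extS Y l < - μ * extS X (i + 1) + ν * extS Y (i + 1) := by
    intro l hl hne
    rw [ext_succ, ext_succ]
    rcases Nat.eq_zero_or_pos l with rfl | h0
    · simpa using h1
    · rcases Nat.lt_or_ge k l with h | h
      · have : l = k + 1 := by omega
        subst this
        rw [ext_last, ext_last]; linarith
      · obtain ⟨l', rfl⟩ : ∃ l', l = l' + 1 := ⟨l - 1, by omega⟩
        have e1 := ext_succ X ⟨l', by omega⟩
        have e2 := ext_succ Y ⟨l', by omega⟩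
        simp only at e1 e2
        rw [e1, e2]
        apply h3
        intro hcon
        apply hne
        rw [← hcon]
  have a1 := key i (by omega) (by omega)
  have a2 := key (i + 2) (by omega) (by omega)
  have p1 : 0 < gap Y i := hMY ⟨i, by omega⟩
  have p2 : 0 < gap Y (i + 1) := hMY ⟨i + 1, by omega⟩
  have e1 : μ * gap X i < ν * gap Y i := by unfold gap; linarith
  have e2 : ν * gap Y (i + 1) < μ * gap X (i + 1) := by unfold gap; linarith
  have f1 : gap X i / gap Y i < ν / μ := by
    rw [div_lt_div_iff₀ p1 hμ]; linarith
  have f2 : ν / μ < gap X (i + 1) / gap Y (i + 1) := by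
    rw [div_lt_div_iff₀ hμ p2]; linarith
  simpa using f1.trans f2

/-- triangle from two points and two functionals -/
def mkTri (uL uR : ℝ × ℝ) (p q : E 2) : Tri where
  p := p
  q := q
  c := mkE ((lc uL p * uR.2 - lc uR q * uL.2) / dt uL uR) ((lc uR q * uL.1 - lc uL p * uR.1) / dt uL uR)
  uL := uL
  uR := uR

lemma mkTri_c {uL uR : ℝ × ℝ} (hd : dt uL uR ≠ 0) (p q : E 2) :
    lc uL (mkTri uL uR p q).c = lc uL p ∧ lc uR (mkTri uL uR p q).c = lc uR q := by
  constructor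
  · conv_lhs => unfold lc
    simp only [mkTri, mkE_zero, mkE_one]
    generalize lc uL p = A
    generalize lc uR q = B
    field_simp
    unfold dt; ring
  · conv_lhs => unfold lc
    simp only [mkTri, mkE_zero, mkE_one]
    generalize lc uL p = A
    generalize lc uR q = B
    field_simp
    unfold dt; ring

/-- linear combination of coefficient vectors -/
lemma lc_comb {u v w : ℝ × ℝ} {x y : ℝ} (h : u = (x * v.1 + y * w.1, x * v.2 + y * w.2)) (z : E 2) :
    lc u z = x * lc v z + y * lc w z := by
  rw [h]; simp [lc]; ring

lemma core_max {a b X Y x y α β : ℝ} (ha : 0 ≤ a) (hb : 0 ≤ b) (hX : 0 ≤ X) (hY : Y ≤ b) (hxy : x < 0 ∨ y < 0)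
    (h1 : 0 ≤ - x * X + y * Y) (h2 : 0 ≤ x * (a - X) - y * (b - Y)) (hα : 0 ≤ α) (hβ : 0 ≤ β) :
    - α * X + β * Y ≤ max 0 (- α * a + β * b) := by
  by_contra hcon
  push Not at hcon
  rw [max_lt_iff] at hcon
  obtain ⟨c1, c2⟩ := hcon
  have hYpos : 0 < Y := by
    by_contra h; push Not at h; nlinarith [mul_nonneg hα hX, mul_nonneg hβ (neg_nonneg.2 h)]
  have hXlt : X < a := by
    by_contra h; push Not at h; nlinarith [mul_nonneg hα (sub_nonneg.2 h), mul_nonneg hβ (sub_nonneg.2 hY)]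
  have hβ' : 0 < β := by
    rcases hβ.eq_or_lt with h | h
    · subst h; nlinarith [mul_nonneg hα hX]
    · exact h
  have hα' : 0 < α := by
    rcases hα.eq_or_lt with h | h
    · subst h; nlinarith [mul_nonneg hβ (sub_nonneg.2 hY)]
    · exact h
  have c2' : β * (b - Y) < α * (a - X) := by linarith
  have c1' : α * X < β * Y := by linarith
  have hD : X * (b - Y) < Y * (a - X) := by
    have e1 : (α * X) * (β * (b - Y)) ≤ (β * Y) * (β * (b - Y)) :=
      mul_le_mul_of_nonneg_right c1'.le (mul_nonneg hβ (by linarith))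
    have e2 : (β * Y) * (β * (b - Y)) < (β * Y) * (α * (a - X)) := mul_lt_mul_of_pos_left c2' (by positivity)
    have : (α * β) * (X * (b - Y)) < (α * β) * (Y * (a - X)) := by nlinarith
    exact lt_of_mul_lt_mul_left this (by positivity)
  rcases lt_or_ge x 0 with hx | hx
  · rcases lt_or_ge y 0 with hy | hy
    · -- both negative
      have e1 : (-y) * Y ≤ (-x) * X := by linarith
      have e2 : (-x) * (a - X) ≤ (-y) * (b - Y) := by linarith
      have e3 : ((-y) * Y) * (a - X) ≤ ((-x) * X) * (a - X) := mul_le_mul_of_nonneg_right e1 (by linarith)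
      have e4 : ((-x) * (a - X)) * X ≤ ((-y) * (b - Y)) * X := mul_le_mul_of_nonneg_right e2 hX
      have e5 : (-y) * (Y * (a - X)) ≤ (-y) * (X * (b - Y)) := by nlinarith
      have := le_of_mul_le_mul_left e5 (by linarith)
      linarith
    · nlinarith [mul_pos (neg_pos.2 hx) (sub_pos.2 hXlt), mul_nonneg hy (sub_nonneg.2 hY)]
  · have hy : y < 0 := by rcases hxy with h | h; · linarith
                          · exact h
    nlinarith [mul_pos (neg_pos.2 hy) hYpos, mul_nonneg hx hX]

/-- a third point which is maximal for an outside functional cannot stick out -/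
lemma core_pts {uL uR uS : ℝ × ℝ} {x y : ℝ} (hS : uS = (x * uL.1 + y * uR.1, x * uL.2 + y * uR.2)) (hxy : x < 0 ∨ y < 0)
    {p q r : E 2} (h1 : lc uL q ≤ lc uL p) (h2 : lc uR p ≤ lc uR q) (h3 : lc uL r ≤ lc uL p) (h4 : lc uR r ≤ lc uR q)
    (h5 : lc uS p ≤ lc uS r) (h6 : lc uS q ≤ lc uS r) {α β : ℝ} (hα : 0 ≤ α) (hβ : 0 ≤ β) :
    α * lc uL r + β * lc uR r ≤ max (α * lc uL p + β * lc uR p) (α * lc uL q + β * lc uR q) := by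
  simp only [lc_comb hS] at h5 h6
  have := core_max (a := lc uL p - lc uL q) (b := lc uR q - lc uR p) (X := lc uL p - lc uL r) (Y := lc uR r - lc uR p)
    (x := x) (y := y) (α := α) (β := β) (by linarith) (by linarith) (by linarith) (by linarith) hxy (by linarith) (by linarith) hα hβ
  rw [le_max_iff] at this ⊢
  rcases this with h | h
  · left; linarith
  · right; linarith

/-- a fan of directions -/
structure Fan {m : ℕ} [NeZero m] (u : Fin m → ℝ × ℝ) : Prop where
  det_pos : ∀ j, 0 < dt (u j) (u (j + 1))
  cover : ∀ w : ℝ × ℝ, ∃ j : Fin m, ∃ α β : ℝ, 0 ≤ α ∧ 0 ≤ β ∧ w = (α * (u j).1 + β * (u (j + 1)).1, α * (u j).2 + β * (u (j + 1)).2)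
  neg : ∀ i j, i ≠ j → i ≠ j + 1 → ∃ x y : ℝ, (x < 0 ∨ y < 0) ∧ u i = (x * (u j).1 + y * (u (j + 1)).1, x * (u j).2 + y * (u (j + 1)).2)
  ne1 : ∀ j : Fin m, j + 1 ≠ j
  ne2 : ∀ j : Fin m, j + 1 + 1 ≠ j

def MM {m : ℕ} (u : Fin m → ℝ × ℝ) (y : Fin m → E 2) : Prop := ∀ i j, lc (u i) (y j) ≤ lc (u i) (y i)

def fanTri {m : ℕ} [NeZero m] (u : Fin m → ℝ × ℝ) (y : Fin m → E 2) (j : Fin m) : Tri := mkTri (u j) (u (j + 1)) (y j) (y (j + 1))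

section fan
variable {m : ℕ} [NeZero m] {u : Fin m → ℝ × ℝ} {y : Fin m → E 2}

lemma Fan.c_le (hu : Fan u) (hy : MM u y) (i k : Fin m) : lc (u k) (fanTri u y i).c ≤ lc (u k) (y k) := by
  obtain ⟨e1, e2⟩ := mkTri_c (hu.det_pos i).ne' (y i) (y (i + 1))
  change lc (u i) (fanTri u y i).c = _ at e1
  change lc (u (i+1)) (fanTri u y i).c = _ at e2
  by_cases h1 : k = i
  · subst h1; exact e1.le
  by_cases h2 : k = i + 1
  · subst h2; exact e2.le
  obtain ⟨a, b, hab, he⟩ := hu.neg k i h1 h2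
  have q1 := hy (i + 1) i
  have q2 := hy i (i + 1)
  have q3 := hy k i
  have q4 := hy k (i + 1)
  rw [lc_comb he] at q3 q4 ⊢
  rw [e1, e2]
  rcases hab with h | h
  · have := mul_le_mul_of_nonpos_left q2 h.le
    linarith
  · have := mul_le_mul_of_nonpos_left q1 h.le
    linarith

lemma Fan.compat (hu : Fan u) (hy : MM u y) {i j : Fin m} (hij : i ≠ j) {α β : ℝ} (hα : 0 ≤ α) (hβ : 0 ≤ β) {r : E 2}
    (hr : r = y i ∨ r = y (i + 1) ∨ r = (fanTri u y i).c) :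
    lc ((fanTri u y j).w α β) r ≤ max (lc ((fanTri u y j).w α β) (y j)) (lc ((fanTri u y j).w α β) (y (j + 1))) := by
  simp only [Tri.lc_w]
  have hpt : ∀ l : Fin m, α * lc (u j) (y l) + β * lc (u (j+1)) (y l) ≤
      max (α * lc (u j) (y j) + β * lc (u (j+1)) (y j)) (α * lc (u j) (y (j+1)) + β * lc (u (j+1)) (y (j+1))) := by
    intro l
    by_cases h1 : l = j
    · subst h1; exact le_max_left _ _
    by_cases h2 : l = j + 1
    · subst h2; exact le_max_right _ _
    obtain ⟨a, b, hab, he⟩ := hu.neg l j h1 h2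
    exact core_pts he hab (hy j (j+1)) (hy (j+1) j) (hy _ _) (hy _ _) (hy _ _) (hy _ _) hα hβ
  rcases hr with rfl | rfl | rfl
  · exact hpt i
  · exact hpt (i + 1)
  · obtain ⟨e1, e2⟩ := mkTri_c (hu.det_pos i).ne' (y i) (y (i + 1))
    change lc (u i) (fanTri u y i).c = _ at e1
    change lc (u (i+1)) (fanTri u y i).c = _ at e2
    change α * lc (u j) _ + β * lc (u (j+1)) _ ≤ max (α * lc (u j) (y j) + β * lc (u (j+1)) (y j)) (α * lc (u j) (y (j+1)) + β * lc (u (j+1)) (y (j+1)))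
    by_cases h2 : i = j + 1
    · obtain ⟨a, b, hab, he⟩ := hu.neg (i + 1) j (by rw [h2]; exact hu.ne2 j) (by rw [h2]; exact hu.ne1 _)
      refine core_pts he hab (hy j (j+1)) (hy (j+1) j) (hu.c_le hy _ _) (hu.c_le hy _ _) ?_ ?_ hα hβ
      · rw [e2]; exact hy _ _
      · rw [e2]; exact hy _ _
    · obtain ⟨a, b, hab, he⟩ := hu.neg i j hij h2
      refine core_pts he hab (hy j (j+1)) (hy (j+1) j) (hu.c_le hy _ _) (hu.c_le hy _ _) ?_ ?_ hα hβ
      · rw [e1]; exact hy _ _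
      · rw [e1]; exact hy _ _

lemma Fan.ab_nonneg (hy : MM u y) (j : Fin m) : 0 ≤ (fanTri u y j).a ∧ 0 ≤ (fanTri u y j).b :=
  ⟨sub_nonneg.2 (hy j (j+1)), sub_nonneg.2 (hy (j+1) j)⟩

lemma Fan.T_nonneg (hu : Fan u) (hy : MM u y) (j : Fin m) : 0 ≤ (fanTri u y j).T := by
  obtain ⟨h1, h2⟩ := Fan.ab_nonneg hy j
  have := hu.det_pos j
  change 0 < dt (fanTri u y j).uL (fanTri u y j).uR at this
  unfold Tri.T; positivity

/-- configuration from maximal points, nondegenerate triangles only -/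
lemma Fan.cfg (hu : Fan u) (hy : MM u y) {K : Set (E 2)} (hyK : ∀ j, y j ∈ K) (hcK : ∀ j, (fanTri u y j).c ∈ K) :
    Cfg K (fun j : {j : Fin m // 0 < (fanTri u y j).a ∧ 0 < (fanTri u y j).b} => fanTri u y j.1) := by
  constructor
  · rintro ⟨j, h1, h2⟩
    obtain ⟨e1, e2⟩ := mkTri_c (hu.det_pos j).ne' (y j) (y (j + 1))
    exact ⟨⟨e1, e2, h1, h2, hu.det_pos j⟩, hyK j, hyK (j+1), hcK j⟩
  · rintro ⟨i, hi⟩ ⟨j, hj⟩ hij α β hα hβ r hr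
    exact hu.compat hy (by intro h; exact hij (Subtype.ext h)) hα hβ hr

lemma Fan.sum_T (hy : MM u y) (g : ℝ → ℝ) (hg : g 0 = 0) :
    ∑ j : {j : Fin m // 0 < (fanTri u y j).a ∧ 0 < (fanTri u y j).b}, g (fanTri u y j.1).T = ∑ j, g (fanTri u y j).T := by
  have h1 := Finset.sum_subtype (F := inferInstance) (p := fun j => 0 < (fanTri u y j).a ∧ 0 < (fanTri u y j).b)
    (Finset.univ.filter fun j => 0 < (fanTri u y j).a ∧ 0 < (fanTri u y j).b) (by intro j; simp) (fun j => g (fanTri u y j).T)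
  rw [← h1]
  apply Finset.sum_filter_of_ne
  intro j _ hne
  obtain ⟨h2, h3⟩ := Fan.ab_nonneg hy j
  by_contra hcon
  apply hne
  have : (fanTri u y j).a * (fanTri u y j).b = 0 := by
    rcases h2.eq_or_lt with h | h
    · rw [← h, zero_mul]
    · rcases h3.eq_or_lt with h' | h'
      · rw [← h', mul_zero]
      · exact absurd ⟨h, h'⟩ hcon
  unfold Tri.T
  rw [this, zero_div, hg]

end fan
end

noncomputable section

section count2
variable {m : ℕ} [NeZero m] {u : Fin m → ℝ × ℝ}

lemma SP_decomp (hu : Fan u) {n : ℕ} {x : Fin n → E 2} (hinj : ∀ j, Function.Injective fun p => lc (u j) (x p))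
    {s : Finset (Fin n)} (hs : 3 ≤ s.card) (hsp : SP s x) :
    ∃ v : Fin m → Fin n, ∃ k : Fin m → Fin (n + 1), ∃ e : (Σ j, Fin (k j : ℕ)) ↪ Fin n,
      ((∀ z j, e z ≠ v j) ∧ MM u (x ∘ v) ∧ x ∘ e ∈ Chains (fanTri u (x ∘ v)) (fun j => (k j : ℕ))) ∧
      s = Finset.univ.image v ∪ Finset.univ.map e := by
  classical
  have hne : s.Nonempty := Finset.card_pos.1 (by omega)
  have hmax : ∀ j, ∃ p ∈ s, ∀ q ∈ s, lc (u j) (x q) ≤ lc (u j) (x p) := fun j => Finset.exists_max_image s _ hne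
  choose v hvs hv using hmax
  have hvlt : ∀ j, ∀ q ∈ s, q ≠ v j → lc (u j) (x q) < lc (u j) (x (v j)) := fun j q hq hqn =>
    lt_of_le_of_ne (hv j q hq) fun h => hqn (hinj j h)
  have hMM : MM u (x ∘ v) := fun i j => hv i _ (hvs j)
  have hex : ∀ p, ∃ j : Fin m, ∃ α β : ℝ, p ∈ s → (∀ j, p ≠ v j) → 0 < α ∧ 0 < β ∧ ∀ q ∈ s, q ≠ p →
      α * lc (u j) (x q) + β * lc (u (j + 1)) (x q) < α * lc (u j) (x p) + β * lc (u (j + 1)) (x p) := by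
    intro p
    by_cases hp : p ∈ s
    · obtain ⟨w, hw⟩ := hsp p hp
      obtain ⟨j, α, β, hα, hβ, he⟩ := hu.cover w
      refine ⟨j, α, β, fun _ hpv => ?_⟩
      have hw' : ∀ q ∈ s, q ≠ p →
          α * lc (u j) (x q) + β * lc (u (j + 1)) (x q) < α * lc (u j) (x p) + β * lc (u (j + 1)) (x p) := by
        intro q hq hqp
        have := hw q hq hqp
        rwa [lc_comb he, lc_comb he] at this
      refine ⟨?_, ?_, hw'⟩
      · rcases hα.eq_or_lt with h | h
        · subst h
          have h1 := hw' (v (j+1)) (hvs _) (hpv _).symm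
          have h2 := hv (j+1) p hp
          nlinarith [mul_le_mul_of_nonneg_left h2 hβ]
        · exact h
      · rcases hβ.eq_or_lt with h | h
        · subst h
          have h1 := hw' (v j) (hvs _) (hpv _).symm
          have h2 := hv j p hp
          nlinarith [mul_le_mul_of_nonneg_left h2 hα]
        · exact h
    · exact ⟨0, 0, 0, fun h => absurd h hp⟩
  choose g α β hg using hex
  set G : Fin m → Finset (Fin n) := fun j => s.filter fun p => (∀ i, p ≠ v i) ∧ g p = j with hG
  have hGcard : ∀ j, (G j).card < n + 1 := fun j => by
    have := Finset.card_le_univ (G j)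
    rw [Fintype.card_fin] at this
    omega
  -- ordering
  have hord : ∀ j, ∃ f : Fin (G j).card ↪ Fin n, (∀ i, f i ∈ G j) ∧ (∀ p ∈ G j, ∃ i, f i = p) ∧
      (fun i => x (f i)) ∈ (fanTri u (x ∘ v) j).ChainIn (G j).card := by
    intro j
    set t := fanTri u (x ∘ v) j with ht
    have ta : t.a = lc (u j) (x (v j)) - lc (u j) (x (v (j+1))) := rfl
    have tb : t.b = lc (u (j+1)) (x (v (j+1))) - lc (u (j+1)) (x (v j)) := rfl
    have tX : ∀ z, t.Xc z = (lc (u j) (x (v j)) - lc (u j) z) / t.a := fun z => rfl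
    have tY : ∀ z, t.Yc z = (lc (u (j+1)) z - lc (u (j+1)) (x (v j))) / t.b := fun z => rfl
    rcases (G j).eq_empty_or_nonempty with hemp | ⟨p0, hp0⟩
    · have h0 : (G j).card = 0 := by rw [hemp]; rfl
      have hE : IsEmpty (Fin (G j).card) := by rw [h0]; infer_instance
      refine ⟨⟨fun i => hE.elim i, fun i => hE.elim i⟩, fun i => hE.elim i, fun p hp => by rw [hemp] at hp; simp at hp, ?_⟩
      exact chain_of_max (fun i => hE.elim i) (fun i => hE.elim i) (fun i => hE.elim i) (fun i => hE.elim i)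
    · have hvne : v j ≠ v (j+1) := by
        intro hcon
        obtain ⟨q1, q2, q3⟩ := Finset.mem_filter.1 hp0
        obtain ⟨hα, hβ, h3⟩ := hg p0 q1 q2
        have h4 := h3 (v j) (hvs _) (q2 _).symm
        rw [q3] at h4
        have h5 := hv j p0 q1
        have h6 := hv (j+1) p0 q1
        rw [← hcon] at h6
        nlinarith [mul_le_mul_of_nonneg_left h5 hα.le, mul_le_mul_of_nonneg_left h6 hβ.le]
      have ha : 0 < t.a := by rw [ta]; linarith [hvlt j _ (hvs (j+1)) hvne.symm]
      have hb : 0 < t.b := by rw [tb]; linarith [hvlt (j+1) _ (hvs j) hvne]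
      set f0 := (G j).orderEmbOfFin rfl with hf0
      have hXinj : Function.Injective fun i => t.Xc (x (f0 i)) := by
        intro i i' hii
        simp only [tX] at hii
        rw [div_left_inj' ha.ne'] at hii
        exact f0.injective (hinj j (by simp only; linarith))
      obtain ⟨σ, hσ⟩ := exists_perm_strictMono hXinj
      refine ⟨σ.toEmbedding.trans f0.toEmbedding, fun i => Finset.orderEmbOfFin_mem (G j) rfl (σ i), fun p hp => ?_, ?_⟩
      · have : p ∈ Set.range f0 := by rw [hf0, Finset.range_orderEmbOfFin]; exact hp
        obtain ⟨i, hi⟩ := this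
        exact ⟨σ.symm i, by simpa using hi⟩
      · have hmem : ∀ i, f0 (σ i) ∈ G j := fun i => Finset.orderEmbOfFin_mem (G j) rfl (σ i)
        apply chain_of_max
        · exact hσ
        · intro i
          obtain ⟨q1, q2, q3⟩ := Finset.mem_filter.1 (hmem i)
          rw [tX]
          apply div_pos _ ha
          exact sub_pos.2 (hvlt j _ q1 (q2 j))
        · intro i
          obtain ⟨q1, q2, q3⟩ := Finset.mem_filter.1 (hmem i)
          rw [tY, div_lt_one hb, tb]
          have := hvlt (j+1) _ q1 (q2 (j+1))
          change lc (u (j+1)) (x (f0 (σ i))) - _ < _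
          linarith
        · intro i
          obtain ⟨q1, q2, q3⟩ := Finset.mem_filter.1 (hmem i)
          obtain ⟨hα, hβ, h3⟩ := hg _ q1 q2
          set p := f0 (σ i) with hp
          rw [q3] at h3
          have key : ∀ z : E 2, - (α p * t.a) * t.Xc z + (β p * t.b) * t.Yc z =
              (α p * lc (u j) z + β p * lc (u (j+1)) z) - (α p * lc (u j) (x (v j)) + β p * lc (u (j+1)) (x (v j))) := by
            intro z; rw [tX, tY]; field_simp; ring
          refine ⟨α p * t.a, β p * t.b, by positivity, by positivity, ?_, ?_, ?_⟩
          · change 0 < - (α p * t.a) * t.Xc (x p) + (β p * t.b) * t.Yc (x p)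
            rw [key]
            linarith [h3 (v j) (hvs j) (q2 j).symm]
          · change _ < - (α p * t.a) * t.Xc (x p) + (β p * t.b) * t.Yc (x p)
            rw [key, ta, tb]
            linarith [h3 (v (j+1)) (hvs (j+1)) (q2 (j+1)).symm]
          · intro l hl
            change - (α p * t.a) * t.Xc (x (f0 (σ l))) + (β p * t.b) * t.Yc (x (f0 (σ l))) < - (α p * t.a) * t.Xc (x p) + (β p * t.b) * t.Yc (x p)
            rw [key, key]
            have := h3 (f0 (σ l)) (Finset.mem_filter.1 (hmem l)).1 (by
              intro h; exact hl (σ.injective (f0.injective h)))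
            linarith
  choose f hf1 hf2 hf3 using hord
  have hfinj : Function.Injective fun z : (Σ j, Fin (G j).card) => f z.1 z.2 := by
    rintro ⟨j, i⟩ ⟨j', i'⟩ h
    simp only at h
    have h1 := (Finset.mem_filter.1 (hf1 j i)).2.2
    have h2 := (Finset.mem_filter.1 (hf1 j' i')).2.2
    rw [h] at h1
    have : j = j' := h1.symm.trans h2
    subst this
    rw [(f j).injective h]
  refine ⟨v, fun j => ⟨(G j).card, hGcard j⟩, ⟨fun z => f z.1 z.2, hfinj⟩, ⟨?_, hMM, ?_⟩, ?_⟩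
  · rintro ⟨j, i⟩ l
    exact (Finset.mem_filter.1 (hf1 j i)).2.1 l
  · intro j
    exact hf3 j
  · ext p
    simp only [Finset.mem_union, Finset.mem_image, Finset.mem_univ, true_and, Finset.mem_map, Function.Embedding.coeFn_mk]
    constructor
    · intro hp
      by_cases h : ∃ j, v j = p
      · exact Or.inl h
      · push Not at h
        right
        obtain ⟨i, hi⟩ := hf2 (g p) p (Finset.mem_filter.2 ⟨hp, fun j => (h j).symm, rfl⟩)
        exact ⟨⟨g p, i⟩, hi⟩
    · rintro (⟨j, rfl⟩ | ⟨⟨j, i⟩, rfl⟩)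
      · exact hvs j
      · exact (Finset.mem_filter.1 (hf1 j i)).1

/-- event for a given index pattern -/
def Ev (u : Fin m → ℝ × ℝ) {n : ℕ} (v : Fin m → Fin n) (k : Fin m → Fin (n + 1)) (e : (Σ j, Fin (k j : ℕ)) ↪ Fin n) (x : Fin n → E 2) : Prop :=
  (∀ z j, e z ≠ v j) ∧ MM u (x ∘ v) ∧ x ∘ e ∈ Chains (fanTri u (x ∘ v)) (fun j => (k j : ℕ))

open Classical in
lemma numSP_le (hu : Fan u) {n : ℕ} {x : Fin n → E 2} (hinj : ∀ j, Function.Injective fun p => lc (u j) (x p)) :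
    numSP n x ≤ ∑ v : Fin m → Fin n, ∑ k : Fin m → Fin (n + 1), (Finset.univ.filter fun e => Ev u v k e x).card := by
  unfold numSP
  have hsub : (Finset.univ.filter fun s : Finset (Fin n) => 3 ≤ s.card ∧ SP s x) ⊆
      Finset.univ.biUnion fun v : Fin m → Fin n => Finset.univ.biUnion fun k : Fin m → Fin (n + 1) =>
        (Finset.univ.filter fun e => Ev u v k e x).image fun e => Finset.univ.image v ∪ Finset.univ.map e := by
    intro s hs
    obtain ⟨h1, h2⟩ := (Finset.mem_filter.1 hs).2
    obtain ⟨v, k, e, h3, h4⟩ := SP_decomp hu hinj h1 h2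
    refine Finset.mem_biUnion.2 ⟨v, Finset.mem_univ _, Finset.mem_biUnion.2 ⟨k, Finset.mem_univ _, Finset.mem_image.2 ⟨e, ?_, h4.symm⟩⟩⟩
    exact Finset.mem_filter.2 ⟨Finset.mem_univ _, h3⟩
  refine (Finset.card_le_card hsub).trans (Finset.card_biUnion_le.trans ?_)
  refine Finset.sum_le_sum fun v _ => Finset.card_biUnion_le.trans ?_
  exact Finset.sum_le_sum fun k _ => Finset.card_image_le

end count2
end

noncomputable section

section upper
variable {m : ℕ} [NeZero m] {u : Fin m → ℝ × ℝ}

lemma vol_ChainIn_le {t : Tri} (ha : 0 ≤ t.a) (hb : 0 ≤ t.b) (hd : 0 < dt t.uL t.uR) (k : ℕ) :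
    volume (t.ChainIn k) ≤ ENNReal.ofReal (2 * t.T) ^ k * volume (Chain k) := by
  by_cases h : 0 < t.a ∧ 0 < t.b
  · exact (Tri.vol_ChainIn h.1 h.2 hd k).le
  rcases Nat.eq_zero_or_pos k with rfl | hk
  · rw [vol_Chain]
    simp only [pow_zero, Nat.factorial]
    refine (measure_mono (subset_univ _)).trans ?_
    rw [volume_pi, Measure.pi_of_empty]
    simp
  · have : t.ChainIn k = ∅ := by
      ext x
      simp only [mem_empty_iff_false, iff_false]
      intro hx
      have h1 := ((mem_Mset_iff _).1 hx.1).2 ⟨0, hk⟩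
      have h2 := ((mem_Mset_iff _).1 hx.2.1).2 ⟨0, hk⟩
      simp only [mem_Ioo, Tri.Xc, Tri.Yc] at h1 h2
      apply h
      constructor
      · rcases ha.eq_or_lt with h | h
        · rw [← h] at h1; simp at h1
        · exact h
      · rcases hb.eq_or_lt with h | h
        · rw [← h] at h2; simp at h2
        · exact h
    rw [this]; simp

lemma pi_restrict_le (K : Set (E 2)) (hK : MeasurableSet K) (k : ℕ) (S : Set (Fin k → E 2)) :
    Measure.pi (fun _ : Fin k => (volume : Measure (E 2)).restrict K) S ≤ volume S := by
  rw [← Measure.restrict_pi_pi]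
  exact Measure.restrict_apply_le _ _

lemma real_bound {s τ : ℝ} (hs : 0 ≤ s) (hτ : 0 ≤ τ) (k : ℕ) :
    (s ^ 3) ^ k * (τ ^ 3) ^ k * (((k.factorial : ℝ) ^ 2 * (k+1).factorial)⁻¹) ≤ Real.exp (3 * (s * τ)) := by
  have h1 := Real.pow_div_factorial_le_exp (x := s * τ) (by positivity) k
  have h2 : (((k.factorial : ℝ) ^ 2 * (k+1).factorial)⁻¹) ≤ ((k.factorial : ℝ) ^ 3)⁻¹ := by
    apply inv_anti₀ (by positivity)
    rw [show (k.factorial : ℝ) ^ 3 = (k.factorial : ℝ) ^ 2 * k.factorial by ring]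
    gcongr
    omega
  calc _ ≤ (s ^ 3) ^ k * (τ ^ 3) ^ k * ((k.factorial : ℝ) ^ 3)⁻¹ := by gcongr
    _ = ((s * τ) ^ k / k.factorial) ^ 3 := by field_simp; ring
    _ ≤ (Real.exp (s * τ)) ^ 3 := by gcongr
    _ = _ := by rw [← Real.exp_nat_mul]; norm_num

lemma prod_bound {n : ℕ} (hn : 0 < n) {T : Fin m → ℝ} (hT : ∀ j, 0 ≤ T j) {M : ℝ} (hM : 3 * ∑ j, (2 * T j) ^ ((1:ℝ)/3) ≤ M)
    (k : Fin m → ℕ) :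
    (n : ENNReal) ^ (∑ j, k j) * ∏ j, (ENNReal.ofReal (2 * T j) ^ (k j) * volume (Chain (k j))) ≤
      ENNReal.ofReal (Real.exp ((n:ℝ) ^ ((1:ℝ)/3) * M)) := by
  set s := (n:ℝ) ^ ((1:ℝ)/3) with hs
  have hs0 : 0 ≤ s := by positivity
  have hs3 : s ^ 3 = n := by
    rw [hs, ← Real.rpow_natCast, ← Real.rpow_mul (by positivity)]; norm_num
  have hτ3 : ∀ j, ((2 * T j) ^ ((1:ℝ)/3)) ^ 3 = 2 * T j := fun j => by
    rw [← Real.rpow_natCast, ← Real.rpow_mul (by have := hT j; positivity)]; norm_num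
  have hv : ∀ k, volume (Chain k) = ENNReal.ofReal (((k.factorial : ℝ) ^ 2 * (k+1).factorial)⁻¹) := by
    intro k
    rw [vol_Chain, ENNReal.ofReal_inv_of_pos (by positivity), ENNReal.ofReal_mul (by positivity), ENNReal.ofReal_pow (by positivity)]
    simp
  have key : (n : ENNReal) ^ (∑ j, k j) * ∏ j, (ENNReal.ofReal (2 * T j) ^ (k j) * volume (Chain (k j))) =
      ENNReal.ofReal (∏ j, ((s ^ 3) ^ k j * (((2 * T j) ^ ((1:ℝ)/3)) ^ 3) ^ k j * ((((k j).factorial : ℝ) ^ 2 * ((k j)+1).factorial)⁻¹))) := by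
    rw [ENNReal.ofReal_prod_of_nonneg (fun j _ => by have := hT j; positivity), ← Finset.prod_pow_eq_pow_sum, ← Finset.prod_mul_distrib]
    apply Finset.prod_congr rfl
    intro j _
    have h2T : 0 ≤ 2 * T j := by have := hT j; positivity
    rw [hs3, hτ3, hv]
    generalize 2 * T j = τ at h2T ⊢
    rw [ENNReal.ofReal_mul (by positivity), ENNReal.ofReal_mul (by positivity), ENNReal.ofReal_pow (by positivity),
      ENNReal.ofReal_pow (by positivity), ENNReal.ofReal_natCast, mul_assoc]
  rw [key]
  apply ENNReal.ofReal_le_ofReal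
  calc _ ≤ ∏ j, Real.exp (3 * (s * (2 * T j) ^ ((1:ℝ)/3))) := by
        apply Finset.prod_le_prod
        · intro j _; have := hT j; positivity
        · intro j _; have := hT j; exact real_bound hs0 (by positivity) _
    _ = Real.exp (s * (3 * ∑ j, (2 * T j) ^ ((1:ℝ)/3))) := by
        rw [← Real.exp_sum, ← Finset.mul_sum, ← Finset.mul_sum]; congr 1; ring
    _ ≤ _ := by gcongr

/-- the product event -/
def DD (u : Fin m → ℝ × ℝ) {V : Type} (v' : Fin m → V) (k : Fin m → ℕ) : Set ((V → E 2) × ((Σ j, Fin (k j)) → E 2)) :=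
  {p | MM u (p.1 ∘ v') ∧ p.2 ∈ Chains (fanTri u (p.1 ∘ v')) k}

lemma measurableSet_DD {V : Type} [Fintype V] (v' : Fin m → V) (k : Fin m → ℕ) : MeasurableSet (DD u v' k) := by
  have hp : ∀ (w : ℝ × ℝ) (j : V), Measurable fun p : (V → E 2) × ((Σ j, Fin (k j)) → E 2) => lc w (p.1 j) := fun w j =>
    (measurable_lc w).comp ((measurable_pi_apply j).comp measurable_fst)
  have hq : ∀ (w : ℝ × ℝ) (j), Measurable fun p : (V → E 2) × ((Σ j, Fin (k j)) → E 2) => lc w (p.2 j) := fun w j =>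
    (measurable_lc w).comp ((measurable_pi_apply j).comp measurable_snd)
  have : DD u v' k = (⋂ i, ⋂ j, {p | lc (u i) (p.1 (v' j)) ≤ lc (u i) (p.1 (v' i))}) ∩
      ⋂ j, {p | ((fun i => (fanTri u (p.1 ∘ v') j).Xc (p.2 ⟨j, i⟩)), fun i => (fanTri u (p.1 ∘ v') j).Yc (p.2 ⟨j, i⟩)) ∈ Chain (k j)} := by
    ext p; simp [DD, MM, Chains, Tri.ChainIn]
  rw [this]
  refine MeasurableSet.inter ?_ ?_
  · exact MeasurableSet.iInter fun i => MeasurableSet.iInter fun j => measurableSet_le (hp _ _) (hp _ _)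
  · refine MeasurableSet.iInter fun j => ?_
    have hm : Measurable fun p : (V → E 2) × ((Σ j, Fin (k j)) → E 2) =>
      ((fun i => (fanTri u (p.1 ∘ v') j).Xc (p.2 ⟨j, i⟩)), fun i => (fanTri u (p.1 ∘ v') j).Yc (p.2 ⟨j, i⟩)) := by
      refine Measurable.prodMk ?_ ?_
      · refine measurable_pi_lambda _ fun i => ?_
        exact ((hp (u j) (v' j)).sub (hq (u j) ⟨j, i⟩)).div ((hp (u j) (v' j)).sub (hp (u j) (v' (j+1))))
      · refine measurable_pi_lambda _ fun i => ?_
        exact ((hq (u (j+1)) ⟨j, i⟩).sub (hp (u (j+1)) (v' j))).div ((hp (u (j+1)) (v' (j+1))).sub (hp (u (j+1)) (v' j)))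
    exact hm measurableSet_Chain

lemma prob_Ev (hu : Fan u) {K : Set (E 2)} (hKm : MeasurableSet K) (harea : volume K = 1) {n : ℕ} {M : ℝ}
    (hM : ∀ y : Fin m → E 2, MM u y → (∀ j, y j ∈ K) → 3 * ∑ j, (2 * (fanTri u y j).T) ^ ((1:ℝ)/3) ≤ M)
    (v : Fin m → Fin n) (k : Fin m → Fin (n + 1)) (e : (Σ j, Fin (k j : ℕ)) ↪ Fin n) :
    (n : ENNReal) ^ (∑ j, (k j : ℕ)) * sampleMeasure 2 n K {x | Ev u v k e x} ≤ ENNReal.ofReal (Real.exp ((n:ℝ) ^ ((1:ℝ)/3) * M)) := by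
  classical
  have hn : 0 < n := by
    have := (v 0).2; omega
  have := prob_restrict K harea
  by_cases hev : ∀ z j, e z ≠ v j
  swap
  · have : {x : Fin n → E 2 | Ev u v k e x} = ∅ := by
      ext x; simp only [mem_ofPred_eq, mem_empty_iff_false, iff_false]; exact fun h => hev h.1
    rw [this]; simp
  rw [sample_eq K harea]
  let V := Set.range v
  let v' : Fin m → V := fun j => ⟨v j, mem_range_self j⟩
  let κ : V ⊕ (Σ j, Fin (k j : ℕ)) → Fin n := Sum.elim Subtype.val e
  have hκ : Function.Injective κ := by
    apply Function.Injective.sumElim Subtype.val_injective e.injective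
    rintro ⟨_, j, rfl⟩ z h
    exact hev z j h.symm
  have hmp := (measurePreserving_sumPiEquivProdPi (fun _ : V ⊕ (Σ j, Fin (k j : ℕ)) => (volume : Measure (E 2)).restrict K)).comp
    (map_comp_inj ((volume : Measure (E 2)).restrict K) κ hκ)
  have hset : {x : Fin n → E 2 | Ev u v k e x} = ((MeasurableEquiv.sumPiEquivProdPi fun _ : V ⊕ (Σ j, Fin (k j : ℕ)) => E 2) ∘
      fun (x : Fin n → E 2) (j : V ⊕ (Σ j, Fin (k j : ℕ))) => x (κ j)) ⁻¹' (DD u v' fun j => (k j : ℕ)) := by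
    ext x
    constructor
    · intro h; exact ⟨h.2.1, h.2.2⟩
    · intro h; exact ⟨hev, h.1, h.2⟩
  rw [hset, hmp.measure_preimage (measurableSet_DD v' _).nullMeasurableSet, Measure.prod_apply (measurableSet_DD v' _),
    ← lintegral_const_mul' _ _ (by simp)]
  have hae : ∀ᵐ y ∂(Measure.pi fun _ : V => (volume : Measure (E 2)).restrict K), ∀ i, y i ∈ K := by
    rw [ae_all_iff]
    intro i
    have h1 : ∀ᵐ z ∂((volume : Measure (E 2)).restrict K), z ∈ K := ae_restrict_mem hKm
    exact (measurePreserving_eval (fun _ : V => (volume : Measure (E 2)).restrict K) i).quasiMeasurePreserving.ae h1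
  have hb : ∀ᵐ y ∂(Measure.pi fun _ : V => (volume : Measure (E 2)).restrict K),
      (n : ENNReal) ^ (∑ j, (k j : ℕ)) * (Measure.pi fun _ : (Σ j, Fin (k j : ℕ)) => (volume : Measure (E 2)).restrict K)
        (Prod.mk y ⁻¹' (DD u v' fun j => (k j : ℕ))) ≤ ENNReal.ofReal (Real.exp ((n:ℝ) ^ ((1:ℝ)/3) * M)) := by
    filter_upwards [hae] with y hy
    by_cases hMM : MM u (y ∘ v')
    · have : Prod.mk y ⁻¹' (DD u v' fun j => (k j : ℕ)) = {z | ∀ i, (fun j => z ⟨i, j⟩) ∈ (fanTri u (y ∘ v') i).ChainIn (k i)} := by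
        ext z; simp [DD, hMM, Chains]
      rw [this, pi_sigma _ _ (fun i => (fanTri u (y ∘ v') i).ChainIn (k i)) (fun i => Tri.measurableSet_ChainIn _)]
      refine le_trans ?_ (prod_bound hn (fun j => hu.T_nonneg hMM j) (hM (y ∘ v') hMM fun j => hy _) fun j => (k j : ℕ))
      gcongr with j
      refine (pi_restrict_le K hKm _ _).trans ?_
      obtain ⟨h1, h2⟩ := Fan.ab_nonneg hMM j
      exact vol_ChainIn_le h1 h2 (hu.det_pos j) _
    · have : Prod.mk y ⁻¹' (DD u v' fun j => (k j : ℕ)) = ∅ := by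
        ext z; simp [DD, hMM]
      rw [this]; simp
  refine (lintegral_mono_ae hb).trans ?_
  simp

lemma EQ_le (hu : Fan u) {K : Set (E 2)} (hKm : MeasurableSet K) (harea : volume K = 1) {n : ℕ} {M : ℝ}
    (hM : ∀ y : Fin m → E 2, MM u y → (∀ j, y j ∈ K) → 3 * ∑ j, (2 * (fanTri u y j).T) ^ ((1:ℝ)/3) ≤ M) :
    EQ K n ≤ (n:ℝ) ^ m * ((n:ℝ) + 1) ^ m * Real.exp ((n:ℝ) ^ ((1:ℝ)/3) * M) := by
  classical
  have hne : ∀ j, u j ≠ 0 := by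
    intro j h
    have := hu.det_pos j
    rw [h] at this
    simp [dt] at this
  have hinj : ∀ᵐ x ∂(sampleMeasure 2 n K), ∀ j, Function.Injective fun p => lc (u j) (x p) := by
    rw [ae_all_iff]; intro j
    have : ∀ᵐ x ∂(sampleMeasure 2 n K), ∀ i l : Fin n, i ≠ l → lc (u j) (x i) ≠ lc (u j) (x l) := by
      rw [ae_all_iff]; intro i; rw [ae_all_iff]; intro l
      by_cases hij : i = l
      · simp [hij]
      · filter_upwards [ae_ne K harea n (u j) (hne j) i l hij] with x hx _ using hx
    filter_upwards [this] with x hx i l h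
    by_contra hcon
    exact hx i l hcon h
  rw [← ENNReal.ofReal_le_ofReal_iff (by positivity), EQ_eq K harea]
  set R := ENNReal.ofReal (Real.exp ((n:ℝ) ^ ((1:ℝ)/3) * M)) with hR
  have hms : ∀ v : Fin m → Fin n, ∀ k : Fin m → Fin (n+1), ∀ e, MeasurableSet {x : Fin n → E 2 | Ev u v k e x} := by
    intro v k e
    by_cases hev : ∀ z j, e z ≠ v j
    · have : {x : Fin n → E 2 | Ev u v k e x} = (fun x : Fin n → E 2 => (x, fun z => x (e z))) ⁻¹' (DD u v fun j => (k j : ℕ)) := by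
        ext x
        constructor
        · intro h; exact ⟨h.2.1, h.2.2⟩
        · intro h; exact ⟨hev, h.1, h.2⟩
      rw [this]
      exact (measurable_id.prodMk (measurable_pi_lambda _ fun z => measurable_pi_apply (e z))) (measurableSet_DD v _)
    · have : {x : Fin n → E 2 | Ev u v k e x} = ∅ := by
        ext x; simp only [mem_ofPred_eq, mem_empty_iff_false, iff_false]; exact fun h => hev h.1
      rw [this]; exact MeasurableSet.empty
  calc _ ≤ ∫⁻ x, ∑ v : Fin m → Fin n, ∑ k : Fin m → Fin (n + 1), ∑ e : (Σ j, Fin (k j : ℕ)) ↪ Fin n,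
        {x : Fin n → E 2 | Ev u v k e x}.indicator 1 x ∂(sampleMeasure 2 n K) := by
        apply lintegral_mono_ae
        filter_upwards [hinj] with x hx
        have := numSP_le hu hx
        refine (Nat.cast_le.2 this).trans (le_of_eq ?_)
        push_cast
        refine Finset.sum_congr rfl fun v _ => Finset.sum_congr rfl fun k _ => ?_
        rw [Finset.card_filter]
        push_cast
        refine Finset.sum_congr rfl fun e _ => ?_
        simp [Set.indicator_apply]
    _ = ∑ v : Fin m → Fin n, ∑ k : Fin m → Fin (n + 1), ∑ e : (Σ j, Fin (k j : ℕ)) ↪ Fin n,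
        sampleMeasure 2 n K {x : Fin n → E 2 | Ev u v k e x} := by
        have hmi := fun v k e => (measurable_one (α := ENNReal)).indicator (hms v k e)
        rw [lintegral_finsetSum _ fun v _ => Finset.measurable_sum _ fun k _ => Finset.measurable_sum _ fun e _ => hmi v k e]
        refine Finset.sum_congr rfl fun v _ => ?_
        rw [lintegral_finsetSum _ fun k _ => Finset.measurable_sum _ fun e _ => hmi v k e]
        refine Finset.sum_congr rfl fun k _ => ?_
        rw [lintegral_finsetSum _ fun e _ => hmi v k e]
        refine Finset.sum_congr rfl fun e _ => ?_
        exact lintegral_indicator_one (hms v k e)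
    _ ≤ ∑ v : Fin m → Fin n, ∑ k : Fin m → Fin (n + 1), R := by
        refine Finset.sum_le_sum fun v _ => Finset.sum_le_sum fun k _ => ?_
        have hn : 0 < n := by
          have := (v 0).2; omega
        have hn0 : (n : ENNReal) ^ (∑ j, (k j : ℕ)) ≠ 0 := by
          apply pow_ne_zero; simp; omega
        have hle : ∀ e, sampleMeasure 2 n K {x : Fin n → E 2 | Ev u v k e x} ≤ R / (n : ENNReal) ^ (∑ j, (k j : ℕ)) := by
          intro e
          rw [ENNReal.le_div_iff_mul_le (Or.inl hn0) (Or.inl (by simp)), mul_comm]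
          exact prob_Ev hu hKm harea hM v k e
        refine (Finset.sum_le_sum fun e _ => hle e).trans ?_
        rw [Finset.sum_const, Finset.card_univ, Fintype.card_embedding_eq, Fintype.card_fin, nsmul_eq_mul]
        have hcard : Fintype.card (Σ i, Fin (k i : ℕ)) = ∑ i, (k i : ℕ) := by simp
        rw [hcard]
        calc _ ≤ ((n ^ (∑ j, (k j : ℕ)) : ℕ) : ENNReal) * (R / (n : ENNReal) ^ (∑ j, (k j : ℕ))) := by
              gcongr; exact Nat.descFactorial_le_pow _ _
          _ = R := by push_cast; exact ENNReal.mul_div_cancel hn0 (by simp)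
    _ = _ := by
        simp only [Finset.sum_const, Finset.card_univ, Fintype.card_fun, Fintype.card_fin, nsmul_eq_mul]
        rw [ENNReal.ofReal_mul (by positivity), ENNReal.ofReal_mul (by positivity), ENNReal.ofReal_pow (by positivity), ENNReal.ofReal_pow (by positivity),
          ← Nat.cast_succ, ENNReal.ofReal_natCast, ENNReal.ofReal_natCast, mul_assoc]
        push_cast
        rfl

lemma upper_asym (hu : Fan u) {K : Set (E 2)} (hKm : MeasurableSet K) (harea : volume K = 1) {M : ℝ} (hM0 : 0 ≤ M)
    (hM : ∀ y : Fin m → E 2, MM u y → (∀ j, y j ∈ K) → 3 * ∑ j, (2 * (fanTri u y j).T) ^ ((1:ℝ)/3) ≤ M) :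
    ∀ ε > 0, ∀ᶠ n : ℕ in atTop, (n:ℝ)^(-(1:ℝ)/3) * Real.log (EQ K n) ≤ M + ε := by
  intro ε hε
  have hs : Tendsto (fun n : ℕ => (n:ℝ) ^ ((1:ℝ)/3)) atTop atTop := (tendsto_rpow_atTop (by norm_num)).comp tendsto_natCast_atTop_atTop
  have h1 := (tendsto_log_div 1 one_pos).comp hs
  have h2 : ∀ᶠ n : ℕ in atTop, Real.log (1 * (n:ℝ) ^ ((1:ℝ)/3) + 1) / (n:ℝ) ^ ((1:ℝ)/3) < ε / (6 * m + 1) :=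
    h1.eventually (gt_mem_nhds (by positivity))
  filter_upwards [h2, eventually_gt_atTop 0] with n h3 hn
  have hn' : (0:ℝ) < n := by exact_mod_cast hn
  set s := (n:ℝ) ^ ((1:ℝ)/3) with hs
  have hs0 : 0 < s := by positivity
  have hs3 : s ^ 3 = n := by
    rw [hs, ← Real.rpow_natCast, ← Real.rpow_mul (by positivity)]; norm_num
  have hinv : (n:ℝ)^(-(1:ℝ)/3) = s⁻¹ := by
    rw [hs, ← Real.rpow_neg hn'.le]; norm_num
  rw [hinv]
  rcases (EQ_nonneg K n).eq_or_lt with h | h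
  · rw [← h]; simp; positivity
  have hle := Real.log_le_log h (EQ_le hu hKm harea hM)
  rw [Real.log_mul (by positivity) (by positivity), Real.log_mul (by positivity) (by positivity), Real.log_exp, Real.log_pow, Real.log_pow] at hle
  have hl1 : Real.log ((n:ℝ) + 1) ≤ 3 * Real.log (s + 1) := by
    have : Real.log ((s + 1) ^ 3) = 3 * Real.log (s + 1) := by rw [Real.log_pow]; norm_num
    rw [← this]
    apply Real.log_le_log (by positivity)
    rw [← hs3]; nlinarith [sq_nonneg s]
  have hl0 : Real.log (n:ℝ) ≤ Real.log ((n:ℝ)+1) := Real.log_le_log hn' (by linarith)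
  rw [one_mul, div_lt_iff₀ hs0] at h3
  rw [inv_mul_le_iff₀ hs0]
  have hm0 : (0:ℝ) ≤ m := by positivity
  have h5 : Real.log (EQ K n) ≤ m * (6 * Real.log (s+1)) + s * M := by
    refine hle.trans ?_
    nlinarith [mul_le_mul_of_nonneg_left hl1 hm0, mul_le_mul_of_nonneg_left hl0 hm0]
  have h6 : m * (6 * Real.log (s+1)) ≤ m * (6 * (ε / (6 * m + 1) * s)) := by gcongr
  have h7 : m * (6 * (ε / (6 * m + 1) * s)) ≤ s * ε := by
    rw [show (m:ℝ) * (6 * (ε / (6 * m + 1) * s)) = (s * ε) * (6 * m / (6 * m + 1)) by field_simp]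
    apply mul_le_of_le_one_right (by positivity)
    rw [div_le_one (by positivity)]; linarith
  linarith

end upper
end

noncomputable section

lemma trig_id (A ψ θ : ℝ) : Real.cos (A + ψ) * Real.sin θ = Real.sin (θ - ψ) * Real.cos A + Real.sin ψ * Real.cos (A + θ) ∧
    Real.sin (A + ψ) * Real.sin θ = Real.sin (θ - ψ) * Real.sin A + Real.sin ψ * Real.sin (A + θ) := by
  constructor
  · rw [Real.cos_add, Real.cos_add, Real.sin_sub]; ring
  · rw [Real.sin_add, Real.sin_add, Real.sin_sub]; ring

lemma comb_div {s x y P Q W : ℝ} (hs : s ≠ 0) (h : W * s = x * P + y * Q) : W = x / s * P + y / s * Q := by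
  field_simp; linarith

def cfan (m : ℕ) (j : Fin m) : ℝ × ℝ := (Real.cos (2 * Real.pi / m * j), Real.sin (2 * Real.pi / m * j))

lemma cfan_succ (m : ℕ) [NeZero m] (hm : 5 ≤ m) (j : Fin m) :
    cfan m (j + 1) = (Real.cos (2 * Real.pi / m * j + 2 * Real.pi / m), Real.sin (2 * Real.pi / m * j + 2 * Real.pi / m)) := by
  unfold cfan
  have hm0 : (m:ℝ) ≠ 0 := by positivity
  have hv : ((j + 1 : Fin m) : ℕ) = (j + 1) % m := by
    rw [Fin.val_add]
    congr 2
    obtain ⟨k, rfl⟩ : ∃ k, m = k + 2 := ⟨m - 2, by omega⟩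
    rfl
  rcases Nat.lt_or_ge ((j:ℕ) + 1) m with h | h
  · rw [hv, Nat.mod_eq_of_lt h]
    push_cast
    rw [mul_add, mul_one]
  · have hj : (j:ℕ) + 1 = m := by omega
    have hjr : ((j:ℕ):ℝ) = m - 1 := by
      have : ((j:ℕ):ℝ) + 1 = m := by exact_mod_cast hj
      linarith
    rw [hv, hj, Nat.mod_self, hjr]
    have : 2 * Real.pi / m * ((m:ℝ) - 1) + 2 * Real.pi / m = 2 * Real.pi := by field_simp; ring
    rw [this]; simp

lemma cfan_fan (m : ℕ) [NeZero m] (hm : 5 ≤ m) : Fan (cfan m) := by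
  have hm0 : (0:ℝ) < m := by positivity
  set θ := 2 * Real.pi / m with hθ
  have hθ0 : 0 < θ := by positivity
  have hmθ : m * θ = 2 * Real.pi := by rw [hθ]; field_simp
  have hm5 : (5:ℝ) ≤ m := by exact_mod_cast hm
  have hθ1 : θ < Real.pi / 2 := by
    have := Real.pi_pos
    nlinarith
  have hsin : 0 < Real.sin θ := Real.sin_pos_of_pos_of_lt_pi hθ0 (by linarith [Real.pi_pos])
  have hsucc := cfan_succ m hm
  have hv : ∀ j : Fin m, ((j + 1 : Fin m) : ℕ) = (j + 1) % m := by
    intro j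
    rw [Fin.val_add]
    congr 2
    obtain ⟨k, rfl⟩ : ∃ k, m = k + 2 := ⟨m - 2, by omega⟩
    rfl
  have hv2 : ∀ j : Fin m, ((j + 1 : Fin m) : ℕ) = if (j:ℕ) + 1 < m then (j:ℕ) + 1 else 0 := by
    intro j
    rw [hv]
    split_ifs with h
    · exact Nat.mod_eq_of_lt h
    · have : (j:ℕ) + 1 = m := by omega
      rw [this, Nat.mod_self]
  constructor
  · intro j
    rw [hsucc]
    simp only [dt, cfan, ← hθ]
    have := trig_id (θ * j) 0 θ
    rw [Real.cos_add, Real.sin_add]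
    nlinarith [Real.sin_sq_add_cos_sq (θ * j)]
  · intro w
    obtain ⟨r, φ, hr, hφ0, hφ1, h1, h2⟩ : ∃ r φ : ℝ, 0 ≤ r ∧ 0 ≤ φ ∧ φ < 2 * Real.pi ∧ w.1 = r * Real.cos φ ∧ w.2 = r * Real.sin φ := by
      set z : ℂ := ⟨w.1, w.2⟩ with hz
      have e1 : w.1 = ‖z‖ * Real.cos z.arg := (Complex.norm_mul_cos_arg z).symm
      have e2 : w.2 = ‖z‖ * Real.sin z.arg := (Complex.norm_mul_sin_arg z).symm
      have a1 := Complex.neg_pi_lt_arg z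
      have a2 := Complex.arg_le_pi z
      rcases le_or_gt 0 z.arg with h | h
      · exact ⟨‖z‖, z.arg, norm_nonneg _, h, by linarith [Real.pi_pos], e1, e2⟩
      · refine ⟨‖z‖, z.arg + 2 * Real.pi, norm_nonneg _, by linarith, by linarith, ?_, ?_⟩
        · rw [Real.cos_add_two_pi]; exact e1
        · rw [Real.sin_add_two_pi]; exact e2
    have f1 := Nat.floor_le (show 0 ≤ φ / θ by positivity)
    have f2 := Nat.lt_floor_add_one (φ / θ)
    rw [le_div_iff₀ hθ0] at f1
    rw [div_lt_iff₀ hθ0] at f2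
    have f3 : ⌊φ / θ⌋₊ < m := by
      rw [Nat.floor_lt (by positivity), div_lt_iff₀ hθ0, hmθ]; exact hφ1
    set j : Fin m := ⟨⌊φ / θ⌋₊, f3⟩ with hj
    have hjv : ((j:ℕ):ℝ) = (⌊φ / θ⌋₊ : ℝ) := rfl
    rw [← hjv] at f1 f2
    obtain ⟨t1, t2⟩ := trig_id (θ * j) (φ - θ * j) θ
    refine ⟨j, r * Real.sin (θ - (φ - θ * j)) / Real.sin θ, r * Real.sin (φ - θ * j) / Real.sin θ, ?_, ?_, ?_⟩
    · have := Real.sin_nonneg_of_nonneg_of_le_pi (x := θ - (φ - θ * j)) (by linarith) (by linarith [Real.pi_pos])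
      positivity
    · have := Real.sin_nonneg_of_nonneg_of_le_pi (x := φ - θ * j) (by linarith) (by linarith [Real.pi_pos])
      positivity
    · rw [hsucc]
      simp only [cfan, ← hθ]
      rw [add_sub_cancel] at t1 t2
      ext
      · simp only; rw [h1]; exact comb_div hsin.ne' (by linear_combination r * t1)
      · simp only; rw [h2]; exact comb_div hsin.ne' (by linear_combination r * t2)
  · intro i j hij hij1
    obtain ⟨t1, t2⟩ := trig_id (θ * j) (θ * i - θ * j) θ
    refine ⟨Real.sin (θ - (θ * i - θ * j)) / Real.sin θ, Real.sin (θ * i - θ * j) / Real.sin θ, ?_, ?_⟩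
    · rw [div_lt_iff₀ hsin, div_lt_iff₀ hsin, zero_mul]
      obtain ⟨d, hd2, hdm, hd⟩ : ∃ d : ℝ, 2 ≤ d ∧ d ≤ m - 1 ∧ ((i:ℝ) - j = d ∨ (i:ℝ) - j = d - m) := by
        have h3 : (i:ℕ) ≠ j := fun h => hij (Fin.ext h)
        have h4 : (i:ℕ) ≠ ((j+1 : Fin m) : ℕ) := fun h => hij1 (Fin.ext h)
        rw [hv2] at h4
        have hi := i.2
        have hj := j.2
        rcases Nat.lt_or_ge i j with h | h
        · refine ⟨(i:ℝ) - j + m, ?_, ?_, Or.inr (by ring)⟩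
          · have : (j:ℕ) + 2 ≤ i + m := by split_ifs at h4 <;> omega
            have : ((j:ℕ):ℝ) + 2 ≤ i + m := by exact_mod_cast this
            linarith
          · have : (i:ℕ) + 1 ≤ j := by omega
            have : ((i:ℕ):ℝ) + 1 ≤ j := by exact_mod_cast this
            linarith
        · refine ⟨(i:ℝ) - j, ?_, ?_, Or.inl rfl⟩
          · have : (j:ℕ) + 2 ≤ i := by split_ifs at h4 <;> omega
            have : ((j:ℕ):ℝ) + 2 ≤ i := by exact_mod_cast this
            linarith
          · have : (i:ℕ) + 1 ≤ j + m := by omega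
            have : ((i:ℕ):ℝ) + 1 ≤ j + m := by exact_mod_cast this
            linarith
      have e1 : Real.sin (θ * i - θ * j) = Real.sin (θ * d) := by
        rw [← mul_sub]
        rcases hd with h | h
        · rw [h]
        · rw [h, mul_sub, mul_comm θ (m:ℝ), hmθ, Real.sin_sub_two_pi]
      have e2 : Real.sin (θ - (θ * i - θ * j)) = - Real.sin (θ * d - θ) := by
        rw [← Real.sin_neg, neg_sub, ← mul_sub]
        rcases hd with h | h
        · rw [h]
        · rw [h, mul_sub, mul_comm θ (m:ℝ), hmθ]
          rw [show θ - (θ * d - 2 * Real.pi) = θ - θ * d + 2 * Real.pi by ring, Real.sin_add_two_pi]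
      rw [e1, e2]
      rcases lt_or_ge (θ * d - θ) Real.pi with h | h
      · left
        have := Real.sin_pos_of_pos_of_lt_pi (x := θ * d - θ) (by nlinarith) h
        linarith
      · right
        have h5 : θ * d - 2 * Real.pi < 0 := by nlinarith
        have := Real.sin_neg_of_neg_of_neg_pi_lt h5 (by linarith)
        rwa [Real.sin_sub_two_pi] at this
    · rw [hsucc]
      simp only [cfan, ← hθ]
      rw [add_sub_cancel] at t1 t2
      ext
      · exact comb_div hsin.ne' t1
      · exact comb_div hsin.ne' t2
  · intro j h
    have := congrArg Fin.val h
    rw [hv2] at this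
    split_ifs at this <;> omega
  · intro j h
    have := congrArg Fin.val h
    rw [hv2, hv2] at this
    split_ifs at this <;> omega

end

noncomputable section

lemma norm_mkE_le (x y : ℝ) : ‖mkE x y‖ ≤ |x| + |y| := by
  rw [EuclideanSpace.norm_eq]
  apply Real.sqrt_le_iff.2
  refine ⟨by positivity, ?_⟩
  simp only [Fin.sum_univ_two, mkE_zero, mkE_one, Real.norm_eq_abs]
  nlinarith [abs_nonneg x, abs_nonneg y]

lemma abs_coord_le (x : E 2) (i : Fin 2) : |x i| ≤ ‖x‖ := by
  rw [← Real.norm_eq_abs]; exact PiLp.norm_apply_le x i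

/-- apex decomposition for two unit directions -/
lemma apex_decomp {uL uR : ℝ × ℝ} (hL : uL.1 ^ 2 + uL.2 ^ 2 = 1) (hR : uR.1 ^ 2 + uR.2 ^ 2 = 1)
    (hd : 0 < dt uL uR) (hc : 0 ≤ uL.1 * uR.1 + uL.2 * uR.2) {p q : E 2} (ha : 0 ≤ lc uL p - lc uL q) (hb : 0 ≤ lc uR q - lc uR p) :
    ∃ l : ℝ, 0 ≤ l ∧ l ≤ 1 ∧ ∃ z : E 2, (mkTri uL uR p q).c = l • p + (1 - l) • q + z ∧
      ‖z‖ ≤ (lc uL p - lc uL q) + (lc uR q - lc uR p) := by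
  obtain ⟨e1, e2⟩ := mkTri_c hd.ne' p q
  set a := lc uL p - lc uL q with hadef
  set b := lc uR q - lc uR p with hbdef
  rcases (add_nonneg ha hb).eq_or_lt with h | h
  · refine ⟨1, by norm_num, le_rfl, 0, ?_, ?_⟩
    · apply eq_of_lc hd.ne'
      · rw [e1]; simp
      · rw [e2]; simp; linarith
    · simp [← h]
  · set κ := uL.1 * uR.1 + uL.2 * uR.2 with hκ
    set P := a * b / (a + b) with hP
    have hP0 : 0 ≤ P := by positivity
    have hP4 : 4 * P ≤ a + b := by
      rw [hP, ← mul_div_assoc, div_le_iff₀ h]; nlinarith [sq_nonneg (a - b)]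
    refine ⟨a / (a + b), by positivity, by rw [div_le_one h]; linarith,
      mkE (P * (uL.1 + uR.1) / (1 + κ)) (P * (uL.2 + uR.2) / (1 + κ)), ?_, ?_⟩
    · apply eq_of_lc hd.ne'
      · rw [e1, lc_add, lc_add, lc_smul, lc_smul]
        have : lc uL (mkE (P * (uL.1 + uR.1) / (1 + κ)) (P * (uL.2 + uR.2) / (1 + κ))) = P := by
          simp only [lc, mkE_zero, mkE_one]
          have : uL.1 * (P * (uL.1 + uR.1) / (1 + κ)) + uL.2 * (P * (uL.2 + uR.2) / (1 + κ)) = P * ((uL.1 ^ 2 + uL.2 ^ 2) + κ) / (1 + κ) := by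
            rw [hκ]; ring
          rw [this, hL]; field_simp
        rw [this, hP]
        field_simp
        rw [show lc uL q = lc uL p - a by rw [hadef]; ring]; ring
      · rw [e2, lc_add, lc_add, lc_smul, lc_smul]
        have : lc uR (mkE (P * (uL.1 + uR.1) / (1 + κ)) (P * (uL.2 + uR.2) / (1 + κ))) = P := by
          simp only [lc, mkE_zero, mkE_one]
          have : uR.1 * (P * (uL.1 + uR.1) / (1 + κ)) + uR.2 * (P * (uL.2 + uR.2) / (1 + κ)) = P * ((uR.1 ^ 2 + uR.2 ^ 2) + κ) / (1 + κ) := by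
            rw [hκ]; ring
          rw [this, hR]; field_simp
        rw [this, hP]
        field_simp
        rw [show lc uR p = lc uR q - b by rw [hbdef]; ring]; ring
    · have hx : ∀ α β : ℝ, |α| ≤ 1 → |β| ≤ 1 → |P * (α + β) / (1 + κ)| ≤ 2 * P := by
        intro α β h1 h2
        rw [abs_div, abs_mul, abs_of_nonneg hP0, abs_of_pos (show 0 < 1 + κ by positivity), div_le_iff₀ (by positivity)]
        have := abs_add_le α β
        nlinarith [mul_nonneg hP0 hc, mul_le_mul_of_nonneg_left (show |α + β| ≤ 2 by linarith) hP0]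
      refine (norm_mkE_le _ _).trans ?_
      have a1 : |uL.1| ≤ 1 := abs_le_one_iff_mul_self_le_one.2 (by nlinarith [sq_nonneg uL.2])
      have a2 : |uL.2| ≤ 1 := abs_le_one_iff_mul_self_le_one.2 (by nlinarith [sq_nonneg uL.1])
      have a3 : |uR.1| ≤ 1 := abs_le_one_iff_mul_self_le_one.2 (by nlinarith [sq_nonneg uR.2])
      have a4 : |uR.2| ≤ 1 := abs_le_one_iff_mul_self_le_one.2 (by nlinarith [sq_nonneg uR.1])
      have := hx _ _ a1 a3
      have := hx _ _ a2 a4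
      linarith

lemma cfan_M {K : Set (E 2)} (hKconv : Convex ℝ K) {o : E 2} {r : ℝ} (hr : 0 < r) (hball : Metric.closedBall o r ⊆ K)
    {D : ℝ} (hD : ∀ x ∈ K, ‖x‖ ≤ D) {B : ℝ} (hB0 : 0 ≤ B)
    (hB : ∀ (ι : Type) [Fintype ι] (t : ι → Tri), Cfg K t → 3 * ∑ i, (2 * (t i).T) ^ ((1:ℝ)/3) ≤ B)
    {ε : ℝ} (hε : 0 < ε) (m : ℕ) [NeZero m] (hm : 5 ≤ m) (hmD : 2 * (2 * Real.pi / m) * (2 * D) ≤ ε * r)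
    {y : Fin m → E 2} (hy : MM (cfan m) y) (hyK : ∀ j, y j ∈ K) :
    3 * ∑ j, (2 * (fanTri (cfan m) y j).T) ^ ((1:ℝ)/3) ≤ (1 + ε) * B := by
  classical
  have hfan := cfan_fan m hm
  set u := cfan m with hu
  have hm0 : (0:ℝ) < m := by positivity
  set θ := 2 * Real.pi / m with hθ
  have hθ0 : 0 < θ := by positivity
  have hmθ : m * θ = 2 * Real.pi := by rw [hθ]; field_simp
  have hm5 : (5:ℝ) ≤ m := by exact_mod_cast hm
  have hθ1 : θ < Real.pi / 2 := by
    have := Real.pi_pos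
    nlinarith
  have hunit : ∀ j, (u j).1 ^ 2 + (u j).2 ^ 2 = 1 := fun j => by simp [hu, cfan]
  have hcos : ∀ j, 0 ≤ (u j).1 * (u (j+1)).1 + (u j).2 * (u (j+1)).2 := by
    intro j
    rw [hu, cfan_succ m hm]
    simp only [cfan]
    rw [← Real.cos_sub, ← Real.cos_neg, ← hθ, show -(θ * j - (θ * j + θ)) = θ by ring]
    exact Real.cos_nonneg_of_neg_pi_div_two_le_of_le (by linarith) hθ1.le
  have hlip : ∀ j, |(u j).1 - (u (j+1)).1| ≤ θ ∧ |(u j).2 - (u (j+1)).2| ≤ θ := by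
    intro j
    rw [hu, cfan_succ m hm]
    simp only [cfan, ← hθ]
    have h1 := Real.lipschitzWith_cos.dist_le_mul (θ * j) (θ * j + θ)
    have h2 := Real.lipschitzWith_sin.dist_le_mul (θ * j) (θ * j + θ)
    simp only [Real.dist_eq, NNReal.coe_one, one_mul] at h1 h2
    rw [show θ * j - (θ * j + θ) = -θ by ring, abs_neg, abs_of_pos hθ0] at h1 h2
    exact ⟨h1, h2⟩
  have hε1 : (0:ℝ) < 1 + ε := by positivity
  set η := (1 + ε)⁻¹ with hη
  have hη0 : 0 < η := by positivity
  -- the scaled map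
  let φ : E 2 → E 2 := fun x => (1 - η) • o + η • x
  have hlcφ : ∀ w x, lc w (φ x) = (1 - η) * lc w o + η * lc w x := fun w x => by
    simp only [φ, lc_add, lc_smul]
  have hoK : o ∈ K := hball (Metric.mem_closedBall_self hr.le)
  have hη1 : η ≤ 1 := by rw [hη]; exact inv_le_one_of_one_le₀ (by linarith)
  have hφK : ∀ x ∈ K, φ x ∈ K := fun x hx => hKconv hoK hx (by linarith) hη0.le (by ring)
  have hmm : MM u (φ ∘ y) := by
    intro i j
    simp only [Function.comp, hlcφ]
    have := mul_le_mul_of_nonneg_left (hy i j) hη0.le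
    linarith
  have hcφ : ∀ j, (fanTri u (φ ∘ y) j).c = φ (fanTri u y j).c := by
    intro j
    have hd := (hfan.det_pos j).ne'
    obtain ⟨e1, e2⟩ := mkTri_c hd (y j) (y (j+1))
    obtain ⟨e3, e4⟩ := mkTri_c hd (φ (y j)) (φ (y (j+1)))
    apply eq_of_lc hd
    · refine e3.trans ?_
      rw [hlcφ, hlcφ]; unfold fanTri; rw [e1]
    · refine e4.trans ?_
      rw [hlcφ, hlcφ]; unfold fanTri; rw [e2]
  have hcK : ∀ j, (fanTri u (φ ∘ y) j).c ∈ K := by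
    intro j
    rw [hcφ]
    obtain ⟨h1, h2⟩ := Fan.ab_nonneg hy j
    obtain ⟨l, hl0, hl1, z, hz, hzn⟩ := apex_decomp (hunit j) (hunit (j+1)) (hfan.det_pos j) (hcos j) (p := y j) (q := y (j+1)) h1 h2
    have hzb : ‖z‖ ≤ ε * r := by
      refine hzn.trans (le_trans ?_ hmD)
      have : lc (u j) (y j) - lc (u j) (y (j+1)) + (lc (u (j+1)) (y (j+1)) - lc (u (j+1)) (y j)) =
        ((u j).1 - (u (j+1)).1) * (y j 0 - y (j+1) 0) + ((u j).2 - (u (j+1)).2) * (y j 1 - y (j+1) 1) := by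
        unfold lc; ring
      rw [this]
      have hdi : ∀ i : Fin 2, |y j i - y (j+1) i| ≤ 2 * D := by
        intro i
        have b1 := abs_coord_le (y j) i
        have b2 := abs_coord_le (y (j+1)) i
        have := abs_sub (y j i) (y (j+1) i)
        linarith [hD _ (hyK j), hD _ (hyK (j+1))]
      have hprod : ∀ a b : ℝ, |a| ≤ θ → |b| ≤ 2 * D → a * b ≤ θ * (2 * D) := fun a b h1 h2 =>
        (le_abs_self _).trans (by rw [abs_mul]; gcongr)
      have := hprod _ _ (hlip j).1 (hdi 0)
      have := hprod _ _ (hlip j).2 (hdi 1)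
      linarith
    have hcomb : l • y j + (1 - l) • y (j+1) ∈ K := hKconv (hyK j) (hyK (j+1)) hl0 (by linarith) (by ring)
    have hoz : o + ε⁻¹ • z ∈ K := by
      apply hball
      rw [Metric.mem_closedBall, dist_eq_norm, add_sub_cancel_left, norm_smul, norm_inv, Real.norm_eq_abs, abs_of_pos hε]
      rw [inv_mul_le_iff₀ hε]; exact hzb
    have hηε : 1 - η = η * ε := by rw [hη]; field_simp; ring
    have heq : φ (fanTri u y j).c = η • (l • y j + (1 - l) • y (j+1)) + (1 - η) • (o + ε⁻¹ • z) := by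
      have : (fanTri u y j).c = l • y j + (1 - l) • y (j+1) + z := hz
      simp only [φ]
      rw [this, smul_add (1 - η), smul_smul (1 - η), hηε, mul_assoc, mul_inv_cancel₀ hε.ne', mul_one, smul_add η _ z]
      abel
    rw [heq]
    exact hKconv hcomb hoz hη0.le (by linarith) (by ring)
  have hcfg := hfan.cfg hmm (fun j => hφK _ (hyK j)) hcK
  have hb := hB _ _ hcfg
  have hsum := Fan.sum_T hmm (fun T => (2 * T) ^ ((1:ℝ)/3)) (by norm_num)
  have hT : ∀ j, (fanTri u (φ ∘ y) j).T = η ^ 2 * (fanTri u y j).T := by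
    intro j
    have ha : (fanTri u (φ ∘ y) j).a = η * (fanTri u y j).a := by
      change lc (u j) (φ (y j)) - lc (u j) (φ (y (j+1))) = η * (lc (u j) (y j) - lc (u j) (y (j+1)))
      rw [hlcφ, hlcφ]; ring
    have hb : (fanTri u (φ ∘ y) j).b = η * (fanTri u y j).b := by
      change lc (u (j+1)) (φ (y (j+1))) - lc (u (j+1)) (φ (y j)) = η * (lc (u (j+1)) (y (j+1)) - lc (u (j+1)) (y j))
      rw [hlcφ, hlcφ]; ring
    unfold Tri.T
    rw [ha, hb]
    change _ / (2 * dt (u j) (u (j+1))) = η ^ 2 * (_ / (2 * dt (u j) (u (j+1))))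
    ring
  have hb' : 3 * ∑ j, (2 * (fanTri u (φ ∘ y) j).T) ^ ((1:ℝ)/3) ≤ B := by
    rw [← hsum]; exact hb
  have hterm : ∀ j, (2 * (fanTri u y j).T) ^ ((1:ℝ)/3) ≤ (1 + ε) * (2 * (fanTri u (φ ∘ y) j).T) ^ ((1:ℝ)/3) := by
    intro j
    have hT0 := hfan.T_nonneg hy j
    rw [hT]
    have : 2 * (fanTri u y j).T = (1 + ε) ^ 2 * (2 * (η ^ 2 * (fanTri u y j).T)) := by
      rw [hη]; field_simp
    conv_lhs => rw [this]
    rw [Real.mul_rpow (by positivity) (by positivity)]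
    gcongr
    rw [← Real.rpow_natCast, ← Real.rpow_mul hε1.le]
    conv_rhs => rw [← Real.rpow_one (1 + ε)]
    apply Real.rpow_le_rpow_of_exponent_le (by linarith) (by norm_num)
  calc _ ≤ 3 * ∑ j, (1 + ε) * (2 * (fanTri u (φ ∘ y) j).T) ^ ((1:ℝ)/3) := by gcongr with j; exact hterm j
    _ = (1 + ε) * (3 * ∑ j, (2 * (fanTri u (φ ∘ y) j).T) ^ ((1:ℝ)/3)) := by rw [← Finset.mul_sum]; ring
    _ ≤ _ := by gcongr

theorem part_b {K : Set (E 2)} (hKc : IsCompact K) (hKconv : Convex ℝ K) (hKint : (interior K).Nonempty) (harea : volume K = 1)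
    {B : ℝ} (hB0 : 0 ≤ B)
    (hB : ∀ (ι : Type) [Fintype ι] (t : ι → Tri), Cfg K t → 3 * ∑ i, (2 * (t i).T) ^ ((1:ℝ)/3) ≤ B) :
    ∀ ε > 0, ∀ᶠ n : ℕ in atTop, (n:ℝ)^(-(1:ℝ)/3) * Real.log (EQ K n) ≤ B + ε := by
  intro ε hε
  obtain ⟨o, ho⟩ := hKint
  obtain ⟨r, hr, hball⟩ := Metric.nhds_basis_closedBall.mem_iff.1 (mem_interior_iff_mem_nhds.1 ho)
  obtain ⟨D, hD⟩ := hKc.isBounded.exists_norm_le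
  set ε' := ε / (2 * (B + 1)) with hε'
  have hε'0 : 0 < ε' := by positivity
  have hlim : Tendsto (fun m : ℕ => 2 * (2 * Real.pi / (m:ℝ)) * (2 * D)) atTop (nhds (2 * 0 * (2 * D))) :=
    (tendsto_const_nhds.mul (tendsto_const_div_atTop_nhds_zero_nat _)).mul_const _
  have hev := hlim.eventually (ge_mem_nhds (show 2 * 0 * (2 * D) < ε' * r by simp; positivity))
  obtain ⟨m, hm1, hm2⟩ := (hev.and (eventually_ge_atTop 5)).exists
  have : NeZero m := ⟨by omega⟩
  have h := upper_asym (M := (1 + ε') * B) (cfan_fan m hm2) hKc.measurableSet harea (by positivity)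
    (fun y hy hyK => cfan_M hKconv hr hball hD hB0 hB hε'0 m hm2 hm1 hy hyK) (ε/2) (by positivity)
  filter_upwards [h] with n hn
  refine hn.trans ?_
  have : ε' * B ≤ ε / 2 := by
    rw [hε', div_mul_eq_mul_div, div_le_div_iff₀ (by positivity) (by positivity)]; nlinarith
  linarith

end

noncomputable section

/-- right derivative -/
def rd (f : ℝ → ℝ) (x : ℝ) : ℝ := derivWithin f (Ioi x) x

/-- second difference -/
def D2 (f : ℝ → ℝ) (x t : ℝ) : ℝ := f (x + t) + f (x - t) - 2 * f x

section one
variable {a b : ℝ} {f : ℝ → ℝ}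

lemma rd_mono (hf : ConvexOn ℝ (Icc a b) f) : MonotoneOn (rd f) (Ioo a b) := by
  have := hf.monotoneOn_rightDeriv
  rwa [interior_Icc] at this

lemma cvx_cont (hf : ConvexOn ℝ (Icc a b) f) : ContinuousOn f (Ioo a b) := by
  have := hf.continuousOn_interior
  rwa [interior_Icc] at this

lemma rd_hasDeriv (hf : ConvexOn ℝ (Icc a b) f) {x : ℝ} (hx : x ∈ Ioo a b) : HasDerivWithinAt f (rd f x) (Ici x) x := by
  rw [← interior_Icc] at hx
  exact (hf.hasDerivWithinAt_rightDeriv_of_mem_interior hx).Ici_of_Ioi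

lemma tangent_le (hf : ConvexOn ℝ (Icc a b) f) {x y : ℝ} (hx : x ∈ Ioo a b) (hy : y ∈ Icc a b) :
    f x + rd f x * (y - x) ≤ f y := by
  have hx' := hx
  rw [← interior_Icc] at hx'
  rcases lt_trichotomy x y with h | h | h
  · have := hf.rightDeriv_le_slope_of_mem_interior hx' hy h
    rw [slope_def_field, le_div_iff₀ (by linarith)] at this
    unfold rd; linarith
  · subst h; simp
  · have h1 := hf.slope_le_leftDeriv_of_mem_interior hy hx' h
    have h2 := h1.trans (hf.leftDeriv_le_rightDeriv_of_mem_interior hx')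
    rw [slope_def_field, div_le_iff₀ (by linarith)] at h2
    unfold rd; linarith

lemma rd_good (hf : ConvexOn ℝ (Icc a b) f) :
    ∀ᵐ x : ℝ, x ∈ Ioo a b → ∃ A, 0 ≤ A ∧ HasDerivAt (rd f) A x := by
  filter_upwards [(rd_mono hf).ae_differentiableWithinAt_of_mem] with x hx hxm
  have h1 := (hx hxm).differentiableAt (isOpen_Ioo.mem_nhds hxm)
  refine ⟨_, ?_, h1.hasDerivAt⟩
  rw [← h1.derivWithin (isOpen_Ioo.uniqueDiffWithinAt hxm)]
  exact (rd_mono hf).derivWithin_nonneg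

lemma taylor2 (hf : ConvexOn ℝ (Icc a b) f) {x A : ℝ} (hx : x ∈ Ioo a b) (hA : HasDerivAt (rd f) A x) {ε : ℝ} (hε : 0 < ε) :
    ∃ η > 0, Icc (x - η) (x + η) ⊆ Ioo a b ∧ (∀ z ∈ Icc (x - η) (x + η), |rd f z - rd f x - A * (z - x)| ≤ ε * |z - x|) ∧
      ∀ z ∈ Icc (x - η) (x + η), |f z - f x - rd f x * (z - x) - A / 2 * (z - x) ^ 2| ≤ ε * (z - x) ^ 2 := by
  have h1 := (hasDerivAt_iff_isLittleO.1 hA).def hε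
  have h2 := h1.and (isOpen_Ioo.mem_nhds hx)
  obtain ⟨η, hη, hball⟩ := Metric.nhds_basis_closedBall.mem_iff.1 h2
  rw [Real.closedBall_eq_Icc] at hball
  have hsub : Icc (x - η) (x + η) ⊆ Ioo a b := fun z hz => (hball hz).2
  have hder : ∀ z ∈ Icc (x - η) (x + η), |rd f z - rd f x - A * (z - x)| ≤ ε * |z - x| := by
    intro z hz
    have := (hball hz).1
    simp only [Real.norm_eq_abs, smul_eq_mul] at this
    rwa [mul_comm A]
  refine ⟨η, hη, hsub, hder, ?_⟩
  set g : ℝ → ℝ := fun z => f z - f x - rd f x * (z - x) - A / 2 * (z - x) ^ 2 with hg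
  have hgx : g x = 0 := by simp [hg]
  have hgc : ContinuousOn g (Icc (x - η) (x + η)) := by
    have := (cvx_cont hf).mono hsub
    fun_prop
  have hgd : ∀ z ∈ Icc (x - η) (x + η), HasDerivWithinAt g (rd f z - rd f x - A * (z - x)) (Ici z) z := by
    intro z hz
    have h3 := rd_hasDeriv hf (hsub hz)
    have h4 : HasDerivWithinAt (fun z => rd f x * (z - x)) (rd f x) (Ici z) z := by
      simpa using (((hasDerivAt_id z).sub_const x).const_mul (rd f x)).hasDerivWithinAt (s := Ici z)
    have h5 : HasDerivWithinAt (fun z => A / 2 * (z - x) ^ 2) (A * (z - x)) (Ici z) z := by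
      have := ((((hasDerivAt_id z).sub_const x).pow 2).const_mul (A/2)).hasDerivWithinAt (s := Ici z)
      exact this.congr_deriv (by push_cast; simp only [id]; ring)
    exact ((h3.sub_const (f x)).sub h4).sub h5
  intro z hz
  change |g z| ≤ _
  rcases le_total x z with hxz | hxz
  · have hs : Icc x z ⊆ Icc (x - η) (x + η) := Icc_subset_Icc (by linarith) hz.2
    have := norm_image_sub_le_of_norm_deriv_right_le_segment (C := ε * (z - x)) (hgc.mono hs)
      (fun y hy => hgd y (hs (Ico_subset_Icc_self hy))) (fun y hy => by
        refine (hder y (hs (Ico_subset_Icc_self hy))).trans ?_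
        rw [abs_of_nonneg (by linarith [hy.1])]
        have := hy.2
        gcongr) z ⟨hxz, le_rfl⟩
    rw [hgx, sub_zero, Real.norm_eq_abs] at this
    linarith [this]
  · have hs : Icc z x ⊆ Icc (x - η) (x + η) := Icc_subset_Icc hz.1 (by linarith)
    have := norm_image_sub_le_of_norm_deriv_right_le_segment (C := ε * (x - z)) (hgc.mono hs)
      (fun y hy => hgd y (hs (Ico_subset_Icc_self hy))) (fun y hy => by
        refine (hder y (hs (Ico_subset_Icc_self hy))).trans ?_
        rw [abs_sub_comm, abs_of_nonneg (by linarith [hy.2])]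
        have := hy.1
        gcongr) x ⟨hxz, le_rfl⟩
    rw [hgx, zero_sub, norm_neg, Real.norm_eq_abs] at this
    linarith [this]

lemma D2_nonneg (hf : ConvexOn ℝ (Icc a b) f) {x t : ℝ} (h1 : x + t ∈ Icc a b) (h2 : x - t ∈ Icc a b) : 0 ≤ D2 f x t := by
  have := hf.2 h1 h2 (show (0:ℝ) ≤ 1/2 by norm_num) (show (0:ℝ) ≤ 1/2 by norm_num) (by norm_num)
  simp only [smul_eq_mul] at this
  rw [show 1/2 * (x + t) + 1/2 * (x - t) = x by ring] at this
  unfold D2; linarith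

lemma D2_mono (hf : ConvexOn ℝ (Icc a b) f) {x t s : ℝ} (h1 : x + t ∈ Icc a b) (h2 : x - t ∈ Icc a b) (hs : |s| ≤ t) :
    D2 f x s ≤ D2 f x t := by
  rcases (le_trans (abs_nonneg s) hs).eq_or_lt with h | h
  · have : s = 0 := by rw [← h] at hs; exact abs_nonpos_iff.1 hs
    rw [this, ← h]
  have hD := D2_nonneg hf h1 h2
  obtain ⟨hs1, hs2⟩ := abs_le.1 hs
  have c1 := hf.2 h1 h2 (show 0 ≤ (t + s) / (2 * t) from div_nonneg (by linarith) (by linarith))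
    (show 0 ≤ (t - s) / (2 * t) from div_nonneg (by linarith) (by linarith)) (by field_simp; ring)
  have c2 := hf.2 h1 h2 (show 0 ≤ (t - s) / (2 * t) from div_nonneg (by linarith) (by linarith))
    (show 0 ≤ (t + s) / (2 * t) from div_nonneg (by linarith) (by linarith)) (by field_simp; ring)
  simp only [smul_eq_mul] at c1 c2
  rw [show (t + s) / (2 * t) * (x + t) + (t - s) / (2 * t) * (x - t) = x + s by field_simp; ring] at c1
  rw [show (t - s) / (2 * t) * (x + t) + (t + s) / (2 * t) * (x - t) = x - s by field_simp; ring] at c2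
  have e1 : (t + s) / (2 * t) * f (x + t) + (t - s) / (2 * t) * f (x - t) + ((t - s) / (2 * t) * f (x + t) + (t + s) / (2 * t) * f (x - t))
    = f (x + t) + f (x - t) := by field_simp; ring
  unfold D2; linarith

lemma rd_bound (hf : ConvexOn ℝ (Icc a b) f) {H : ℝ} (hH : ∀ x ∈ Icc a b, |f x| ≤ H) {σ : ℝ} (hσ : 0 < σ) {z : ℝ} (hz : z ∈ Icc (a + σ) (b - σ)) :
    |rd f z| ≤ 2 * H / σ := by
  have hzm : z ∈ Ioo a b := ⟨by linarith [hz.1], by linarith [hz.2]⟩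
  have m1 : z + σ ∈ Icc a b := ⟨by linarith [hz.1], by linarith [hz.2]⟩
  have m2 : z - σ ∈ Icc a b := ⟨by linarith [hz.1], by linarith [hz.2]⟩
  have t1 := tangent_le hf hzm m1
  have t2 := tangent_le hf hzm m2
  have b0 := abs_le.1 (hH z (Ioo_subset_Icc_self hzm))
  have b1 := abs_le.1 (hH _ m1)
  have b2 := abs_le.1 (hH _ m2)
  rw [abs_le, ← neg_div, div_le_iff₀ hσ, le_div_iff₀ hσ]
  constructor <;> nlinarith

lemma diff_bound (hf : ConvexOn ℝ (Icc a b) f) {H : ℝ} (hH : ∀ x ∈ Icc a b, |f x| ≤ H) {σ : ℝ} (hσ : 0 < σ) {z t : ℝ} (ht : 0 ≤ t)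
    (hz : z ∈ Icc (a + σ) (b - σ)) (hzt : z + t ∈ Icc (a + σ) (b - σ)) : |f (z + t) - f z| ≤ 2 * H / σ * t := by
  have m : ∀ y ∈ Icc (a + σ) (b - σ), y ∈ Ioo a b := fun y hy => ⟨by linarith [hy.1], by linarith [hy.2]⟩
  have t1 := tangent_le hf (m _ hz) (Ioo_subset_Icc_self (m _ hzt))
  have t2 := tangent_le hf (m _ hzt) (Ioo_subset_Icc_self (m _ hz))
  have b1 := abs_le.1 (rd_bound hf hH hσ hz)
  have b2 := abs_le.1 (rd_bound hf hH hσ hzt)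
  rw [abs_le]
  constructor <;> nlinarith

lemma weak_D (hf : ConvexOn ℝ (Icc a b) f) {H : ℝ} (hH : ∀ x ∈ Icc a b, |f x| ≤ H) {ρ t e : ℝ} (hρ : 0 < ρ) (ht : 0 ≤ t) (htρ : 2 * t ≤ ρ) (he : 0 < e) :
    volume {x | x ∈ Icc (a + ρ) (b - ρ) ∧ e ≤ D2 f x t} ≤ ENNReal.ofReal (8 * H * t ^ 2 / (ρ * e)) := by
  rcases lt_or_ge (b - ρ) (a + ρ) with hlt | hle
  · have : {x | x ∈ Icc (a + ρ) (b - ρ) ∧ e ≤ D2 f x t} = ∅ := by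
      ext x; simp only [mem_ofPred_eq, mem_empty_iff_false, iff_false]
      rintro ⟨h, _⟩; linarith [h.1, h.2]
    rw [this]; simp
  set J := Icc (a + ρ/2) (b - ρ/2) with hJ
  have hJs : J ⊆ Ioo a b := fun y hy => ⟨by linarith [hy.1], by linarith [hy.2]⟩
  have hcJ : ContinuousOn f J := (cvx_cont hf).mono hJs
  have hcΔ : ContinuousOn (fun z => f (z + t) - f z) (Icc (a + ρ - t) (b - ρ)) := by
    apply ContinuousOn.sub
    · exact hcJ.comp (by fun_prop) fun z hz => ⟨by linarith [hz.1], by linarith [hz.2]⟩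
    · exact hcJ.mono fun z hz => ⟨by linarith [hz.1], by linarith [hz.2]⟩
  have hI : ∀ p q, p ∈ Icc (a + ρ - t) (b - ρ) → q ∈ Icc (a + ρ - t) (b - ρ) → IntervalIntegrable (fun z => f (z + t) - f z) volume p q := by
    intro p q hp hq
    exact (hcΔ.mono (uIcc_subset_Icc hp hq)).intervalIntegrable
  have hbd : ∀ z ∈ Icc (a + ρ - t) (b - ρ), ‖f (z + t) - f z‖ ≤ 2 * H / (ρ/2) * t := fun z hz =>
    diff_bound hf hH (by positivity) ht ⟨by linarith [hz.1], by linarith [hz.2]⟩ ⟨by linarith [hz.1], by linarith [hz.2]⟩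
  have m1 : a + ρ ∈ Icc (a + ρ - t) (b - ρ) := ⟨by linarith, hle⟩
  have m2 : b - ρ ∈ Icc (a + ρ - t) (b - ρ) := ⟨by linarith, le_rfl⟩
  have m3 : a + ρ - t ∈ Icc (a + ρ - t) (b - ρ) := ⟨le_rfl, by linarith⟩
  have m4 : b - ρ - t ∈ Icc (a + ρ - t) (b - ρ) := ⟨by linarith, by linarith⟩
  have hIntr : ∫ x in (a + ρ)..(b - ρ), D2 f x t ≤ 8 * H * t ^ 2 / ρ := by
    have e1 : ∫ x in (a + ρ)..(b - ρ), D2 f x t = (∫ x in (a + ρ)..(b - ρ), (f (x + t) - f x)) - ∫ x in (a + ρ - t)..(b - ρ - t), (f (x + t) - f x) := by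
      rw [← intervalIntegral.integral_comp_sub_right (fun x => f (x + t) - f x) t, ← intervalIntegral.integral_sub (hI _ _ m1 m2)]
      · congr 1; ext x; unfold D2; rw [sub_add_cancel]; ring
      · have := (hI _ _ m3 m4).comp_sub_right t
        simpa using this
    rw [e1, intervalIntegral.integral_interval_sub_interval_comm (hI _ _ m1 m2) (hI _ _ m3 m4) (hI _ _ m1 m3)]
    have i1 := intervalIntegral.norm_integral_le_of_norm_le_const (a := a + ρ) (b := a + ρ - t) (f := fun z => f (z + t) - f z) (C := 2 * H / (ρ/2) * t)
      (fun z hz => hbd z (uIcc_subset_Icc m1 m3 (uIoc_subset_uIcc hz)))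
    have i2 := intervalIntegral.norm_integral_le_of_norm_le_const (a := b - ρ) (b := b - ρ - t) (f := fun z => f (z + t) - f z) (C := 2 * H / (ρ/2) * t)
      (fun z hz => hbd z (uIcc_subset_Icc m2 m4 (uIoc_subset_uIcc hz)))
    rw [show a + ρ - t - (a + ρ) = -t by ring, abs_neg, abs_of_nonneg ht, Real.norm_eq_abs] at i1
    rw [show b - ρ - t - (b - ρ) = -t by ring, abs_neg, abs_of_nonneg ht, Real.norm_eq_abs] at i2
    have e2 : 8 * H * t ^ 2 / ρ = 2 * H / (ρ/2) * t * t + 2 * H / (ρ/2) * t * t := by field_simp; ring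
    linarith [le_abs_self (∫ x in (a + ρ)..(a + ρ - t), (f (x + t) - f x)), neg_abs_le (∫ x in (b - ρ)..(b - ρ - t), (f (x + t) - f x))]
  have hcD : ContinuousOn (fun x => D2 f x t) (Icc (a + ρ) (b - ρ)) := by
    unfold D2
    have g1 : ContinuousOn (fun x => f (x + t)) (Icc (a + ρ) (b - ρ)) := hcJ.comp (by fun_prop) fun z hz => ⟨by linarith [hz.1], by linarith [hz.2]⟩
    have g2 : ContinuousOn (fun x => f (x - t)) (Icc (a + ρ) (b - ρ)) := hcJ.comp (by fun_prop) fun z hz => ⟨by linarith [hz.1], by linarith [hz.2]⟩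
    have g3 : ContinuousOn f (Icc (a + ρ) (b - ρ)) := hcJ.mono fun z hz => ⟨by linarith [hz.1], by linarith [hz.2]⟩
    exact (g1.add g2).sub (continuousOn_const.mul g3)
  have hDi : IntegrableOn (fun x => D2 f x t) (Icc (a + ρ) (b - ρ)) := hcD.integrableOn_Icc
  have hnn : 0 ≤ᵐ[volume.restrict (Icc (a + ρ) (b - ρ))] fun x => D2 f x t := by
    refine (ae_restrict_iff' measurableSet_Icc).2 (Eventually.of_forall fun x hx => ?_)
    exact D2_nonneg hf ⟨by linarith [hx.1], by linarith [hx.2]⟩ ⟨by linarith [hx.1], by linarith [hx.2]⟩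
  have hmk := mul_meas_ge_le_integral_of_nonneg hnn hDi e
  rw [integral_Icc_eq_integral_Ioc, ← intervalIntegral.integral_of_le hle] at hmk
  have hset : {x | x ∈ Icc (a + ρ) (b - ρ) ∧ e ≤ D2 f x t} = {x | e ≤ D2 f x t} ∩ Icc (a + ρ) (b - ρ) := by
    ext x; simp only [mem_ofPred_eq, mem_inter_iff]; tauto
  have hfin : volume ({x | e ≤ D2 f x t} ∩ Icc (a + ρ) (b - ρ)) ≠ ⊤ :=
    ((measure_mono inter_subset_right).trans_lt measure_Icc_lt_top).ne
  rw [hset, ← ENNReal.ofReal_toReal hfin]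
  apply ENNReal.ofReal_le_ofReal
  have : (volume.restrict (Icc (a + ρ) (b - ρ))).real {x | e ≤ D2 f x t} = (volume ({x | e ≤ D2 f x t} ∩ Icc (a + ρ) (b - ρ))).toReal := by
    rw [Measure.real, Measure.restrict_apply' measurableSet_Icc]
  rw [this] at hmk
  rw [show 8 * H * t ^ 2 / (ρ * e) = 8 * H * t ^ 2 / ρ / e by field_simp, le_div_iff₀ he]
  linarith

end one
end

noncomputable section

/-- a planar region between a convex and a concave graph -/
structure Body (a b H : ℝ) (f g : ℝ → ℝ) : Prop where
  hab : a < b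
  cf : ConvexOn ℝ (Icc a b) f
  cg : ConcaveOn ℝ (Icc a b) g
  le : ∀ x ∈ Icc a b, f x ≤ g x
  lt : ∀ x ∈ Ioo a b, f x < g x
  bf : ∀ x ∈ Icc a b, |f x| ≤ H
  bg : ∀ x ∈ Icc a b, |g x| ≤ H

/-- area of the part of the region below a line -/
def capm (a b : ℝ) (f g : ℝ → ℝ) (c s : ℝ) : ENNReal :=
  ∫⁻ X in Ioo a b, ENNReal.ofReal (min (c + s * X) (g X) - f X)

/-- slice of the wet part cut by lower caps -/
def Wm (a b : ℝ) (f g : ℝ → ℝ) (δ x : ℝ) : Set ℝ :=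
  {y | f x ≤ y ∧ y ≤ g x ∧ ∃ c s, y < c + s * x ∧ capm a b f g c s ≤ ENNReal.ofReal δ}

section two
variable {a b H : ℝ} {f g : ℝ → ℝ}

lemma Body.neg (h : Body a b H f g) : Body a b H (fun x => - g x) (fun x => - f x) where
  hab := h.hab
  cf := h.cg.neg
  cg := h.cf.neg
  le := fun x hx => neg_le_neg (h.le x hx)
  lt := fun x hx => neg_lt_neg (h.lt x hx)
  bf := fun x hx => by rw [abs_neg]; exact h.bg x hx
  bg := fun x hx => by rw [abs_neg]; exact h.bf x hx

lemma Body.contg (h : Body a b H f g) : ContinuousOn g (Ioo a b) := by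
  have := (cvx_cont h.neg.cf).neg
  simpa only [Pi.neg_def, neg_neg] using this

lemma Body.half (h : Body a b H f g) {x t d : ℝ} (hd : 0 < d) (h1 : a ≤ x - d) (h2 : x + d ≤ b) (ht : |t| ≤ d / 2) :
    (g x - f x) / 2 ≤ g (x + t) - f (x + t) := by
  have key : ∀ y ∈ Icc a b, ∀ θ, 0 ≤ θ → θ ≤ 1/2 → (g x - f x) / 2 ≤ g ((1 - θ) * x + θ * y) - f ((1 - θ) * x + θ * y) := by
    intro y hy θ h0 h1'
    have hx : x ∈ Icc a b := ⟨by linarith, by linarith⟩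
    have c1 := h.cf.2 hx hy (show 0 ≤ 1 - θ by linarith) h0 (by ring)
    have c2 := h.cg.2 hx hy (show 0 ≤ 1 - θ by linarith) h0 (by ring)
    simp only [smul_eq_mul] at c1 c2
    have l1 := h.le x hx
    have l2 := h.le y hy
    nlinarith
  obtain ⟨t1, t2⟩ := abs_le.1 ht
  rcases le_total 0 t with h0 | h0
  · have := key (x + d) ⟨by linarith, h2⟩ (t / d) (by positivity) (by rw [div_le_iff₀ hd]; linarith)
    rwa [show (1 - t / d) * x + t / d * (x + d) = x + t by field_simp; ring] at this
  · have := key (x - d) ⟨h1, by linarith⟩ (-t / d) (div_nonneg (by linarith) hd.le) (by rw [div_le_iff₀ hd]; linarith)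
    rwa [show (1 - -t / d) * x + -t / d * (x - d) = x + t by field_simp; ring] at this

/-- the pairing bound -/
lemma cap_lower (h : Body a b H f g) {x η γ δ e c s : ℝ} (hη : 0 ≤ η) (hs : Icc (x - η) (x + η) ⊆ Ioo a b)
    (hγ0 : 0 ≤ γ) (hγ : ∀ X ∈ Icc (x - η) (x + η), γ ≤ g X - f X) (hδ : 0 ≤ δ) (he : e ≤ c + s * x - f x)
    (hcap : capm a b f g c s ≤ ENNReal.ofReal δ) :
    ∫ t in (-η)..η, max 0 (min γ (2 * e - D2 f x t)) ≤ 2 * δ := by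
  set φ : ℝ → ℝ := fun X => max 0 (min (c + s * X) (g X) - f X) with hφ
  have hcf := (cvx_cont h.cf).mono hs
  have hcg := h.contg.mono hs
  have hcφ : ContinuousOn φ (Icc (x - η) (x + η)) := by
    apply ContinuousOn.sup continuousOn_const
    refine ContinuousOn.sub (ContinuousOn.inf (by fun_prop) hcg) hcf
  have hle : x - η ≤ x + η := by linarith
  have hφi : IntervalIntegrable φ volume (x - η) (x + η) := by
    apply ContinuousOn.intervalIntegrable; rwa [uIcc_of_le hle]
  have h1 : ∫ X in (x - η)..(x + η), φ X ≤ δ := by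
    rw [intervalIntegral.integral_of_le hle]
    rw [← ENNReal.ofReal_le_ofReal_iff hδ]
    refine le_trans ?_ hcap
    rw [ofReal_integral_eq_lintegral_ofReal]
    · unfold capm
      refine le_trans (lintegral_mono_set (Ioc_subset_Icc_self.trans hs)) (lintegral_mono fun X => ?_)
      simp only [hφ]
      rw [ENNReal.ofReal_max]; simp
    · exact (hφi.1)
    · exact Eventually.of_forall fun X => le_max_left _ _
  have m1 : MapsTo (fun t => x + t) (Icc (-η) η) (Icc (x - η) (x + η)) := fun t ht => ⟨by linarith [ht.1], by linarith [ht.2]⟩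
  have m2 : MapsTo (fun t => x - t) (Icc (-η) η) (Icc (x - η) (x + η)) := fun t ht => ⟨by linarith [ht.2], by linarith [ht.1]⟩
  have hη' : -η ≤ η := by linarith
  have c1 : ContinuousOn (fun t => φ (x + t)) (Icc (-η) η) := hcφ.comp (by fun_prop) m1
  have c2 : ContinuousOn (fun t => φ (x - t)) (Icc (-η) η) := hcφ.comp (by fun_prop) m2
  have f1 : ContinuousOn (fun t => f (x + t)) (Icc (-η) η) := hcf.comp (by fun_prop) m1
  have f2 : ContinuousOn (fun t => f (x - t)) (Icc (-η) η) := hcf.comp (by fun_prop) m2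
  have i1 : IntervalIntegrable (fun t => φ (x + t)) volume (-η) η := by
    apply ContinuousOn.intervalIntegrable; rwa [uIcc_of_le hη']
  have i2 : IntervalIntegrable (fun t => φ (x - t)) volume (-η) η := by
    apply ContinuousOn.intervalIntegrable; rwa [uIcc_of_le hη']
  have e1 : ∫ t in (-η)..η, φ (x + t) = ∫ X in (x - η)..(x + η), φ X := by
    rw [intervalIntegral.integral_comp_add_left]; rfl
  have e2 : ∫ t in (-η)..η, φ (x - t) = ∫ X in (x - η)..(x + η), φ X := by
    rw [intervalIntegral.integral_comp_sub_left, sub_neg_eq_add]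
  have h2 : ∫ t in (-η)..η, max 0 (min γ (2 * e - D2 f x t)) ≤ ∫ t in (-η)..η, (φ (x + t) + φ (x - t)) := by
    apply intervalIntegral.integral_mono_on hη'
    · apply ContinuousOn.intervalIntegrable
      rw [uIcc_of_le hη']
      refine ContinuousOn.sup continuousOn_const (ContinuousOn.inf continuousOn_const (continuousOn_const.sub ?_))
      exact (f1.add f2).sub continuousOn_const
    · exact i1.add i2
    · intro t ht
      have g1 := hγ _ (m1 ht)
      have g2 := hγ _ (m2 ht)
      simp only at g1 g2
      simp only [hφ, D2]
      have a1 : max 0 (min (c + s * (x + t) - f (x + t)) γ) ≤ max 0 (min (c + s * (x + t)) (g (x + t)) - f (x + t)) := by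
        apply max_le_max le_rfl
        rw [le_sub_iff_add_le]
        refine le_min ?_ ?_
        · linarith [min_le_left (c + s * (x + t) - f (x + t)) γ]
        · linarith [min_le_right (c + s * (x + t) - f (x + t)) γ]
      have a2 : max 0 (min (c + s * (x - t) - f (x - t)) γ) ≤ max 0 (min (c + s * (x - t)) (g (x - t)) - f (x - t)) := by
        apply max_le_max le_rfl
        rw [le_sub_iff_add_le]
        refine le_min ?_ ?_
        · linarith [min_le_left (c + s * (x - t) - f (x - t)) γ]
        · linarith [min_le_right (c + s * (x - t) - f (x - t)) γ]
      refine le_trans ?_ (add_le_add a1 a2)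
      set A := c + s * (x + t) - f (x + t) with hA
      set B := c + s * (x - t) - f (x - t) with hB
      have hAB : 2 * e - (f (x + t) + f (x - t) - 2 * f x) ≤ A + B := by rw [hA, hB]; linarith
      generalize 2 * e - (f (x + t) + f (x - t) - 2 * f x) = Z at hAB ⊢
      have p1 := le_max_left 0 (min A γ)
      have p2 := le_max_left 0 (min B γ)
      have p3 := le_max_right 0 (min A γ)
      have p4 := le_max_right 0 (min B γ)
      apply max_le (by linarith)
      rcases le_total A γ with hA' | hA' <;> rcases le_total B γ with hB' | hB' <;>
        simp only [min_eq_left hA', min_eq_right hA', min_eq_left hB', min_eq_right hB'] at * <;>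
        linarith [min_le_left γ Z, min_le_right γ Z]
  rw [intervalIntegral.integral_add i1 i2, e1, e2] at h2
  linarith

lemma L1 (h : Body a b H f g) {x ρ e δ y : ℝ} (hρ : 0 < ρ) (hx : x ∈ Icc (a + ρ) (b - ρ)) (he : 0 < e) (hδ : 0 < δ)
    (hy : y ∈ Wm a b f g δ x) (hye : e ≤ y - f x) (hδe : 2 * (4 * δ / e) ≤ ρ) : e ≤ D2 f x (4 * δ / e) := by
  set t0 := 4 * δ / e with ht0
  have ht0p : 0 < t0 := by positivity
  by_contra hD
  push Not at hD
  obtain ⟨y1, y2, c, s, hyc, hcap⟩ := hy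
  have hsub : Icc (x - t0) (x + t0) ⊆ Ioo a b := fun z hz => ⟨by linarith [hz.1, hx.1], by linarith [hz.2, hx.2]⟩
  have := cap_lower (γ := e / 2) (e := e) h ht0p.le hsub (by positivity) (fun X hX => by
    have := h.half (x := x) (t := X - x) (d := ρ) hρ (by linarith [hx.1]) (by linarith [hx.2])
      (abs_le.2 ⟨by linarith [hX.1], by linarith [hX.2]⟩)
    rw [add_sub_cancel] at this
    linarith) hδ.le (by linarith) hcap
  have h2 : ∫ t in (-t0)..t0, e / 2 ≤ ∫ t in (-t0)..t0, max 0 (min (e/2) (2 * e - D2 f x t)) := by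
    apply intervalIntegral.integral_mono_on (by linarith) (by simp)
    · apply ContinuousOn.intervalIntegrable
      rw [uIcc_of_le (by linarith)]
      have hcf := (cvx_cont h.cf).mono hsub
      have f1 : ContinuousOn (fun t => f (x + t)) (Icc (-t0) t0) := hcf.comp (by fun_prop) fun t ht => ⟨by linarith [ht.1], by linarith [ht.2]⟩
      have f2 : ContinuousOn (fun t => f (x - t)) (Icc (-t0) t0) := hcf.comp (by fun_prop) fun t ht => ⟨by linarith [ht.2], by linarith [ht.1]⟩
      refine ContinuousOn.sup continuousOn_const (ContinuousOn.inf continuousOn_const (continuousOn_const.sub ?_))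
      exact (f1.add f2).sub continuousOn_const
    · intro t ht
      have := D2_mono h.cf (x := x) (t := t0) (s := t) ⟨by linarith [hx.1], by linarith [hx.2]⟩ ⟨by linarith [hx.1], by linarith [hx.2]⟩ (abs_le.2 ⟨ht.1, ht.2⟩)
      exact le_max_of_le_right (le_min le_rfl (by linarith))
  rw [intervalIntegral.integral_const, smul_eq_mul] at h2
  have : (t0 - -t0) * (e / 2) = 4 * δ := by rw [ht0]; field_simp; ring
  linarith

/-- upper bound at good points -/
lemma L2 (h : Body a b H f g) {x A κ : ℝ} (hx : x ∈ Ioo a b) (hA0 : 0 ≤ A) (hA : HasDerivAt (rd f) A x)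
    (hκ : 9 * A < 32 * κ ^ 3) (hκ0 : 0 < κ) :
    ∀ᶠ τ : ℝ in nhdsWithin 0 (Ioi 0), ∀ y ∈ Wm a b f g (τ ^ 3) x, y - f x ≤ κ * τ ^ 2 := by
  obtain ⟨A', hA1, hA2⟩ : ∃ A', A < A' ∧ 9 * A' < 32 * κ ^ 3 :=
    ⟨(A + 32 * κ ^ 3 / 9) / 2, by linarith, by linarith⟩
  have hA'0 : 0 < A' := by linarith
  obtain ⟨η, hη, hsub, -, hT⟩ := taylor2 h.cf hx hA (ε := (A' - A) / 2) (by linarith)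
  set m := Real.sqrt (2 * κ / A') with hm
  have hm2 : m ^ 2 = 2 * κ / A' := Real.sq_sqrt (by positivity)
  have hm0 : 0 < m := Real.sqrt_pos.2 (by positivity)
  obtain ⟨d, hd, hd1, hd2⟩ : ∃ d > 0, a ≤ x - d ∧ x + d ≤ b := by
    refine ⟨min (x - a) (b - x), lt_min (by linarith [hx.1]) (by linarith [hx.2]), ?_, ?_⟩
    · linarith [min_le_left (x - a) (b - x)]
    · linarith [min_le_right (x - a) (b - x)]
  have hgf := h.lt x hx
  have ev1 : ∀ᶠ τ : ℝ in nhdsWithin 0 (Ioi 0), τ * m < η := by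
    refine (Tendsto.eventually_lt_const (u := η) (v := 0 * m) (by simpa using hη) ?_)
    exact (tendsto_nhdsWithin_of_tendsto_nhds (Continuous.tendsto (by fun_prop) 0))
  have ev2 : ∀ᶠ τ : ℝ in nhdsWithin 0 (Ioi 0), τ * m < d / 2 := by
    refine (Tendsto.eventually_lt_const (u := d/2) (v := 0 * m) (by simpa using hd) ?_)
    exact (tendsto_nhdsWithin_of_tendsto_nhds (Continuous.tendsto (by fun_prop) 0))
  have ev3 : ∀ᶠ τ : ℝ in nhdsWithin 0 (Ioi 0), 2 * (κ * τ ^ 2) < (g x - f x) / 2 := by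
    refine (Tendsto.eventually_lt_const (v := 2 * (κ * 0 ^ 2)) (by simp; linarith) ?_)
    exact (tendsto_nhdsWithin_of_tendsto_nhds (Continuous.tendsto (by fun_prop) 0))
  filter_upwards [ev1, ev2, ev3, self_mem_nhdsWithin] with τ h1 h2 h3 h0 y hy
  have h0 : 0 < τ := h0
  by_contra hlt
  push Not at hlt
  obtain ⟨y1, y2, c, s, hyc, hcap⟩ := hy
  set e := κ * τ ^ 2 with he
  have hτm : 0 < τ * m := by positivity
  have hs' : Icc (x - τ * m) (x + τ * m) ⊆ Icc (x - η) (x + η) := Icc_subset_Icc (by linarith) (by linarith)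
  have hc := cap_lower (γ := (g x - f x) / 2) (e := e) h hτm.le (hs'.trans hsub) (by linarith) (fun X hX => by
    have := h.half (x := x) (t := X - x) (d := d) hd hd1 hd2
      (abs_le.2 ⟨by linarith [hX.1], by linarith [hX.2]⟩)
    rwa [add_sub_cancel] at this) (by positivity) (by linarith) hcap
  have hmono : ∫ t in (-(τ * m))..(τ * m), (2 * e - A' * t ^ 2) ≤ ∫ t in (-(τ * m))..(τ * m), max 0 (min ((g x - f x) / 2) (2 * e - D2 f x t)) := by
    apply intervalIntegral.integral_mono_on (by linarith)
    · apply Continuous.intervalIntegrable; fun_prop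
    · apply ContinuousOn.intervalIntegrable
      rw [uIcc_of_le (by linarith)]
      have hcf := (cvx_cont h.cf).mono (hs'.trans hsub)
      have f1 : ContinuousOn (fun t => f (x + t)) (Icc (-(τ * m)) (τ * m)) := hcf.comp (by fun_prop) fun t ht => ⟨by linarith [ht.1], by linarith [ht.2]⟩
      have f2 : ContinuousOn (fun t => f (x - t)) (Icc (-(τ * m)) (τ * m)) := hcf.comp (by fun_prop) fun t ht => ⟨by linarith [ht.2], by linarith [ht.1]⟩
      refine ContinuousOn.sup continuousOn_const (ContinuousOn.inf continuousOn_const (continuousOn_const.sub ?_))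
      exact (f1.add f2).sub continuousOn_const
    · intro t ht
      have T1 := abs_le.1 (hT (x + t) ⟨by linarith [ht.1], by linarith [ht.2]⟩)
      have T2 := abs_le.1 (hT (x - t) ⟨by linarith [ht.2], by linarith [ht.1]⟩)
      have hD : D2 f x t ≤ A' * t ^ 2 := by
        unfold D2
        have e1 : x + t - x = t := by ring
        have e2 : x - t - x = -t := by ring
        rw [e1] at T1; rw [e2] at T2
        nlinarith [T1.2, T2.2]
      refine le_max_of_le_right (le_min ?_ (by linarith))
      nlinarith [mul_nonneg hA'0.le (sq_nonneg t)]
  have hIntr : ∫ t in (-(τ * m))..(τ * m), (2 * e - A' * t ^ 2) = 2 * (τ * m) * (2 * e) - A' * (2 * (τ * m) ^ 3 / 3) := by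
    rw [intervalIntegral.integral_sub (by simp) (by apply Continuous.intervalIntegrable; fun_prop), intervalIntegral.integral_const,
      intervalIntegral.integral_const_mul, integral_pow]
    simp only [smul_eq_mul]; norm_num; ring
  have hAm : A' * m ^ 2 = 2 * κ := by rw [hm2]; field_simp
  have hval : 2 * (τ * m) * (2 * e) - A' * (2 * (τ * m) ^ 3 / 3) = 8 / 3 * κ * m * τ ^ 3 := by
    rw [he, show A' * (2 * (τ * m) ^ 3 / 3) = (A' * m ^ 2) * m * τ ^ 3 * 2 / 3 by ring, hAm]; ring
  have hfin : 8 / 3 * κ * m * τ ^ 3 ≤ 2 * τ ^ 3 := by linarith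
  have hτ3 : 0 < τ ^ 3 := by positivity
  have h4 : 4 / 3 * (κ * m) ≤ 1 := by
    have := le_of_mul_le_mul_right (show (8 / 3 * κ * m) * τ ^ 3 ≤ 2 * τ ^ 3 from hfin) hτ3
    linarith
  have h5 : κ ^ 2 * m ^ 2 ≤ (3/4) ^ 2 := by
    rw [← mul_pow]; exact pow_le_pow_left₀ (by positivity) (by linarith) 2
  have h6 : A' * (κ ^ 2 * m ^ 2) ≤ A' * (3/4) ^ 2 := mul_le_mul_of_nonneg_left h5 hA'0.le
  nlinarith [h6, hAm]

/-- lower bound at good points -/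
lemma L3 (h : Body a b H f g) {x A κ : ℝ} (hx : x ∈ Ioo a b) (hA : HasDerivAt (rd f) A x)
    (hκ : 32 * κ ^ 3 < 9 * A) (hκ0 : 0 < κ) :
    ∀ᶠ τ : ℝ in nhdsWithin 0 (Ioi 0), ∀ y, f x ≤ y → y ≤ g x → y < f x + κ * τ ^ 2 → y ∈ Wm a b f g (τ ^ 3) x := by
  obtain ⟨A', hA1, hA2⟩ : ∃ A', A' < A ∧ 32 * κ ^ 3 < 9 * A' :=
    ⟨(A + 32 * κ ^ 3 / 9) / 2, by linarith, by linarith⟩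
  have hκ3 : 0 < κ ^ 3 := by positivity
  have hA'0 : 0 < A' := by linarith
  obtain ⟨η, hη, hsub, -, hT⟩ := taylor2 h.cf hx hA (ε := (A - A') / 2) (by linarith)
  set m := Real.sqrt (2 * κ / A') with hm
  have hm2 : m ^ 2 = 2 * κ / A' := Real.sq_sqrt (by positivity)
  have hm0 : 0 < m := Real.sqrt_pos.2 (by positivity)
  have ev3 : ∀ᶠ τ : ℝ in nhdsWithin 0 (Ioi 0), κ * τ ^ 2 < A' / 2 * η ^ 2 := by
    refine (Tendsto.eventually_lt_const (v := κ * 0 ^ 2) (by simp; positivity) ?_)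
    exact (tendsto_nhdsWithin_of_tendsto_nhds (Continuous.tendsto (by fun_prop) 0))
  filter_upwards [ev3, self_mem_nhdsWithin] with τ h3 h0 y hy1 hy2 hy
  have h0 : 0 < τ := h0
  refine ⟨hy1, hy2, f x + κ * τ ^ 2 - rd f x * x, rd f x, by linarith, ?_⟩
  have hT' : ∀ z ∈ Icc (x - η) (x + η), f x + rd f x * (z - x) + A' / 2 * (z - x) ^ 2 ≤ f z := by
    intro z hz
    have := (abs_le.1 (hT z hz)).1
    nlinarith
  -- pointwise bound
  have hpt : ∀ X ∈ Ioo a b, min (f x + κ * τ ^ 2 - rd f x * x + rd f x * X) (g X) - f X ≤ max 0 (κ * τ ^ 2 - A' / 2 * (X - x) ^ 2) := by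
    intro X hX
    refine le_trans (sub_le_sub_right (min_le_left _ _) _) ?_
    by_cases hXη : X ∈ Icc (x - η) (x + η)
    · have := hT' X hXη
      exact le_max_of_le_right (by linarith)
    · refine le_max_of_le_left ?_
      have hXI := Ioo_subset_Icc_self hX
      have hxI := Ioo_subset_Icc_self hx
      -- convexity along x to X through x ± η
      have key : ∀ σ : ℝ, (σ = η ∨ σ = -η) → 0 ≤ (X - x) / σ → 1 < (X - x) / σ → f x + κ * τ ^ 2 - rd f x * x + rd f x * X - f X ≤ 0 := by
        intro σ hσ _ hgt
        have hσ0 : σ ≠ 0 := by rcases hσ with h | h <;> rw [h] <;> linarith [hη.ne'] <;> simp [hη.ne']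
        have hσ2 : σ ^ 2 = η ^ 2 := by rcases hσ with h | h <;> rw [h] <;> ring
        have hm : x + σ ∈ Icc (x - η) (x + η) := by rcases hσ with h | h <;> rw [h] <;> constructor <;> linarith
        have h1 := hT' _ hm
        rw [show x + σ - x = σ by ring, hσ2] at h1
        set q := (X - x) / σ with hq
        have hXq : X = x + q * σ := by rw [hq]; field_simp; ring
        have hq0 : 0 < q := by linarith
        have hc := h.cf.2 hxI hXI (show 0 ≤ 1 - 1 / q by rw [sub_nonneg, div_le_one hq0]; exact hgt.le) (show 0 ≤ 1 / q by positivity) (by ring)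
        simp only [smul_eq_mul] at hc
        have hpt' : (1 - 1 / q) * x + 1 / q * X = x + σ := by rw [hXq]; field_simp; ring
        rw [hpt'] at hc
        have hc2 : q * f (x + σ) ≤ (q - 1) * f x + f X := by
          have := mul_le_mul_of_nonneg_left hc hq0.le
          have e1 : q * ((1 - 1 / q) * f x + 1 / q * f X) = (q - 1) * f x + f X := by field_simp
          linarith
        have h4 := mul_le_mul_of_nonneg_left h1 hq0.le
        have h5 : rd f x * X = rd f x * x + q * (rd f x * σ) := by rw [hXq]; ring
        nlinarith
      rcases lt_or_ge X (x - η) with hl | hl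
      · have : 1 < (X - x) / (-η) := by rw [lt_div_iff_of_neg (by linarith)]; linarith
        exact key (-η) (Or.inr rfl) (by linarith) this
      · have hr : x + η < X := by
          by_contra hc; push Not at hc; exact hXη ⟨hl, hc⟩
        have : 1 < (X - x) / η := by rw [lt_div_iff₀ hη]; linarith
        exact key η (Or.inl rfl) (by linarith) this
  set q : ℝ → ℝ := fun X => κ * τ ^ 2 - A' / 2 * (X - x) ^ 2 with hq
  have hAm : A' * m ^ 2 = 2 * κ := by rw [hm2]; field_simp
  have hqm : ∀ X, q X = A' / 2 * ((m * τ) ^ 2 - (X - x) ^ 2) := by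
    intro X; simp only [hq]; linear_combination (-(τ ^ 2) / 2) * hAm
  have hmτ : 0 < m * τ := by positivity
  have hqnn : ∀ X ∈ Ioc (x - m * τ) (x + m * τ), 0 ≤ q X := by
    intro X hX
    rw [hqm]
    have : (X - x) ^ 2 ≤ (m * τ) ^ 2 := sq_le_sq' (by linarith [hX.1]) (by linarith [hX.2])
    exact mul_nonneg (by positivity) (by linarith)
  have b1 : capm a b f g (f x + κ * τ ^ 2 - rd f x * x) (rd f x) ≤ ∫⁻ X in Ioc (x - m * τ) (x + m * τ), ENNReal.ofReal (q X) := by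
    unfold capm
    calc _ ≤ ∫⁻ X in Ioo a b, (Ioc (x - m * τ) (x + m * τ)).indicator (fun X => ENNReal.ofReal (q X)) X := by
            refine setLIntegral_mono' measurableSet_Ioo fun X hX => ?_
            by_cases hXm : X ∈ Ioc (x - m * τ) (x + m * τ)
            · rw [indicator_of_mem hXm]
              refine (ENNReal.ofReal_le_ofReal (hpt X hX)).trans (le_of_eq ?_)
              congr 1; exact max_eq_right (hqnn X hXm)
            · rw [indicator_of_notMem hXm, nonpos_iff_eq_zero, ENNReal.ofReal_eq_zero]
              refine (hpt X hX).trans (max_le le_rfl ?_)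
              change q X ≤ 0
              rw [hqm]
              have : (m * τ) ^ 2 ≤ (X - x) ^ 2 := by
                by_contra hc; push Not at hc
                have := abs_lt_of_sq_lt_sq hc hmτ.le
                rw [abs_lt] at this
                exact hXm ⟨by linarith, by linarith⟩
              exact mul_nonpos_of_nonneg_of_nonpos (by positivity) (by linarith)
      _ ≤ ∫⁻ X, (Ioc (x - m * τ) (x + m * τ)).indicator (fun X => ENNReal.ofReal (q X)) X := setLIntegral_le_lintegral _ _
      _ = _ := lintegral_indicator measurableSet_Ioc _
  refine b1.trans ?_
  have hqc : Continuous q := by simp only [hq]; fun_prop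
  have hqi := hqc.intervalIntegrable (μ := volume) (x - m * τ) (x + m * τ)
  rw [← ofReal_integral_eq_lintegral_ofReal hqi.1 ((ae_restrict_iff' measurableSet_Ioc).2 (Eventually.of_forall hqnn)),
    ← intervalIntegral.integral_of_le (by linarith)]
  apply ENNReal.ofReal_le_ofReal
  have hIntr : ∫ X in (x - m * τ)..(x + m * τ), q X = 4 / 3 * κ * m * τ ^ 3 := by
    have : ∫ X in (x - m * τ)..(x + m * τ), q X = ∫ t in (-(m * τ))..(m * τ), (κ * τ ^ 2 - A' / 2 * t ^ 2) := by
      have := intervalIntegral.integral_comp_sub_right (a := x - m * τ) (b := x + m * τ) (fun t => κ * τ ^ 2 - A' / 2 * t ^ 2) x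
      rw [show x - m * τ - x = -(m * τ) by ring, show x + m * τ - x = m * τ by ring] at this
      exact this
    rw [this, intervalIntegral.integral_sub (by simp) (by apply Continuous.intervalIntegrable; fun_prop), intervalIntegral.integral_const,
      intervalIntegral.integral_const_mul, integral_pow]
    simp only [smul_eq_mul]; norm_num
    linear_combination (-(τ ^ 3) * m / 3) * hAm
  rw [hIntr]
  have h5 : κ * m ≤ 3 / 4 := by
    by_contra hc; push Not at hc
    have : (3/4) ^ 2 < (κ * m) ^ 2 := by
      apply pow_lt_pow_left₀ hc (by norm_num) (by norm_num)
    have h6 : A' * (3/4) ^ 2 < A' * (κ * m) ^ 2 := mul_lt_mul_of_pos_left this hA'0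
    nlinarith
  have : 0 < τ ^ 3 := by positivity
  nlinarith

end two
end

noncomputable section

lemma four_eight (k : ℕ) : (4:ENNReal) ^ k * (8 ^ k)⁻¹ = 2⁻¹ ^ k := by
  rw [show (8:ENNReal) = 4 * 2 by norm_num, mul_pow, ENNReal.mul_inv (Or.inl (by simp)) (Or.inl (by simp)), ← mul_assoc,
    ENNReal.mul_inv_cancel (by simp) (by simp), one_mul, ENNReal.inv_pow]

lemma conv_split {α : Type*} [MeasurableSpace α] {μ : Measure α} {F : α → ENNReal} (hm : Measurable F)
    (hfin : ∀ x, F x ≠ ⊤) {C : ENNReal} (htail : ∀ k : ℕ, μ {x | 2 * 4 ^ k < F x} ≤ C * (8 ^ k)⁻¹) (j : ℕ) :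
    ∫⁻ x, F x ∂μ ≤ ∫⁻ x, min (F x) (2 * 4 ^ j) ∂μ + 16 * C * 2⁻¹ ^ j := by
  have hpt : ∀ x, F x ≤ min (F x) (2 * 4 ^ j) + ∑' i : ℕ, {x | 2 * 4 ^ (j + i) < F x}.indicator (fun _ => (2 * 4 ^ (j + i + 1) : ENNReal)) x := by
    intro x
    rcases le_or_gt (F x) (2 * 4 ^ j) with h | h
    · rw [min_eq_left h]; exact le_self_add
    · have hex : ∃ k : ℕ, F x ≤ 2 * 4 ^ k := by
        obtain ⟨n, hn⟩ := ENNReal.exists_nat_gt (hfin x)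
        refine ⟨n, hn.le.trans ?_⟩
        have h1 : n ≤ 2 * 4 ^ n := by
          have := (Nat.lt_pow_self (show 1 < 4 by norm_num) (n := n)).le; omega
        exact_mod_cast h1
      have hf := Nat.find_spec hex
      set k := Nat.find hex with hk
      have hjk : j < k := by
        by_contra hc; push Not at hc
        have : (2 * 4 ^ k : ENNReal) ≤ 2 * 4 ^ j := by
          gcongr; norm_num
        exact absurd (hf.trans this) (not_le.2 h)
      obtain ⟨i, hi⟩ : ∃ i, k = j + i + 1 := ⟨k - j - 1, by omega⟩
      have hlt : 2 * 4 ^ (j + i) < F x := by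
        have := Nat.find_min hex (m := j + i) (by omega)
        exact not_le.1 this
      refine le_trans ?_ le_add_self
      refine le_trans ?_ (ENNReal.le_tsum i)
      rw [indicator_of_mem (by exact hlt), ← hi]; exact hf
  have hms : ∀ k : ℕ, MeasurableSet {x | 2 * 4 ^ k < F x} := fun k => measurableSet_lt measurable_const hm
  calc ∫⁻ x, F x ∂μ ≤ ∫⁻ x, (min (F x) (2 * 4 ^ j) + ∑' i : ℕ, {x | 2 * 4 ^ (j + i) < F x}.indicator (fun _ => (2 * 4 ^ (j + i + 1) : ENNReal)) x) ∂μ := lintegral_mono hpt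
    _ = ∫⁻ x, min (F x) (2 * 4 ^ j) ∂μ + ∑' i : ℕ, 2 * 4 ^ (j + i + 1) * μ {x | 2 * 4 ^ (j + i) < F x} := by
        rw [lintegral_add_left (hm.min measurable_const), lintegral_tsum]
        · congr 1; apply tsum_congr; intro i
          rw [lintegral_indicator_const (hms _)]
        · intro i; exact (measurable_const.indicator (hms _)).aemeasurable
    _ ≤ ∫⁻ x, min (F x) (2 * 4 ^ j) ∂μ + ∑' i : ℕ, (8 * C * 2⁻¹ ^ j) * 2⁻¹ ^ i := by
        refine add_le_add le_rfl (ENNReal.tsum_le_tsum fun i => ?_)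
        refine (mul_le_mul_right (htail (j + i)) _).trans (le_of_eq ?_)
        rw [mul_assoc (8 * C), ← pow_add, ← four_eight (j + i), pow_succ]; ring
    _ = _ := by
        rw [ENNReal.tsum_mul_left, ENNReal.tsum_geometric, ENNReal.one_sub_inv_two, inv_inv]; ring

lemma conv {α : Type*} [MeasurableSpace α] {μ : Measure α} [IsFiniteMeasure μ] {F : ℕ → α → ENNReal} {G : α → ENNReal} (hm : ∀ n, Measurable (F n))
    (hfin : ∀ᶠ n in atTop, ∀ x, F n x ≠ ⊤) {C : ENNReal} (hC : C ≠ ⊤)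
    (htail : ∀ᶠ n in atTop, ∀ k : ℕ, μ {x | 2 * 4 ^ k < F n x} ≤ C * (8 ^ k)⁻¹)
    (hae : ∀ᵐ x ∂μ, Tendsto (fun n => F n x) atTop (nhds (G x))) :
    ∫⁻ x, G x ∂μ ≤ 2 * μ univ + 16 * C ∧ Tendsto (fun n => ∫⁻ x, F n x ∂μ) atTop (nhds (∫⁻ x, G x ∂μ)) := by
  have hsplit : ∀ᶠ n in atTop, ∀ j : ℕ, ∫⁻ x, F n x ∂μ ≤ ∫⁻ x, min (F n x) (2 * 4 ^ j) ∂μ + 16 * C * 2⁻¹ ^ j := by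
    filter_upwards [hfin, htail] with n h1 h2 j using conv_split (hm n) h1 h2 j
  have hlow : ∫⁻ x, G x ∂μ ≤ liminf (fun n => ∫⁻ x, F n x ∂μ) atTop := by
    calc ∫⁻ x, G x ∂μ = ∫⁻ x, liminf (fun n => F n x) atTop ∂μ := by
          apply lintegral_congr_ae
          filter_upwards [hae] with x hx using hx.liminf_eq.symm
      _ ≤ _ := lintegral_liminf_le hm
  have hmin : ∀ j : ℕ, Tendsto (fun n => ∫⁻ x, min (F n x) (2 * 4 ^ j) ∂μ) atTop (nhds (∫⁻ x, min (G x) (2 * 4 ^ j) ∂μ)) := by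
    intro j
    refine tendsto_lintegral_of_dominated_convergence (fun _ => 2 * 4 ^ j) (fun n => (hm n).min measurable_const) ?_ ?_ ?_
    · intro n; exact Eventually.of_forall fun x => min_le_right _ _
    · rw [lintegral_const]
      exact ENNReal.mul_ne_top (ENNReal.mul_ne_top (by simp) (by simp)) (measure_ne_top _ _)
    · filter_upwards [hae] with x hx using hx.min tendsto_const_nhds
  have hup : ∀ j : ℕ, limsup (fun n => ∫⁻ x, F n x ∂μ) atTop ≤ ∫⁻ x, min (G x) (2 * 4 ^ j) ∂μ + 16 * C * 2⁻¹ ^ j := by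
    intro j
    have := ((hmin j).add_const (16 * C * 2⁻¹ ^ j)).limsup_eq
    rw [← this]
    refine limsup_le_limsup ?_
    filter_upwards [hsplit] with n hn using hn j
  have hls : liminf (fun n => ∫⁻ x, F n x ∂μ) atTop ≤ limsup (fun n => ∫⁻ x, F n x ∂μ) atTop := liminf_le_limsup
  refine ⟨?_, ?_⟩
  · refine ((hlow.trans hls).trans ((hup 0).trans ?_))
    simp only [pow_zero, mul_one]
    gcongr
    calc ∫⁻ x, min (G x) 2 ∂μ ≤ ∫⁻ x, 2 ∂μ := lintegral_mono fun x => min_le_right _ _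
      _ = _ := lintegral_const _
  · refine tendsto_of_le_liminf_of_limsup_le hlow ?_
    have ht : Tendsto (fun j : ℕ => ∫⁻ x, G x ∂μ + 16 * C * 2⁻¹ ^ j) atTop (nhds (∫⁻ x, G x ∂μ + 16 * C * 0)) := by
      refine Tendsto.const_add _ (ENNReal.Tendsto.const_mul ?_ (Or.inr (ENNReal.mul_ne_top (by simp) hC)))
      exact ENNReal.tendsto_pow_atTop_nhds_zero_of_lt_one (by simp)
    rw [mul_zero, add_zero] at ht
    refine ge_of_tendsto' ht fun j => (hup j).trans ?_
    gcongr
    exact min_le_left _ _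

/-- local limit constant -/
def kap (f : ℝ → ℝ) (x : ℝ) : ℝ := (9 / 32 * deriv (rd f) x) ^ ((1:ℝ) / 3)

/-- slice of the wet part cut by upper caps -/
def Wp (a b : ℝ) (f g : ℝ → ℝ) (δ x : ℝ) : Set ℝ := {y | -y ∈ Wm a b (fun x => - g x) (fun x => - f x) δ x}

section three
variable {a b H : ℝ} {f g : ℝ → ℝ}

lemma Body.H0 (h : Body a b H f g) : 0 ≤ H := (abs_nonneg _).trans (h.bf a ⟨le_rfl, h.hab.le⟩)

lemma weak_W (h : Body a b H f g) {τ : ℝ} (hτ : 0 < τ) (k : ℕ) :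
    volume {x | x ∈ Ioo a b ∧ ∃ y ∈ Wm a b f g (τ ^ 3) x, 4 ^ k * τ ^ 2 ≤ y - f x} ≤
      ENNReal.ofReal (16 * (2 * H + 1) + 16 * H) * (8 ^ k)⁻¹ := by
  have hH := h.H0
  set R := 8 * (2 * H + 1) with hR
  have hR0 : 0 < R := by positivity
  set ρ := R / 8 ^ k with hρ
  have hρ0 : 0 < ρ := by positivity
  set e := 4 ^ k * τ ^ 2 with he
  have he0 : 0 < e := by positivity
  have ht0 : 4 * τ ^ 3 / e = 4 * τ / 4 ^ k := by rw [he]; field_simp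
  rcases lt_or_ge (2 * H) e with hlt | hle
  · have : {x | x ∈ Ioo a b ∧ ∃ y ∈ Wm a b f g (τ ^ 3) x, e ≤ y - f x} = ∅ := by
      ext x; simp only [mem_ofPred_eq, mem_empty_iff_false, iff_false]
      rintro ⟨hx, y, hy, hye⟩
      have b1 := abs_le.1 (h.bf x (Ioo_subset_Icc_self hx))
      have b2 := abs_le.1 (h.bg x (Ioo_subset_Icc_self hx))
      have := hy.2.1
      linarith
    rw [this]; simp
  have h84 : (8:ℝ) ^ k = 4 ^ k * 2 ^ k := by rw [← mul_pow]; norm_num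
  have h24 : (4:ℝ) ^ k = (2 ^ k) ^ 2 := by rw [← pow_mul, mul_comm, pow_mul]; norm_num
  have hτk : 2 ^ k * τ ≤ 2 * H + 1 := by
    have h1 : (2 ^ k * τ) ^ 2 ≤ 2 * H := by rw [mul_pow, ← h24]; exact hle
    have h2 : (2 ^ k * τ) ^ 2 ≤ (2 * H + 1) ^ 2 := by nlinarith
    exact le_of_sq_le_sq h2 (by positivity)
  have h2t : 2 * (4 * τ ^ 3 / e) ≤ ρ := by
    rw [ht0, hρ, le_div_iff₀ (by positivity), h84]
    calc 2 * (4 * τ / 4 ^ k) * (4 ^ k * 2 ^ k) = 8 * (2 ^ k * τ) := by field_simp; ring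
      _ ≤ R := by rw [hR]; linarith
  have hsub : {x | x ∈ Ioo a b ∧ ∃ y ∈ Wm a b f g (τ ^ 3) x, e ≤ y - f x} ⊆
      Ioo a (a + ρ) ∪ Ioo (b - ρ) b ∪ {x | x ∈ Icc (a + ρ) (b - ρ) ∧ e ≤ D2 f x (4 * τ ^ 3 / e)} := by
    rintro x ⟨hx, y, hy, hye⟩
    rcases lt_or_ge x (a + ρ) with h1 | h1
    · exact Or.inl (Or.inl ⟨hx.1, h1⟩)
    rcases lt_or_ge (b - ρ) x with h2 | h2
    · exact Or.inl (Or.inr ⟨h2, hx.2⟩)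
    exact Or.inr ⟨⟨h1, h2⟩, L1 h hρ0 ⟨h1, h2⟩ he0 (by positivity) hy hye h2t⟩
  refine (measure_mono hsub).trans ((measure_union_le _ _).trans ?_)
  refine (add_le_add (measure_union_le _ _) (weak_D h.cf h.bf hρ0 (by positivity) h2t he0)).trans ?_
  rw [Real.volume_Ioo, Real.volume_Ioo, ← ENNReal.ofReal_add (by linarith) (by linarith), ← ENNReal.ofReal_add (by linarith) (by positivity)]
  rw [show ((8:ENNReal) ^ k)⁻¹ = ENNReal.ofReal ((8 ^ k)⁻¹) by
    rw [ENNReal.ofReal_inv_of_pos (by positivity), ENNReal.ofReal_pow (by norm_num)]; norm_num]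
  rw [← ENNReal.ofReal_mul (by positivity)]
  apply ENNReal.ofReal_le_ofReal
  have e1 : 8 * H * (4 * τ ^ 3 / e) ^ 2 / (ρ * e) = 128 * H / R * (8 ^ k)⁻¹ := by
    rw [ht0, hρ, he, h84, h24]; field_simp; ring
  rw [e1]
  have e2 : 128 * H / R ≤ 16 * H := by
    rw [div_le_iff₀ hR0, hR]; nlinarith
  have e3 : a + ρ - a + (b - (b - ρ)) = 2 * R * (8 ^ k)⁻¹ := by rw [hρ]; field_simp; ring
  rw [e3, ← add_mul]
  apply mul_le_mul_of_nonneg_right _ (by positivity)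
  rw [hR] at e2 ⊢; linarith

/-- width of the wet part in the slice -/
def wid (a b : ℝ) (f g : ℝ → ℝ) (δ x : ℝ) : ENNReal := volume (Wm a b f g δ x ∪ Wp a b f g δ x)

lemma wid_weak (h : Body a b H f g) {τ : ℝ} (hτ : 0 < τ) (k : ℕ) :
    volume {x | x ∈ Ioo a b ∧ 2 * 4 ^ k < (ENNReal.ofReal (τ ^ 2))⁻¹ * wid a b f g (τ ^ 3) x} ≤
      (2 * ENNReal.ofReal (16 * (2 * H + 1) + 16 * H)) * (8 ^ k)⁻¹ := by
  rw [show ∀ X Y : ENNReal, (2 * X) * Y = X * Y + X * Y by intros; ring]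
  refine le_trans (measure_mono ?_) ((measure_union_le _ _).trans (add_le_add (weak_W h hτ k) (weak_W h.neg hτ k)))
  rintro x ⟨hx, hlt⟩
  by_contra hc
  simp only [mem_union, mem_ofPred_eq, not_or, not_and, not_exists, not_le] at hc
  obtain ⟨c1, c2⟩ := hc
  apply absurd hlt (not_lt.2 _)
  have hsub : Wm a b f g (τ ^ 3) x ∪ Wp a b f g (τ ^ 3) x ⊆ Icc (f x) (f x + 4 ^ k * τ ^ 2) ∪ Icc (g x - 4 ^ k * τ ^ 2) (g x) := by
    rintro y (hy | hy)
    · exact Or.inl ⟨hy.1, by linarith [c1 hx y hy]⟩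
    · exact Or.inr ⟨by have := c2 hx (-y) hy; linarith, neg_le_neg_iff.1 hy.1⟩
  have hw : wid a b f g (τ ^ 3) x ≤ ENNReal.ofReal (τ ^ 2) * (2 * 4 ^ k) := by
    refine (measure_mono hsub).trans ((measure_union_le _ _).trans (le_of_eq ?_))
    rw [Real.volume_Icc, Real.volume_Icc, ← ENNReal.ofReal_add (by simp; positivity) (by simp; positivity)]
    rw [show f x + 4 ^ k * τ ^ 2 - f x + (g x - (g x - 4 ^ k * τ ^ 2)) = τ ^ 2 * (2 * 4 ^ k) by ring, ENNReal.ofReal_mul (by positivity),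
      ENNReal.ofReal_mul (by positivity), ENNReal.ofReal_pow (by norm_num) k]
    norm_num
  calc (ENNReal.ofReal (τ ^ 2))⁻¹ * wid a b f g (τ ^ 3) x ≤ (ENNReal.ofReal (τ ^ 2))⁻¹ * (ENNReal.ofReal (τ ^ 2) * (2 * 4 ^ k)) := by gcongr
    _ = 2 * 4 ^ k := by
      rw [← mul_assoc, ENNReal.inv_mul_cancel (by simp; positivity) (by simp), one_mul]

lemma kap_spec {f : ℝ → ℝ} {x A : ℝ} (hA0 : 0 ≤ A) (hA : HasDerivAt (rd f) A x) : 0 ≤ kap f x ∧ 32 * kap f x ^ 3 = 9 * A := by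
  unfold kap
  rw [hA.deriv]
  refine ⟨by positivity, ?_⟩
  rw [← Real.rpow_natCast (_ ^ _) 3, ← Real.rpow_mul (by positivity)]
  norm_num
  ring

lemma wid_lim (h : Body a b H f g) {x A B : ℝ} (hx : x ∈ Ioo a b) (hA0 : 0 ≤ A) (hA : HasDerivAt (rd f) A x)
    (hB0 : 0 ≤ B) (hB : HasDerivAt (rd (fun x => - g x)) B x) :
    Tendsto (fun τ : ℝ => (ENNReal.ofReal (τ ^ 2))⁻¹ * wid a b f g (τ ^ 3) x) (nhdsWithin 0 (Ioi 0))
      (nhds (ENNReal.ofReal (kap f x + kap (fun x => - g x) x))) := by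
  obtain ⟨k0, k1⟩ := kap_spec hA0 hA
  obtain ⟨l0, l1⟩ := kap_spec hB0 hB
  set p := kap f x
  set q := kap (fun x => - g x) x
  have hgf := h.lt x hx
  have hdiv : ∀ τ : ℝ, 0 < τ → ∀ r : ℝ, 0 ≤ r → (ENNReal.ofReal (τ ^ 2))⁻¹ * ENNReal.ofReal (r * τ ^ 2) = ENNReal.ofReal r := by
    intro τ hτ r hr
    rw [ENNReal.ofReal_mul hr, mul_comm (ENNReal.ofReal r), ← mul_assoc, ENNReal.inv_mul_cancel (by simp; positivity) (by simp), one_mul]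
  have hU : ∀ ε : ℝ, 0 < ε → ∀ᶠ τ : ℝ in nhdsWithin 0 (Ioi 0), (ENNReal.ofReal (τ ^ 2))⁻¹ * wid a b f g (τ ^ 3) x ≤ ENNReal.ofReal (p + q + 2 * ε) := by
    intro ε hε
    have u1 := L2 h hx hA0 hA (κ := p + ε) (by
      have : p ^ 3 < (p + ε) ^ 3 := pow_lt_pow_left₀ (by linarith) k0 (by norm_num)
      linarith) (by linarith)
    have u2 := L2 h.neg hx hB0 hB (κ := q + ε) (by
      have : q ^ 3 < (q + ε) ^ 3 := pow_lt_pow_left₀ (by linarith) l0 (by norm_num)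
      linarith) (by linarith)
    filter_upwards [u1, u2, self_mem_nhdsWithin] with τ h1 h2 h0
    have h0 : 0 < τ := h0
    rw [← hdiv τ h0 (p + q + 2 * ε) (by linarith)]
    gcongr
    have hsub : Wm a b f g (τ ^ 3) x ∪ Wp a b f g (τ ^ 3) x ⊆ Icc (f x) (f x + (p + ε) * τ ^ 2) ∪ Icc (g x - (q + ε) * τ ^ 2) (g x) := by
      rintro y (hy | hy)
      · exact Or.inl ⟨hy.1, by linarith [h1 y hy]⟩
      · exact Or.inr ⟨by have := h2 (-y) hy; linarith, neg_le_neg_iff.1 hy.1⟩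
    refine (measure_mono hsub).trans ((measure_union_le _ _).trans (le_of_eq ?_))
    rw [Real.volume_Icc, Real.volume_Icc, ← ENNReal.ofReal_add (by simp; positivity) (by simp; positivity)]
    congr 1; ring
  have hL : ∀ p' q' : ℝ, 0 ≤ p' → (p' = 0 ∨ p' < p) → 0 ≤ q' → (q' = 0 ∨ q' < q) →
      ∀ᶠ τ : ℝ in nhdsWithin 0 (Ioi 0), ENNReal.ofReal (p' + q') ≤ (ENNReal.ofReal (τ ^ 2))⁻¹ * wid a b f g (τ ^ 3) x := by
    intro p' q' hp0 hp hq0 hq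
    have u1 : ∀ᶠ τ : ℝ in nhdsWithin 0 (Ioi 0), ∀ y, f x ≤ y → y ≤ g x → y < f x + p' * τ ^ 2 → y ∈ Wm a b f g (τ ^ 3) x := by
      rcases hp0.eq_or_lt with h' | h'
      · refine Eventually.of_forall fun τ y h1 _ h2 => ?_
        rw [← h'] at h2; linarith
      · have hp' : p' < p := hp.resolve_left h'.ne'
        exact L3 h hx hA (by
          have : p' ^ 3 < p ^ 3 := pow_lt_pow_left₀ hp' hp0 (by norm_num)
          linarith) h'
    have u2 : ∀ᶠ τ : ℝ in nhdsWithin 0 (Ioi 0), ∀ y, - g x ≤ y → y ≤ - f x → y < - g x + q' * τ ^ 2 → y ∈ Wm a b (fun x => - g x) (fun x => - f x) (τ ^ 3) x := by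
      rcases hq0.eq_or_lt with h' | h'
      · refine Eventually.of_forall fun τ y h1 _ h2 => ?_
        rw [← h'] at h2; linarith
      · have hq' : q' < q := hq.resolve_left h'.ne'
        exact L3 h.neg hx hB (by
          have : q' ^ 3 < q ^ 3 := pow_lt_pow_left₀ hq' hq0 (by norm_num)
          linarith) h'
    have u3 : ∀ᶠ τ : ℝ in nhdsWithin 0 (Ioi 0), (p' + q') * τ ^ 2 < g x - f x := by
      refine (Tendsto.eventually_lt_const (v := (p' + q') * 0 ^ 2) (by simp; linarith) ?_)
      exact (tendsto_nhdsWithin_of_tendsto_nhds (Continuous.tendsto (by fun_prop) 0))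
    filter_upwards [u1, u2, u3, self_mem_nhdsWithin] with τ h1 h2 h3 h0
    have h0 : 0 < τ := h0
    rw [← hdiv τ h0 (p' + q') (by linarith)]
    gcongr
    have hpp : 0 ≤ p' * τ ^ 2 := by positivity
    have hqq : 0 ≤ q' * τ ^ 2 := by positivity
    have hsub : Ico (f x) (f x + p' * τ ^ 2) ∪ Ioc (g x - q' * τ ^ 2) (g x) ⊆ Wm a b f g (τ ^ 3) x ∪ Wp a b f g (τ ^ 3) x := by
      rintro y (hy | hy)
      · exact Or.inl (h1 y hy.1 (by linarith [hy.2]) hy.2)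
      · exact Or.inr (h2 (-y) (by linarith [hy.2]) (by linarith [hy.1]) (by linarith [hy.1]))
    refine le_trans (le_of_eq ?_) (measure_mono hsub)
    rw [measure_union _ measurableSet_Ioc, Real.volume_Ico, Real.volume_Ioc, ← ENNReal.ofReal_add (by linarith) (by linarith)]
    · congr 1; ring
    · rw [Set.disjoint_left]
      intro y hy1 hy2
      linarith [hy1.2, hy2.1]
  refine tendsto_order.2 ⟨fun c hc => ?_, fun c hc => ?_⟩
  · obtain ⟨ε, hε, hlt⟩ : ∃ ε > 0, c < ENNReal.ofReal (p + q - 2 * ε) := by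
      have : Tendsto (fun ε : ℝ => ENNReal.ofReal (p + q - 2 * ε)) (nhdsWithin 0 (Ioi 0)) (nhds (ENNReal.ofReal (p + q - 2 * 0))) :=
        tendsto_nhdsWithin_of_tendsto_nhds ((ENNReal.continuous_ofReal.comp (by fun_prop)).tendsto 0)
      have h2 := (this.eventually_const_lt (by simpa using hc)).and self_mem_nhdsWithin
      obtain ⟨ε, h1, h2⟩ := h2.exists
      exact ⟨ε, h2, h1⟩
    filter_upwards [hL (max 0 (p - ε)) (max 0 (q - ε)) (le_max_left _ _) (by
      rcases le_total (p - ε) 0 with h | h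
      · left; exact max_eq_left h
      · right; rw [max_eq_right h]; linarith) (le_max_left _ _) (by
      rcases le_total (q - ε) 0 with h | h
      · left; exact max_eq_left h
      · right; rw [max_eq_right h]; linarith)] with τ hτ
    refine lt_of_lt_of_le (hlt.trans_le (ENNReal.ofReal_le_ofReal ?_)) hτ
    linarith [le_max_right 0 (p - ε), le_max_right 0 (q - ε)]
  · obtain ⟨ε, hε, hlt⟩ : ∃ ε > 0, ENNReal.ofReal (p + q + 2 * ε) < c := by
      have : Tendsto (fun ε : ℝ => ENNReal.ofReal (p + q + 2 * ε)) (nhdsWithin 0 (Ioi 0)) (nhds (ENNReal.ofReal (p + q + 2 * 0))) :=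
        tendsto_nhdsWithin_of_tendsto_nhds ((ENNReal.continuous_ofReal.comp (by fun_prop)).tendsto 0)
      have h2 := (this.eventually_lt_const (by simpa using hc)).and self_mem_nhdsWithin
      obtain ⟨ε, h1, h2⟩ := h2.exists
      exact ⟨ε, h2, h1⟩
    filter_upwards [hU ε hε] with τ hτ using lt_of_le_of_lt hτ hlt

end three
end

noncomputable section

/-- the region described by the two graphs -/
def IsBody (S : Set (E 2)) (a b H : ℝ) (f g : ℝ → ℝ) : Prop :=
  Body a b H f g ∧ ∀ x y, mkE x y ∈ S ↔ x ∈ Icc a b ∧ f x ≤ y ∧ y ≤ g x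

lemma mkE_comb {p q x1 x2 y1 y2 : ℝ} : p • mkE x1 y1 + q • mkE x2 y2 = mkE (p * x1 + q * x2) (p * y1 + q * y2) := by
  apply E2_ext <;> simp

lemma mkE_eta (z : E 2) : mkE (z 0) (z 1) = z := by apply E2_ext <;> simp

lemma continuous_coord (i : Fin 2) : Continuous (fun z : E 2 => z i) := by fun_prop

lemma exists_body {S : Set (E 2)} (hc : IsCompact S) (hconv : Convex ℝ S) (hIntr : (interior S).Nonempty) :
    ∃ a b H f g, IsBody S a b H f g := by
  obtain ⟨o, ho⟩ := hIntr
  obtain ⟨r, hr, hball⟩ := Metric.isOpen_iff.1 isOpen_interior o ho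
  have hballS : ∀ u v : ℝ, |u| + |v| < r → mkE (o 0 + u) (o 1 + v) ∈ S := by
    intro u v h
    apply interior_subset; apply hball
    rw [Metric.mem_ball, dist_eq_norm]
    have : mkE (o 0 + u) (o 1 + v) - o = mkE u v := by apply E2_ext <;> simp
    rw [this]
    exact (norm_mkE_le u v).trans_lt h
  set P : Set ℝ := (fun z : E 2 => z 0) '' S with hP
  set sl : ℝ → Set ℝ := fun x => (fun z : E 2 => z 1) '' (S ∩ {z | z 0 = x}) with hsl
  have hmem : ∀ x y, y ∈ sl x ↔ mkE x y ∈ S := by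
    intro x y
    constructor
    · rintro ⟨z, ⟨h1, h2⟩, rfl⟩
      have h2 : z 0 = x := h2
      rw [← h2]; simpa [mkE_eta] using h1
    · intro h; exact ⟨_, ⟨h, by simp⟩, by simp⟩
  have hPc : IsCompact P := hc.image (continuous_coord 0)
  have hlin : ∀ i : Fin 2, IsLinearMap ℝ (fun z : E 2 => z i) := fun i => ⟨fun _ _ => rfl, fun _ _ => rfl⟩
  have hPconv : Convex ℝ P := hconv.is_linear_image (hlin 0)
  have hSne : S.Nonempty := ⟨o, interior_subset ho⟩
  have hPI : P = Icc (sInf P) (sSup P) := eq_Icc_of_connected_compact ⟨hSne.image _, hPconv.isPreconnected⟩ hPc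
  have hslc : ∀ x, IsCompact (sl x) := fun x =>
    (hc.inter_right (isClosed_eq (continuous_coord 0) continuous_const)).image (continuous_coord 1)
  have hslconv : ∀ x, Convex ℝ (sl x) := by
    intro x
    refine Convex.is_linear_image (hconv.inter ?_) (hlin 1)
    exact (convex_singleton x).is_linear_preimage (hlin 0)
  have hslne : ∀ x ∈ P, (sl x).Nonempty := by
    rintro x ⟨z, hz, rfl⟩; exact ⟨z 1, z, ⟨hz, rfl⟩, rfl⟩
  have hslI : ∀ x ∈ P, sl x = Icc (sInf (sl x)) (sSup (sl x)) := fun x hx =>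
    eq_Icc_of_connected_compact ⟨hslne x hx, (hslconv x).isPreconnected⟩ (hslc x)
  set a := sInf P
  set b := sSup P
  set f : ℝ → ℝ := fun x => sInf (sl x) with hf
  set g : ℝ → ℝ := fun x => sSup (sl x) with hg
  have hiff : ∀ x y, mkE x y ∈ S ↔ x ∈ Icc a b ∧ f x ≤ y ∧ y ≤ g x := by
    intro x y
    rw [← hPI, ← hmem]
    constructor
    · intro h
      have hx : x ∈ P := by
        obtain ⟨z, ⟨h1, h2⟩, _⟩ := h; exact ⟨z, h1, h2⟩
      rw [hslI x hx] at h
      exact ⟨hx, h⟩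
    · rintro ⟨hx, h⟩
      rw [hslI x hx]; exact h
  have hle : ∀ x ∈ Icc a b, f x ≤ g x := by
    intro x hx
    rw [← hPI] at hx
    have := hslne x hx
    rw [hslI x hx] at this
    exact nonempty_Icc.1 this
  have hfm : ∀ x ∈ Icc a b, mkE x (f x) ∈ S := fun x hx => (hiff _ _).2 ⟨hx, le_rfl, hle x hx⟩
  have hgm : ∀ x ∈ Icc a b, mkE x (g x) ∈ S := fun x hx => (hiff _ _).2 ⟨hx, hle x hx, le_rfl⟩
  obtain ⟨H, hH⟩ := hc.isBounded.exists_norm_le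
  have ho1 : o 0 + r/2 ∈ Icc a b := ((hiff _ _).1 (hballS (r/2) 0 (by rw [abs_of_pos (by linarith)]; simp; linarith))).1
  have ho2 : o 0 + -(r/2) ∈ Icc a b := ((hiff _ _).1 (hballS (-(r/2)) 0 (by rw [abs_neg, abs_of_pos (by linarith)]; simp; linarith))).1
  have hv : f (o 0) < g (o 0) := by
    have h1 := ((hiff _ _).1 (hballS 0 (r/2) (by rw [abs_of_pos (by linarith : 0 < r/2)]; simp; linarith))).2
    have h2 := ((hiff _ _).1 (hballS 0 (-(r/2)) (by rw [abs_neg, abs_of_pos (by linarith : 0 < r/2)]; simp; linarith))).2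
    rw [add_zero] at h1 h2
    linarith [h1.2, h2.1]
  have hcf : ConvexOn ℝ (Icc a b) f := by
    refine ⟨convex_Icc _ _, fun x1 h1 x2 h2 p q hp hq hpq => ?_⟩
    have := hconv (hfm x1 h1) (hfm x2 h2) hp hq hpq
    rw [mkE_comb] at this
    exact ((hiff _ _).1 this).2.1
  have hcg : ConcaveOn ℝ (Icc a b) g := by
    refine ⟨convex_Icc _ _, fun x1 h1 x2 h2 p q hp hq hpq => ?_⟩
    have := hconv (hgm x1 h1) (hgm x2 h2) hp hq hpq
    rw [mkE_comb] at this
    exact ((hiff _ _).1 this).2.2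
  refine ⟨a, b, H, f, g, ⟨by linarith [ho1.2, ho2.1], hcf, hcg, hle, ?_, ?_, ?_⟩, hiff⟩
  · intro x hx
    have ho0 : o 0 ∈ Icc a b := ⟨by linarith [ho2.1], by linarith [ho1.2]⟩
    have key : ∀ y ∈ Icc a b, ∀ θ, 0 ≤ θ → θ < 1 → x = (1 - θ) * o 0 + θ * y → f x < g x := by
      intro y hy θ h0 h1 hxe
      have c1 := hcf.2 ho0 hy (show 0 ≤ 1 - θ by linarith) h0 (by ring)
      have c2 := hcg.2 ho0 hy (show 0 ≤ 1 - θ by linarith) h0 (by ring)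
      simp only [smul_eq_mul, ← hxe] at c1 c2
      have l2 := hle y hy
      have : 0 < (1 - θ) * (g (o 0) - f (o 0)) := mul_pos (by linarith) (by linarith)
      have : 0 ≤ θ * (g y - f y) := mul_nonneg h0 (by linarith)
      nlinarith
    have hab : a ≤ b := ho0.1.trans ho0.2
    rcases lt_trichotomy x (o 0) with h | h | h
    · have h1 : 0 < o 0 - a := by linarith [hx.1]
      exact key a ⟨le_rfl, hab⟩ ((o 0 - x) / (o 0 - a)) (div_nonneg (by linarith) h1.le) (by rw [div_lt_one h1]; linarith [hx.1])
        (by field_simp; ring)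
    · rw [h]; exact hv
    · have h1 : 0 < b - o 0 := by linarith [hx.2]
      exact key b ⟨hab, le_rfl⟩ ((x - o 0) / (b - o 0)) (div_nonneg (by linarith) h1.le) (by rw [div_lt_one h1]; linarith [hx.2])
        (by field_simp; ring)
  · intro x hx
    exact (abs_coord_le (mkE x (f x)) 1).trans (hH _ (hfm x hx))
  · intro x hx
    exact (abs_coord_le (mkE x (g x)) 1).trans (hH _ (hgm x hx))

lemma vol_slices {T : Set (E 2)} (hT : MeasurableSet T) : volume T = ∫⁻ x, volume {y | mkE x y ∈ T} := by
  have h1 : volume T = volume (toProd.symm ⁻¹' T) := (mp_toProd.symm.measure_preimage hT.nullMeasurableSet).symm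
  rw [h1, Measure.volume_eq_prod, Measure.prod_apply (toProd.symm.measurable hT)]
  rfl

lemma meas_slices {T : Set (E 2)} (hT : MeasurableSet T) : Measurable fun x => volume {y | mkE x y ∈ T} := by
  have := measurable_measure_prodMk_left (ν := (volume : Measure ℝ)) (toProd.symm.measurable hT)
  convert this using 3
  ext y; simp

section four
variable {S : Set (E 2)} {a b H : ℝ} {f g : ℝ → ℝ}

lemma vol_slices_Ioo (h : IsBody S a b H f g) {T : Set (E 2)} (hT : MeasurableSet T) (hTS : T ⊆ S) :
    volume T = ∫⁻ x in Ioo a b, volume {y | mkE x y ∈ T} := by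
  rw [vol_slices hT, Measure.restrict_congr_set Ioo_ae_eq_Icc, ← lintegral_indicator measurableSet_Icc]
  congr 1; funext x
  by_cases hx : x ∈ Icc a b
  · rw [indicator_of_mem hx]
  · rw [indicator_of_notMem hx]
    have : {y | mkE x y ∈ T} = ∅ := by
      ext y; simp only [mem_ofPred_eq, mem_empty_iff_false, iff_false]
      intro hy; exact hx ((h.2 x y).1 (hTS hy)).1
    rw [this]; simp

lemma capm_eq (h : IsBody S a b H f g) (hS : MeasurableSet S) (c s : ℝ) :
    volume {z ∈ S | z 1 < c + s * z 0} = capm a b f g c s := by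
  have hm : MeasurableSet {z ∈ S | z 1 < c + s * z 0} := by
    exact hS.inter (measurableSet_lt (f := fun z : E 2 => z 1) (g := fun z : E 2 => c + s * z 0) (continuous_coord 1).measurable
      (((continuous_coord 0).measurable.const_mul s).const_add c))
  rw [vol_slices_Ioo h hm (fun z hz => hz.1)]
  unfold capm
  refine setLIntegral_congr_fun measurableSet_Ioo fun x hx => ?_
  have hx' := Ioo_subset_Icc_self hx
  simp only [mem_ofPred_eq, h.2, mkE_zero, mkE_one]
  apply le_antisymm
  · rw [← Real.volume_Icc]
    refine measure_mono fun y hy => ⟨hy.1.2.1, le_min hy.2.le hy.1.2.2⟩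
  · rw [← Real.volume_Ico]
    refine measure_mono fun y hy => ⟨⟨hx', hy.1, (hy.2.trans_le (min_le_right _ _)).le⟩, hy.2.trans_le (min_le_left _ _)⟩

lemma capm_eq' (h : IsBody S a b H f g) (hS : MeasurableSet S) (c s : ℝ) :
    volume {z ∈ S | - z 1 < c + s * z 0} = capm a b (fun x => - g x) (fun x => - f x) c s := by
  have hm : MeasurableSet {z ∈ S | - z 1 < c + s * z 0} := by
    exact hS.inter (measurableSet_lt (f := fun z : E 2 => - z 1) (g := fun z : E 2 => c + s * z 0) (continuous_coord 1).measurable.neg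
      (((continuous_coord 0).measurable.const_mul s).const_add c))
  rw [vol_slices_Ioo h hm (fun z hz => hz.1)]
  unfold capm
  refine setLIntegral_congr_fun measurableSet_Ioo fun x hx => ?_
  have hx' := Ioo_subset_Icc_self hx
  simp only [mem_ofPred_eq, h.2, mkE_zero, mkE_one]
  rw [show min (c + s * x) (- f x) - - g x = g x - - min (c + s * x) (- f x) by ring]
  apply le_antisymm
  · rw [← Real.volume_Icc]
    refine measure_mono fun y hy => ⟨?_, hy.1.2.2⟩
    have := le_min hy.2.le (neg_le_neg hy.1.2.1)
    linarith
  · rw [← Real.volume_Ioc]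
    refine measure_mono fun y hy => ⟨⟨hx', ?_, hy.2⟩, ?_⟩
    · linarith [hy.1, min_le_right (c + s * x) (- f x)]
    · linarith [hy.1, min_le_left (c + s * x) (- f x)]

lemma meas_floating (hS : IsClosed S) (δ : ℝ) : MeasurableSet (floatingBody S δ) := by
  apply IsClosed.measurableSet
  have : floatingBody S δ = S ∩ ⋂ (φ : E 2 →L[ℝ] ℝ) (c : ℝ) (_ : volume {y ∈ S | c < φ y} ≤ ENNReal.ofReal δ), {x | φ x ≤ c} := by
    ext x; simp [floatingBody]
  rw [this]
  refine hS.inter (isClosed_iInter fun φ => isClosed_iInter fun c => isClosed_iInter fun _ => ?_)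
  exact isClosed_le φ.continuous continuous_const

lemma wet_slice (h : IsBody S a b H f g) (hS : IsClosed S) {δ : ℝ} (hδ : ENNReal.ofReal δ < volume S) {x : ℝ} (hx : x ∈ Ioo a b) :
    {y | mkE x y ∈ S \ floatingBody S δ} = Wm a b f g δ x ∪ Wp a b f g δ x := by
  have hx' := Ioo_subset_Icc_self hx
  have hSm := hS.measurableSet
  have hHb := h.1.H0
  ext y
  constructor
  · rintro ⟨hyS, hyF⟩
    have hyS' := ((h.2 _ _).1 hyS).2
    have : ∃ (φ : E 2 →L[ℝ] ℝ) (c : ℝ), volume {y ∈ S | c < φ y} ≤ ENNReal.ofReal δ ∧ c < φ (mkE x y) := by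
      by_contra hc
      push Not at hc
      exact hyF ⟨hyS, hc⟩
    obtain ⟨φ, c, hvol, hlt⟩ := this
    obtain ⟨u, hu⟩ := exists_lc φ
    simp only [hu] at hvol hlt
    have lower : ∀ c' s, y < c' + s * x → (∀ z ∈ S, z 1 < c' + s * z 0 → c < lc u z) → y ∈ Wm a b f g δ x := by
      intro c' s h1 h2
      refine ⟨hyS'.1, hyS'.2, c', s, h1, ?_⟩
      rw [← capm_eq h hSm]
      exact (measure_mono fun z hz => (⟨hz.1, h2 z hz.1 hz.2⟩ : z ∈ {y ∈ S | c < lc u y})).trans hvol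
    have upper : ∀ c' s, -y < c' + s * x → (∀ z ∈ S, - z 1 < c' + s * z 0 → c < lc u z) → y ∈ Wp a b f g δ x := by
      intro c' s h1 h2
      refine ⟨neg_le_neg hyS'.2, neg_le_neg hyS'.1, c', s, h1, ?_⟩
      rw [← capm_eq' h hSm]
      exact (measure_mono fun z hz => (⟨hz.1, h2 z hz.1 hz.2⟩ : z ∈ {y ∈ S | c < lc u y})).trans hvol
    have hb : ∀ z ∈ S, - H ≤ z 1 := by
      intro z hz
      rw [← mkE_eta z, h.2] at hz
      have := (abs_le.1 (h.1.bf _ hz.1)).1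
      linarith [hz.2.1]
    have hyH : y ≤ H := by linarith [(abs_le.1 (h.1.bg _ hx')).2]
    simp only [lc, mkE_zero, mkE_one] at hlt lower upper
    rcases lt_trichotomy u.2 0 with h2 | h2 | h2
    · left
      refine lower (- c / -u.2 ) (u.1 / -u.2) ?_ fun z hz hzlt => ?_
      · rw [div_mul_eq_mul_div, ← add_div, lt_div_iff₀ (by linarith)]; linarith
      · rw [div_mul_eq_mul_div, ← add_div, lt_div_iff₀ (by linarith)] at hzlt; linarith
    · rcases lt_trichotomy u.1 0 with h1 | h1 | h1
      · -- cap to the left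
        left
        rw [h2] at hlt
        set v := c / u.1 with hv
        have hxv : x < v := by rw [hv, lt_div_iff_of_neg h1]; linarith
        set M := (2 * H + 1) / (v - x) with hM
        have hM0 : 0 < M := div_pos (by linarith) (by linarith)
        have hMv : M * (v - x) = 2 * H + 1 := by rw [hM]; field_simp; rw [div_self (by linarith)]
        refine lower (- H + M * v) (- M) (by linarith) fun z hz hzlt => ?_
        rw [h2, zero_mul, add_zero]
        have hzv : z 0 < v := by
          by_contra hc; push Not at hc
          have := hb z hz
          nlinarith
        rw [hv, lt_div_iff_of_neg h1] at hzv
        linarith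
      · exfalso
        rw [h1, h2] at hlt
        have : {y ∈ S | c < lc u y} = S := by
          ext z; simp only [lc, h1, h2, mem_ofPred_eq]
          constructor
          · exact fun h => h.1
          · intro h; exact ⟨h, by linarith⟩
        rw [this] at hvol
        exact absurd hvol (not_le.2 hδ)
      · left
        rw [h2] at hlt
        set v := c / u.1 with hv
        have hxv : v < x := by rw [hv, div_lt_iff₀ h1]; linarith
        set M := (2 * H + 1) / (x - v) with hM
        have hM0 : 0 < M := div_pos (by linarith) (by linarith)
        have hMv : M * (x - v) = 2 * H + 1 := by rw [hM]; field_simp; rw [div_self (by linarith)]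
        refine lower (- H - M * v) M (by linarith) fun z hz hzlt => ?_
        rw [h2, zero_mul, add_zero]
        have hzv : v < z 0 := by
          by_contra hc; push Not at hc
          have := hb z hz
          nlinarith
        rw [hv, div_lt_iff₀ h1] at hzv
        linarith
    · right
      refine upper (- c / u.2) (u.1 / u.2) ?_ fun z hz hzlt => ?_
      · rw [div_mul_eq_mul_div, ← add_div, lt_div_iff₀ h2]; linarith
      · rw [div_mul_eq_mul_div, ← add_div, lt_div_iff₀ h2] at hzlt; linarith
  · rintro (⟨y1, y2, c, s, hlt, hcap⟩ | ⟨y1, y2, c, s, hlt, hcap⟩)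
    · refine ⟨(h.2 _ _).2 ⟨hx', y1, y2⟩, fun hF => ?_⟩
      have := hF.2 (lcL (s, -1)) (-c) (by
        rw [← capm_eq h hSm] at hcap
        refine (measure_mono fun z hz => (?_ : z ∈ {z ∈ S | z 1 < c + s * z 0})).trans hcap
        have := hz.2; simp only [lcL_apply, lc] at this; exact ⟨hz.1, by linarith⟩)
      simp [lc] at this
      linarith
    · refine ⟨(h.2 _ _).2 ⟨hx', neg_le_neg_iff.1 y2, neg_le_neg_iff.1 y1⟩, fun hF => ?_⟩
      have := hF.2 (lcL (s, 1)) (-c) (by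
        rw [← capm_eq' h hSm] at hcap
        refine (measure_mono fun z hz => (?_ : z ∈ {z ∈ S | - z 1 < c + s * z 0})).trans hcap
        have := hz.2; simp only [lcL_apply, lc] at this; exact ⟨hz.1, by linarith⟩)
      simp [lc] at this
      linarith

/-- the integral of the local limits -/
def kint (a b : ℝ) (f g : ℝ → ℝ) : ENNReal := ∫⁻ x in Ioo a b, ENNReal.ofReal (kap f x + kap (fun x => - g x) x)

lemma body_vol_pos (h : IsBody S a b H f g) (hS : MeasurableSet S) : 0 < volume S := by
  rw [vol_slices_Ioo h hS le_rfl]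
  rw [setLIntegral_pos_iff (meas_slices hS)]
  have : (Function.support fun x => volume {y | mkE x y ∈ S}) ∩ Ioo a b = Ioo a b := by
    rw [inter_eq_right]
    intro x hx
    rw [Function.mem_support]
    have : {y | mkE x y ∈ S} = Icc (f x) (g x) := by
      ext y; simp only [mem_ofPred_eq, h.2, mem_Icc]
      exact and_iff_right (Ioo_subset_Icc_self hx)
    rw [this, Real.volume_Icc]
    simp; exact h.1.lt x hx
  rw [this, Real.volume_Ioo]; simpa using h.1.hab

lemma wet_lim (h : IsBody S a b H f g) (hS : IsCompact S) :
    kint a b f g ≤ 2 * ENNReal.ofReal (b - a) + 16 * (2 * ENNReal.ofReal (16 * (2 * H + 1) + 16 * H)) ∧ Tendsto (fun τ : ℝ => (ENNReal.ofReal (τ ^ 2))⁻¹ * volume (S \ floatingBody S (τ ^ 3))) (nhdsWithin 0 (Ioi 0)) (nhds (kint a b f g)) := by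
  have hSm := hS.isClosed.measurableSet
  have hpos := body_vol_pos h hSm
  set F : ℝ → ℝ → ENNReal := fun τ x => (ENNReal.ofReal (τ ^ 2))⁻¹ * volume {y | mkE x y ∈ S \ floatingBody S (τ ^ 3)} with hF
  have hTm : ∀ δ, MeasurableSet (S \ floatingBody S δ) := fun δ => hSm.diff (meas_floating hS.isClosed δ)
  have hFm : ∀ τ, Measurable (F τ) := fun τ => (meas_slices (hTm _)).const_mul _
  have hIntr : ∀ τ, (ENNReal.ofReal (τ ^ 2))⁻¹ * volume (S \ floatingBody S (τ ^ 3)) = ∫⁻ x in Ioo a b, F τ x := by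
    intro τ
    rw [vol_slices_Ioo h (hTm _) sdiff_subset, lintegral_const_mul _ (meas_slices (hTm _))]
  simp only [hIntr]
  have hev : ∀ᶠ τ : ℝ in nhdsWithin 0 (Ioi 0), 0 < τ ∧ ∀ x ∈ Ioo a b, F τ x = (ENNReal.ofReal (τ ^ 2))⁻¹ * wid a b f g (τ ^ 3) x := by
    have h1 : ∀ᶠ τ : ℝ in nhdsWithin 0 (Ioi 0), ENNReal.ofReal (τ ^ 3) < volume S := by
      refine (Tendsto.eventually_lt_const (v := ENNReal.ofReal (0 ^ 3)) (by simpa using hpos) ?_)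
      exact tendsto_nhdsWithin_of_tendsto_nhds ((ENNReal.continuous_ofReal.comp (by fun_prop)).tendsto 0)
    filter_upwards [h1, self_mem_nhdsWithin] with τ h1 h0
    refine ⟨h0, fun x hx => ?_⟩
    simp only [hF, wid, wet_slice h hS.isClosed h1 hx]
  have main : ∀ u : ℕ → ℝ, Tendsto u atTop (nhdsWithin 0 (Ioi 0)) → kint a b f g ≤ 2 * ENNReal.ofReal (b - a) + 16 * (2 * ENNReal.ofReal (16 * (2 * H + 1) + 16 * H)) ∧ Tendsto (fun n => ∫⁻ x in Ioo a b, F (u n) x) atTop (nhds (kint a b f g)) := by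
    intro u hu
    have hfin : IsFiniteMeasure (volume.restrict (Ioo a b)) := ⟨by simp⟩
    rw [show ENNReal.ofReal (b - a) = (volume.restrict (Ioo a b)) univ by simp]
    refine conv (C := 2 * ENNReal.ofReal (16 * (2 * H + 1) + 16 * H)) (fun n => hFm (u n)) ?_ ?_ ?_ ?_
    · filter_upwards [hu.eventually hev] with n hn x
      refine ENNReal.mul_ne_top (by simp; exact hn.1.ne') (ne_top_of_le_ne_top (b := ENNReal.ofReal (H - -H)) (by simp) ?_)
      rw [← Real.volume_Icc]
      refine measure_mono fun y hy => ?_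
      have := (h.2 _ _).1 hy.1
      exact ⟨by linarith [(abs_le.1 (h.1.bf _ this.1)).1], by linarith [(abs_le.1 (h.1.bg _ this.1)).2]⟩
    · exact ENNReal.mul_ne_top (by simp) (by simp)
    · filter_upwards [hu.eventually hev] with n hn k
      rw [Measure.restrict_apply' measurableSet_Ioo]
      refine le_trans (measure_mono ?_) (wid_weak h.1 hn.1 k)
      rintro x ⟨hx1, hx2⟩
      refine ⟨hx2, ?_⟩
      rw [← hn.2 x hx2]; exact hx1
    · rw [ae_restrict_iff' measurableSet_Ioo]
      filter_upwards [rd_good h.1.cf, rd_good h.1.neg.cf] with x h1 h2 hx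
      obtain ⟨A, hA0, hA⟩ := h1 hx
      obtain ⟨B, hB0, hB⟩ := h2 hx
      refine ((wid_lim h.1 hx hA0 hA hB0 hB).comp hu).congr' ?_
      filter_upwards [hu.eventually hev] with n hn
      rw [hn.2 x hx]; rfl
  refine ⟨(main (fun n => 1 / ((n:ℝ) + 1)) ?_).1, tendsto_of_seq_tendsto fun u hu => (main u hu).2⟩
  refine tendsto_nhdsWithin_iff.2 ⟨tendsto_one_div_add_atTop_nhds_zero_nat, Eventually.of_forall fun n => ?_⟩
  simp only [mem_Ioi]; positivity

lemma part_e (h : IsBody S a b H f g) (hS : IsCompact S) :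
    kint a b f g ≠ ⊤ ∧ Tendsto (fun δ : ℝ => ((volume S).toReal - (volume (floatingBody S δ)).toReal) / δ ^ ((2:ℝ)/3))
      (nhdsWithin 0 (Ioi 0)) (nhds (kint a b f g).toReal) ∧
    affinePerimeter S = (4 * Real.sqrt 2 / 3) ^ ((2:ℝ)/3) * (kint a b f g).toReal := by
  obtain ⟨h1, h2⟩ := wet_lim h hS
  replace h1 : kint a b f g ≠ ⊤ := (h1.trans_lt (ENNReal.add_lt_top.2 ⟨ENNReal.mul_lt_top (by simp) (by simp), ENNReal.mul_lt_top (by simp) (ENNReal.mul_lt_top (by simp) (by simp))⟩)).ne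
  have hlim : Tendsto (fun δ : ℝ => ((volume S).toReal - (volume (floatingBody S δ)).toReal) / δ ^ ((2:ℝ)/3))
      (nhdsWithin 0 (Ioi 0)) (nhds (kint a b f g).toReal) := by
    have h3 := (ENNReal.tendsto_toReal h1).comp h2
    have h4 : Tendsto (fun δ : ℝ => δ ^ ((1:ℝ)/3)) (nhdsWithin 0 (Ioi 0)) (nhdsWithin 0 (Ioi 0)) := by
      refine tendsto_nhdsWithin_iff.2 ⟨?_, ?_⟩
      · have := (Real.continuousAt_rpow_const (0:ℝ) ((1:ℝ)/3) (Or.inr (by norm_num))).tendsto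
        rw [Real.zero_rpow (by norm_num)] at this
        exact tendsto_nhdsWithin_of_tendsto_nhds this
      · filter_upwards [self_mem_nhdsWithin] with δ hδ using Real.rpow_pos_of_pos hδ _
    refine (h3.comp h4).congr' ?_
    filter_upwards [self_mem_nhdsWithin] with δ hδ
    have hδ : 0 < δ := hδ
    have e3 : (δ ^ ((1:ℝ)/3)) ^ 3 = δ := by
      rw [← Real.rpow_natCast, ← Real.rpow_mul hδ.le]; norm_num
    have e2 : (δ ^ ((1:ℝ)/3)) ^ 2 = δ ^ ((2:ℝ)/3) := by
      rw [← Real.rpow_natCast, ← Real.rpow_mul hδ.le]; norm_num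
    have hsub : floatingBody S δ ⊆ S := fun x hx => hx.1
    have hfin : volume (floatingBody S δ) ≠ ⊤ := ne_top_of_le_ne_top hS.measure_lt_top.ne (measure_mono hsub)
    simp only [Function.comp_apply, e3, e2]
    rw [measure_sdiff hsub (meas_floating hS.isClosed δ).nullMeasurableSet hfin, ENNReal.toReal_mul, ENNReal.toReal_inv,
      ENNReal.toReal_ofReal (by positivity), ENNReal.toReal_sub_of_le (measure_mono hsub) hS.measure_lt_top.ne]
    rw [inv_mul_eq_div]
  refine ⟨h1, hlim, ?_⟩
  unfold affinePerimeter
  rw [hlim.limUnder_eq]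

end four
end

noncomputable section

section five
variable {a b H : ℝ} {f g : ℝ → ℝ}

/-- the two offsets of a cell -/
def cA (f : ℝ → ℝ) (u v : ℝ) : ℝ := f v - f u - rd f u * (v - u)
def cB (f : ℝ → ℝ) (u v : ℝ) : ℝ := f u - f v + rd f v * (v - u)
/-- area of the cell triangle -/
def cT (f : ℝ → ℝ) (u v : ℝ) : ℝ := cA f u v * cB f u v / (2 * (rd f v - rd f u))

lemma cell_low (hf : ConvexOn ℝ (Icc a b) f) {x A A' : ℝ} (hx : x ∈ Ioo a b) (hA : HasDerivAt (rd f) A x) (hA' : 0 ≤ A') (hAA : A' < A) :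
    ∃ η > 0, ∀ u v, u ≤ x → x ≤ v → u < v → x - η ≤ u → v ≤ x + η → A' * (v - u) ^ 3 ≤ 8 * cT f u v := by
  set ε := (A - A') / 9 with hεd
  have hε : 0 < ε := by rw [hεd]; linarith
  have hεA : A' = A - 9 * ε := by rw [hεd]; ring
  clear_value ε
  obtain ⟨η, hη, -, h1, h2⟩ := taylor2 hf hx hA hε
  refine ⟨η, hη, fun u v hu hv huv hu' hv' => ?_⟩
  have mu : u ∈ Icc (x - η) (x + η) := ⟨hu', by linarith⟩
  have mv : v ∈ Icc (x - η) (x + η) := ⟨by linarith, hv'⟩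
  have u1 := abs_le.1 (h1 u mu)
  have v1 := abs_le.1 (h1 v mv)
  have u2 := abs_le.1 (h2 u mu)
  have v2 := abs_le.1 (h2 v mv)
  rw [abs_of_nonpos (by linarith : u - x ≤ 0)] at u1
  rw [abs_of_nonneg (by linarith : 0 ≤ v - x)] at v1
  obtain ⟨p, hp⟩ : ∃ p, p = x - u := ⟨_, rfl⟩
  obtain ⟨q, hq⟩ : ∃ q, q = v - x := ⟨_, rfl⟩
  have hp0 : 0 ≤ p := by linarith
  have hq0 : 0 ≤ q := by linarith
  have hpq : 0 < p + q := by linarith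
  have eu : u - x = -p := by linarith
  have ev : v - x = q := by linarith
  have eh : v - u = p + q := by linarith
  rw [eu] at u1 u2
  rw [ev] at v1 v2
  unfold cT cA cB
  rw [eh]
  have hd1 : 0 < rd f v - rd f u := by
    have : 0 < (A - ε) * (p + q) := mul_pos (by linarith) hpq
    nlinarith
  have hd2 : rd f v - rd f u ≤ (A + ε) * (p + q) := by nlinarith
  have hppq : 0 ≤ p * q := mul_nonneg hp0 hq0
  have ha : (A - 4 * ε) / 2 * (p + q) ^ 2 ≤ f v - f u - rd f u * (p + q) := by
    have : rd f u * (p + q) ≤ (rd f x - A * p + ε * p) * (p + q) := mul_le_mul_of_nonneg_right (by linarith) hpq.le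
    nlinarith
  have hb : (A - 4 * ε) / 2 * (p + q) ^ 2 ≤ f u - f v + rd f v * (p + q) := by
    have : (rd f x + A * q - ε * q) * (p + q) ≤ rd f v * (p + q) := mul_le_mul_of_nonneg_right (by linarith) hpq.le
    nlinarith
  have h0 : 0 ≤ (A - 4 * ε) / 2 * (p + q) ^ 2 := mul_nonneg (by linarith) (by positivity)
  have hab' := mul_le_mul ha hb h0 (h0.trans ha)
  rw [← mul_div_assoc, le_div_iff₀ (by linarith)]
  have h3 : A' * (p + q) ^ 3 * (2 * (rd f v - rd f u)) ≤ A' * (p + q) ^ 3 * (2 * ((A + ε) * (p + q))) := by gcongr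
  have h4 : A' * (A + ε) ≤ (A - 4 * ε) ^ 2 := by rw [hεA]; nlinarith only [sq_nonneg ε]
  have h5 := mul_le_mul_of_nonneg_right h4 (show 0 ≤ 2 * (p + q) ^ 4 by positivity)
  linarith only [h3, h5, hab']

lemma cA_nonneg (hf : ConvexOn ℝ (Icc a b) f) {u v : ℝ} (hu : u ∈ Ioo a b) (hv : v ∈ Ioo a b) : 0 ≤ cA f u v := by
  have := tangent_le hf hu (Ioo_subset_Icc_self hv)
  unfold cA; linarith

lemma cB_nonneg (hf : ConvexOn ℝ (Icc a b) f) {u v : ℝ} (hu : u ∈ Ioo a b) (hv : v ∈ Ioo a b) : 0 ≤ cB f u v := by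
  have := tangent_le hf hv (Ioo_subset_Icc_self hu)
  unfold cB; linarith

lemma cT_nonneg (hf : ConvexOn ℝ (Icc a b) f) {u v : ℝ} (hu : u ∈ Ioo a b) (hv : v ∈ Ioo a b) (huv : u ≤ v) : 0 ≤ cT f u v := by
  have := rd_mono hf hu hv huv
  exact div_nonneg (mul_nonneg (cA_nonneg hf hu hv) (cB_nonneg hf hu hv)) (by linarith)

/-- points of a lower cell -/
def cQ (f : ℝ → ℝ) (e u v X Y : ℝ) : Prop :=
  X ∈ Icc u v ∧ f u + e + rd f u * (X - u) ≤ Y ∧ f v + e + rd f v * (X - v) ≤ Y ∧ Y ≤ f X + e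

/-- points that lie on the correct side of a cell -/
def cD (f : ℝ → ℝ) (e u v X Y : ℝ) : Prop :=
  (v ≤ X ∧ f v + e + rd f v * (X - v) ≤ Y) ∨ (X ≤ u ∧ f u + e + rd f u * (X - u) ≤ Y) ∨
    (u ≤ X ∧ X ≤ v ∧ (v - X) * (f u + e) + (X - u) * (f v + e) ≤ (v - u) * Y)

lemma cD_compat {e u v X Y α β : ℝ} (huv : u < v) (hφ : rd f u ≤ rd f v) (hα : 0 ≤ α) (hβ : 0 ≤ β) (h : cD f e u v X Y) :
    α * (rd f u * X - Y) + β * (rd f v * X - Y) ≤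
      max (α * (rd f u * u - (f u + e)) + β * (rd f v * u - (f u + e))) (α * (rd f u * v - (f v + e)) + β * (rd f v * v - (f v + e))) := by
  rcases h with ⟨h1, h2⟩ | ⟨h1, h2⟩ | ⟨h1, h2, h3⟩
  · refine le_trans ?_ (le_max_right _ _)
    have e1 := mul_nonneg (mul_nonneg hα (sub_nonneg.2 hφ)) (sub_nonneg.2 h1)
    have e2 := mul_le_mul_of_nonneg_left h2 (add_nonneg hα hβ)
    nlinarith
  · refine le_trans ?_ (le_max_left _ _)
    have e1 := mul_nonneg (mul_nonneg hβ (sub_nonneg.2 hφ)) (sub_nonneg.2 h1)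
    have e2 := mul_le_mul_of_nonneg_left h2 (add_nonneg hα hβ)
    nlinarith
  · set M := max (α * (rd f u * u - (f u + e)) + β * (rd f v * u - (f u + e))) (α * (rd f u * v - (f v + e)) + β * (rd f v * v - (f v + e))) with hM
    have m1 := mul_le_mul_of_nonneg_left (le_max_left (α * (rd f u * u - (f u + e)) + β * (rd f v * u - (f u + e))) (α * (rd f u * v - (f v + e)) + β * (rd f v * v - (f v + e)))) (sub_nonneg.2 h2)
    have m2 := mul_le_mul_of_nonneg_left (le_max_right (α * (rd f u * u - (f u + e)) + β * (rd f v * u - (f u + e))) (α * (rd f u * v - (f v + e)) + β * (rd f v * v - (f v + e)))) (sub_nonneg.2 h1)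
    rw [← hM] at m1 m2
    have e2 := mul_le_mul_of_nonneg_left h3 (add_nonneg hα hβ)
    have : (v - u) * (α * (rd f u * X - Y) + β * (rd f v * X - Y)) ≤ (v - u) * M := by nlinarith
    exact le_of_mul_le_mul_left this (by linarith)

lemma cD_of_cQ (hf : ConvexOn ℝ (Icc a b) f) {e u v u' v' X Y : ℝ} (hu : u ∈ Ioo a b) (hv : v ∈ Ioo a b) (hu' : u' ∈ Ioo a b) (hv' : v' ∈ Ioo a b)
    (hd : v ≤ u' ∨ v' ≤ u) (h : cQ f e u' v' X Y) : cD f e u v X Y := by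
  obtain ⟨h1, h2, h3, -⟩ := h
  rcases hd with hd | hd
  · left
    have t := tangent_le hf hv (Ioo_subset_Icc_self hu')
    have m := mul_le_mul_of_nonneg_right (rd_mono hf hv hu' hd) (sub_nonneg.2 h1.1)
    exact ⟨hd.trans h1.1, by nlinarith⟩
  · right; left
    have t := tangent_le hf hu (Ioo_subset_Icc_self hv')
    have m := mul_le_mul_of_nonneg_right (rd_mono hf hv' hu hd) (sub_nonneg.2 h1.2)
    exact ⟨h1.2.trans hd, by nlinarith⟩

lemma cD_of_opp (h : Body a b H f g) {e u v X Y : ℝ} (hu : u ∈ Ioo a b) (hv : v ∈ Ioo a b) (hX : X ∈ Ioo a b) (huv : u < v)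
    (eu : 2 * e ≤ g u - f u) (ev : 2 * e ≤ g v - f v) (eX : 2 * e ≤ g X - f X) (hY : g X - e ≤ Y) : cD f e u v X Y := by
  rcases le_or_gt X u with h1 | h1
  · right; left
    have t := tangent_le h.cf hu (Ioo_subset_Icc_self hX)
    exact ⟨h1, by linarith⟩
  rcases le_or_gt v X with h2 | h2
  · left
    have t := tangent_le h.cf hv (Ioo_subset_Icc_self hX)
    exact ⟨h2, by linarith⟩
  right; right
  refine ⟨h1.le, h2.le, ?_⟩
  have hvu : 0 < v - u := by linarith
  have c := h.cg.2 (Ioo_subset_Icc_self hu) (Ioo_subset_Icc_self hv) (show 0 ≤ (v - X) / (v - u) from div_nonneg (by linarith) hvu.le)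
    (show 0 ≤ (X - u) / (v - u) from div_nonneg (by linarith) hvu.le) (by field_simp; ring)
  simp only [smul_eq_mul] at c
  rw [show (v - X) / (v - u) * u + (X - u) / (v - u) * v = X by field_simp; ring] at c
  have c' : (v - X) * g u + (X - u) * g v ≤ (v - u) * g X := by
    have := mul_le_mul_of_nonneg_left c hvu.le
    rw [show (v - u) * ((v - X) / (v - u) * g u + (X - u) / (v - u) * g v) = (v - X) * g u + (X - u) * g v by field_simp] at this
    exact this
  have n1 := mul_le_mul_of_nonneg_left eu (by linarith : 0 ≤ v - X)
  have n2 := mul_le_mul_of_nonneg_left ev (by linarith : 0 ≤ X - u)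
  have n3 := mul_le_mul_of_nonneg_left hY hvu.le
  nlinarith

/-- a cell point is not below the graph -/
lemma cQ_mem (hf : ConvexOn ℝ (Icc a b) f) {e u v X Y : ℝ} (hu : u ∈ Ioo a b) (hv : v ∈ Ioo a b)
    (he : (rd f v - rd f u) * (v - u) ≤ e) (h : cQ f e u v X Y) : f X ≤ Y := by
  obtain ⟨h1, h2, h3, -⟩ := h
  have hX : X ∈ Ioo a b := ⟨hu.1.trans_le h1.1, h1.2.trans_lt hv.2⟩
  have t := tangent_le hf hX (Ioo_subset_Icc_self hu)
  have m := mul_le_mul_of_nonneg_right (rd_mono hf hX hv h1.2) (sub_nonneg.2 h1.1)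
  have m2 := mul_le_mul_of_nonneg_left h1.2 (sub_nonneg.2 (rd_mono hf hu hv (h1.1.trans h1.2)))
  nlinarith

/-- the triangles of cells -/
def sgn (s : Bool) : ℝ := if s then 1 else -1

def cellTri : Bool → (ℝ → ℝ) → ℝ → ℝ → ℝ → Tri
  | true, f, e, u, v => mkTri (rd f u, -1) (rd f v, -1) (mkE u (f u + e)) (mkE v (f v + e))
  | false, f, e, u, v => mkTri (rd f v, 1) (rd f u, 1) (mkE v (-(f v + e))) (mkE u (-(f u + e)))

lemma cellTri_spec (hf : ConvexOn ℝ (Icc a b) f) {e u v : ℝ} (hu : u ∈ Ioo a b) (hv : v ∈ Ioo a b)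
    (h1 : 0 < cA f u v) (h2 : 0 < cB f u v) (h3 : 0 < rd f v - rd f u) (huv : u < v) (s : Bool) :
    (cellTri s f e u v).Ok ∧ (cellTri s f e u v).T = cT f u v ∧
    (∀ r, (r = (cellTri s f e u v).p ∨ r = (cellTri s f e u v).q ∨ r = (cellTri s f e u v).c) → cQ f e u v (r 0) (sgn s * r 1)) ∧
    ∀ α β, 0 ≤ α → 0 ≤ β → ∀ r : E 2, cD f e u v (r 0) (sgn s * r 1) →
      lc ((cellTri s f e u v).w α β) r ≤ max (lc ((cellTri s f e u v).w α β) (cellTri s f e u v).p) (lc ((cellTri s f e u v).w α β) (cellTri s f e u v).q) := by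
  have key : ∀ X Y : ℝ, rd f u * X - Y = rd f u * u - (f u + e) → rd f v * X - Y = rd f v * v - (f v + e) → cQ f e u v X Y := by
    intro X Y e1 e2
    have x1 : (rd f v - rd f u) * (X - u) = cB f u v := by unfold cB; linarith
    have x2 : (rd f v - rd f u) * (v - X) = cA f u v := by unfold cA; linarith
    have y1 : 0 < X - u := pos_of_mul_pos_right (x1 ▸ h2) h3.le
    have y2 : 0 < v - X := pos_of_mul_pos_right (x2 ▸ h1) h3.le
    have t := tangent_le hf hu (y := X) ⟨by linarith [hu.1], by linarith [hv.2]⟩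
    exact ⟨⟨by linarith, by linarith⟩, by linarith, by linarith, by linarith⟩
  have keyu : cQ f e u v u (f u + e) := ⟨⟨le_rfl, huv.le⟩, by simp, by unfold cB at h2; linarith, le_rfl⟩
  have keyv : cQ f e u v v (f v + e) := ⟨⟨huv.le, le_rfl⟩, by unfold cA at h1; linarith, by simp, le_rfl⟩
  cases s
  · have hd : 0 < dt (rd f v, (1:ℝ)) (rd f u, 1) := by simp [dt]; linarith
    obtain ⟨c1, c2⟩ := mkTri_c hd.ne' (mkE v (-(f v + e))) (mkE u (-(f u + e)))
    have ea : (cellTri false f e u v).a = cB f u v := by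
      simp [Tri.a, cellTri, mkTri, lc, cB]; ring
    have eb : (cellTri false f e u v).b = cA f u v := by
      simp [Tri.b, cellTri, mkTri, lc, cA]; ring
    have ed : dt (cellTri false f e u v).uL (cellTri false f e u v).uR = rd f v - rd f u := by
      simp [dt, cellTri, mkTri]
    refine ⟨⟨c1, c2, ea ▸ h2, eb ▸ h1, hd⟩, ?_, ?_, ?_⟩
    · unfold Tri.T cT; rw [ea, eb, ed]; ring
    · rintro r (rfl | rfl | rfl)
      · convert keyv using 1 <;> simp [sgn, cellTri, mkTri]
      · convert keyu using 1 <;> simp [sgn, cellTri, mkTri]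
      · change lc (rd f v, (1:ℝ)) (cellTri false f e u v).c = _ at c1
        change lc (rd f u, (1:ℝ)) (cellTri false f e u v).c = _ at c2
        generalize (cellTri false f e u v).c = r at c1 c2
        simp only [lc, mkE_zero, mkE_one] at c1 c2
        apply key <;> simp [sgn] <;> linarith
    · intro α β hα hβ r hr
      have := cD_compat huv (by linarith) hβ hα hr
      rw [max_comm]
      simp only [Tri.lc_w]
      refine le_of_eq_of_le ?_ (this.trans (le_of_eq ?_))
      · simp [sgn, cellTri, mkTri, lc]; ring
      · simp [cellTri, mkTri, lc]; congr 1 <;> ring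
  · have hd : 0 < dt (rd f u, (-1:ℝ)) (rd f v, -1) := by simp [dt]; linarith
    obtain ⟨c1, c2⟩ := mkTri_c hd.ne' (mkE u (f u + e)) (mkE v (f v + e))
    have ea : (cellTri true f e u v).a = cA f u v := by
      simp [Tri.a, cellTri, mkTri, lc, cA]; ring
    have eb : (cellTri true f e u v).b = cB f u v := by
      simp [Tri.b, cellTri, mkTri, lc, cB]; ring
    have ed : dt (cellTri true f e u v).uL (cellTri true f e u v).uR = rd f v - rd f u := by
      simp [dt, cellTri, mkTri]; ring
    refine ⟨⟨c1, c2, ea ▸ h1, eb ▸ h2, hd⟩, ?_, ?_, ?_⟩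
    · unfold Tri.T cT; rw [ea, eb, ed]
    · rintro r (rfl | rfl | rfl)
      · convert keyu using 1 <;> simp [sgn, cellTri, mkTri]
      · convert keyv using 1 <;> simp [sgn, cellTri, mkTri]
      · change lc (rd f u, (-1:ℝ)) (cellTri true f e u v).c = _ at c1
        change lc (rd f v, (-1:ℝ)) (cellTri true f e u v).c = _ at c2
        generalize (cellTri true f e u v).c = r at c1 c2
        simp only [lc, mkE_zero, mkE_one] at c1 c2
        apply key <;> simp [sgn] <;> linarith
    · intro α β hα hβ r hr
      have := cD_compat huv (by linarith) hα hβ hr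
      simp only [Tri.lc_w]
      refine le_of_eq_of_le ?_ (this.trans (le_of_eq ?_))
      · simp [sgn, cellTri, mkTri, lc]; ring
      · simp [cellTri, mkTri, lc]; congr 1 <;> ring

end five
end

noncomputable section

section six
variable {a b H a' b' : ℝ} {f g : ℝ → ℝ} {S K : Set (E 2)}

/-- uniform grid -/
def gr (a' b' : ℝ) (N i : ℕ) : ℝ := a' + i * ((b' - a') / N)

lemma gr_mem (hab : a' ≤ b') {N i : ℕ} (hi : i ≤ N) : gr a' b' N i ∈ Icc a' b' := by
  unfold gr
  have h0 : 0 ≤ (b' - a') / N := div_nonneg (by linarith) (by positivity)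
  refine ⟨by have := mul_nonneg (Nat.cast_nonneg (α := ℝ) i) h0; linarith, ?_⟩
  rcases Nat.eq_zero_or_pos N with rfl | hN
  · simpa using hab
  · have hN' : (0:ℝ) < N := by exact_mod_cast hN
    have : (i:ℝ) * ((b' - a') / N) ≤ N * ((b' - a') / N) := by gcongr
    rw [mul_div_cancel₀ _ hN'.ne'] at this
    linarith

lemma gr_succ (N i : ℕ) : gr a' b' N (i + 1) = gr a' b' N i + (b' - a') / N := by
  unfold gr; push_cast; ring

lemma gr_mono (hab : a' ≤ b') (N : ℕ) : Monotone (gr a' b' N) := by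
  refine monotone_nat_of_le_succ fun i => ?_
  rw [gr_succ]
  have : 0 ≤ (b' - a') / N := div_nonneg (by linarith) (by positivity)
  linarith

/-- the lower and upper boundary functions -/
def fb (f g : ℝ → ℝ) (s : Bool) : ℝ → ℝ := if s then f else fun x => - g x

/-- grid sum -/
def gsum (f : ℝ → ℝ) (a' b' : ℝ) (N : ℕ) : ℝ := ∑ i ∈ Finset.range N, 2 * (cT f (gr a' b' N i) (gr a' b' N (i + 1))) ^ ((1:ℝ)/3)

lemma cfg_exists (h : IsBody S a b H f g) (hSK : S ⊆ K) (ha : a < a') (hab : a' < b') (hb : b' < b) :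
    ∀ᶠ N : ℕ in atTop, ∃ (ι : Type) (_ : Fintype ι) (t : ι → Tri), Cfg K t ∧
      ∑ i, 2 * (t i).T ^ ((1:ℝ)/3) = gsum f a' b' N + gsum (fun x => - g x) a' b' N := by
  classical
  have hsub : Icc a' b' ⊆ Ioo a b := fun x hx => ⟨ha.trans_le hx.1, hx.2.trans_lt hb⟩
  obtain ⟨hB, hmem⟩ := h
  have ma : a' ∈ Ioo a b := hsub ⟨le_rfl, hab.le⟩
  have mb : b' ∈ Ioo a b := hsub ⟨hab.le, le_rfl⟩
  set e := min (g a' - f a') (g b' - f b') / 2 with he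
  have he0 : 0 < e := by
    have h1 := hB.lt _ ma
    have h2 := hB.lt _ mb
    have : 0 < min (g a' - f a') (g b' - f b') := lt_min (by linarith) (by linarith)
    linarith
  have hgap : ∀ x ∈ Icc a' b', 2 * e ≤ g x - f x := by
    intro x hx
    have hc := (hB.cg.sub hB.cf).min_le_of_mem_Icc (Ioo_subset_Icc_self ma) (Ioo_subset_Icc_self mb) hx
    simp only [Pi.sub_apply] at hc
    linarith
  set σ := min (a' - a) (b - b') with hσ
  have hσ0 : 0 < σ := lt_min (by linarith) (by linarith)
  have hσs : Icc a' b' ⊆ Icc (a + σ) (b - σ) := fun x hx =>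
    ⟨by linarith [hx.1, min_le_left (a' - a) (b - b')], by linarith [hx.2, min_le_right (a' - a) (b - b')]⟩
  have hcv : ∀ s, ConvexOn ℝ (Icc a b) (fb f g s) := by
    intro s; cases s
    · exact hB.neg.cf
    · exact hB.cf
  have hrd : ∀ s, ∀ x ∈ Icc a' b', |rd (fb f g s) x| ≤ 2 * H / σ := by
    intro s x hx; cases s
    · exact rd_bound hB.neg.cf hB.neg.bf hσ0 (hσs hx)
    · exact rd_bound hB.cf hB.bf hσ0 (hσs hx)
  have hlim : Tendsto (fun N : ℕ => 2 * (2 * H / σ) * ((b' - a') / N)) atTop (nhds (2 * (2 * H / σ) * 0)) :=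
    (tendsto_const_div_atTop_nhds_zero_nat _).const_mul _
  rw [mul_zero] at hlim
  filter_upwards [hlim.eventually (gt_mem_nhds he0), eventually_gt_atTop 0] with N hN hN0
  have hNpos : (0:ℝ) < N := by exact_mod_cast hN0
  have hh : 0 < (b' - a') / N := div_pos (by linarith) hNpos
  set x : ℕ → ℝ := gr a' b' N with hx
  have hxm : ∀ i : Fin N, x i ∈ Icc a' b' ∧ x (i + 1) ∈ Icc a' b' := fun i => ⟨gr_mem hab.le i.2.le, gr_mem hab.le i.2⟩
  have hxs : ∀ i, x (i + 1) = x i + (b' - a') / N := gr_succ N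
  have hxl : ∀ i, x i < x (i + 1) := fun i => by rw [hxs]; linarith
  have hsm : ∀ (s : Bool) (i : Fin N), (rd (fb f g s) (x (i + 1)) - rd (fb f g s) (x i)) * (x (i + 1) - x i) ≤ e := by
    intro s i
    have h1 := abs_le.1 (hrd s _ (hxm i).1)
    have h2 := abs_le.1 (hrd s _ (hxm i).2)
    have h3 : x (i + 1) - x i = (b' - a') / N := by rw [hxs]; ring
    rw [h3]
    refine le_trans ?_ hN.le
    exact mul_le_mul_of_nonneg_right (by linarith) hh.le
  set P : Bool × Fin N → Prop := fun p => 0 < cA (fb f g p.1) (x p.2) (x (p.2 + 1)) ∧ 0 < cB (fb f g p.1) (x p.2) (x (p.2 + 1)) ∧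
    0 < rd (fb f g p.1) (x (p.2 + 1)) - rd (fb f g p.1) (x p.2) with hP
  set t : Bool × Fin N → Tri := fun p => cellTri p.1 (fb f g p.1) e (x p.2) (x (p.2 + 1)) with ht
  have spec : ∀ p : Bool × Fin N, P p → _ := fun p hp =>
    cellTri_spec (e := e) (hcv p.1) (hsub (hxm p.2).1) (hsub (hxm p.2).2) hp.1 hp.2.1 hp.2.2 (hxl _) p.1
  have hpt : ∀ p, P p → ∀ r, (r = (t p).p ∨ r = (t p).q ∨ r = (t p).c) → r ∈ K := by
    intro p hp r hr
    have hq := (spec p hp).2.2.1 r hr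
    have hXm : r 0 ∈ Icc a' b' := ⟨(hxm p.2).1.1.trans hq.1.1, hq.1.2.trans (hxm p.2).2.2⟩
    have hm := cQ_mem (hcv p.1) (hsub (hxm p.2).1) (hsub (hxm p.2).2) (hsm p.1 p.2) hq
    have hg := hgap _ hXm
    have hY := hq.2.2.2
    apply hSK
    rw [← mkE_eta r, hmem]
    refine ⟨Ioo_subset_Icc_self (hsub hXm), ?_⟩
    obtain ⟨s, k⟩ := p
    cases s
    · simp [fb, sgn] at hm hY
      constructor <;> linarith
    · simp [fb, sgn] at hm hY
      constructor <;> linarith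
  refine ⟨{p : Bool × Fin N // P p}, inferInstance, fun p => t p.1, ⟨fun i => ⟨(spec i.1 i.2).1, hpt _ i.2 _ (Or.inl rfl), hpt _ i.2 _ (Or.inr (Or.inl rfl)), hpt _ i.2 _ (Or.inr (Or.inr rfl))⟩, ?_⟩, ?_⟩
  · rintro ⟨i, hi⟩ ⟨j, hj⟩ hij α β hα hβ r hr
    refine (spec j hj).2.2.2 α β hα hβ r ?_
    have hq := (spec i hi).2.2.1 r hr
    have hXm : r 0 ∈ Icc a' b' := ⟨(hxm i.2).1.1.trans hq.1.1, hq.1.2.trans (hxm i.2).2.2⟩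
    have hij' : i ≠ j := fun h => hij (Subtype.ext h)
    obtain ⟨s, k⟩ := i
    obtain ⟨s', l⟩ := j
    by_cases hss : s = s'
    · subst hss
      have hkl : (k:ℕ) ≠ l := fun h => hij' (by rw [Prod.mk.injEq]; exact ⟨rfl, Fin.ext h⟩)
      refine cD_of_cQ (hcv s) (hsub (hxm l).1) (hsub (hxm l).2) (hsub (hxm k).1) (hsub (hxm k).2) ?_ hq
      rcases lt_or_gt_of_ne hkl with h | h
      · exact Or.inr (gr_mono hab.le N h)
      · exact Or.inl (gr_mono hab.le N h)
    · have hY := hq.2.2.2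
      have g1 := hgap _ (hxm l).1
      have g2 := hgap _ (hxm l).2
      have g3 := hgap _ hXm
      cases s <;> cases s' <;> simp at hss
      · simp [fb, sgn] at hY ⊢
        exact cD_of_opp hB (hsub (hxm l).1) (hsub (hxm l).2) (hsub hXm) (hxl _) g1 g2 g3 (by linarith)
      · simp [fb, sgn] at hY ⊢
        exact cD_of_opp hB.neg (hsub (hxm l).1) (hsub (hxm l).2) (hsub hXm) (hxl _) (by linarith) (by linarith) (by linarith) (by linarith)
  · have e1 : ∀ i : {p : Bool × Fin N // P p}, 2 * (t i.1).T ^ ((1:ℝ)/3) = (fun p : Bool × Fin N => 2 * cT (fb f g p.1) (x p.2) (x (p.2 + 1)) ^ ((1:ℝ)/3)) i.1 := by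
      intro i
      rw [(spec i.1 i.2).2.1]
    rw [Finset.sum_congr rfl fun i _ => e1 i]
    rw [← Finset.sum_subtype (F := inferInstance) (Finset.univ.filter P) (by simp) (fun p : Bool × Fin N => 2 * cT (fb f g p.1) (x p.2) (x (p.2 + 1)) ^ ((1:ℝ)/3))]
    rw [Finset.sum_filter_of_ne, Fintype.sum_prod_type, Fintype.sum_bool]
    · simp only [gsum, Finset.sum_range]
      rfl
    · intro p _ hne
      by_contra hc
      apply hne
      have n1 := cA_nonneg (hcv p.1) (hsub (hxm p.2).1) (hsub (hxm p.2).2)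
      have n2 := cB_nonneg (hcv p.1) (hsub (hxm p.2).1) (hsub (hxm p.2).2)
      have n3 := rd_mono (hcv p.1) (hsub (hxm p.2).1) (hsub (hxm p.2).2) (hxl _).le
      have : cT (fb f g p.1) (x p.2) (x (p.2 + 1)) = 0 := by
        unfold cT
        by_contra h0
        apply hc
        simp only [div_eq_zero_iff, mul_eq_zero, not_or] at h0
        exact ⟨lt_of_le_of_ne n1 (Ne.symm h0.1.1), lt_of_le_of_ne n2 (Ne.symm h0.1.2), lt_of_le_of_ne (sub_nonneg.2 n3) (Ne.symm h0.2.2)⟩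
      rw [this, Real.zero_rpow (by norm_num), mul_zero]

end six
end

noncomputable section

section seven
variable {a b H a' b' : ℝ} {f g : ℝ → ℝ} {S K : Set (E 2)}

/-- normalising constant of the affine perimeter -/
def cst : ℝ := (4 * Real.sqrt 2 / 3) ^ ((2:ℝ)/3)

lemma cst_pos : 0 < cst := by unfold cst; positivity

lemma cst_cube : cst ^ 3 = 32 / 9 := by
  unfold cst
  rw [← Real.rpow_natCast (_ ^ _) 3, ← Real.rpow_mul (by positivity)]
  have : ((2:ℝ)/3 * ((3:ℕ):ℝ)) = ((2:ℕ):ℝ) := by norm_num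
  rw [this, Real.rpow_natCast, div_pow, mul_pow, Real.sq_sqrt (by norm_num)]
  norm_num

lemma measurable_kap (f : ℝ → ℝ) : Measurable (kap f) := by
  unfold kap
  exact ((measurable_deriv (rd f)).const_mul _).pow_const _

def stepF (f : ℝ → ℝ) (a' b' : ℝ) (N : ℕ) (x : ℝ) : ENNReal :=
  ∑ i ∈ Finset.range N, (Ico (gr a' b' N i) (gr a' b' N (i + 1))).indicator
    (fun _ => ENNReal.ofReal (2 * (cT f (gr a' b' N i) (gr a' b' N (i + 1))) ^ ((1:ℝ)/3) / ((b' - a') / N))) x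

lemma stepF_meas (N : ℕ) : Measurable (stepF f a' b' N) := by
  unfold stepF
  exact Finset.measurable_fun_sum _ fun i _ => measurable_const.indicator measurableSet_Ico

lemma stepF_int (hf : ConvexOn ℝ (Icc a b) f) (ha : a < a') (hab : a' < b') (hb : b' < b) {N : ℕ} (hN : 0 < N) :
    ∫⁻ x, stepF f a' b' N x = ENNReal.ofReal (gsum f a' b' N) := by
  have hN' : (0:ℝ) < N := by exact_mod_cast hN
  have hh : 0 < (b' - a') / N := div_pos (by linarith) hN'
  have hsub : Icc a' b' ⊆ Ioo a b := fun x hx => ⟨ha.trans_le hx.1, hx.2.trans_lt hb⟩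
  unfold stepF gsum
  rw [lintegral_finsetSum _ fun i _ => measurable_const.indicator measurableSet_Ico, ENNReal.ofReal_sum_of_nonneg]
  · refine Finset.sum_congr rfl fun i hi => ?_
    rw [lintegral_indicator_const measurableSet_Ico, Real.volume_Ico, gr_succ, add_sub_cancel_left, ← ENNReal.ofReal_mul' hh.le,
      div_mul_cancel₀ _ hh.ne']
  · intro i hi
    have hi := Finset.mem_range.1 hi
    have := cT_nonneg hf (hsub (gr_mem hab.le hi.le)) (hsub (gr_mem hab.le hi)) (gr_mono hab.le N (Nat.le_succ i))
    positivity

lemma stepF_ge {N : ℕ} (hN : 0 < N) (hab : a' < b') {x : ℝ} (hx : x ∈ Ico a' b') :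
    ∃ u v, u ≤ x ∧ x < v ∧ v - u = (b' - a') / N ∧ ENNReal.ofReal (2 * (cT f u v) ^ ((1:ℝ)/3) / ((b' - a') / N)) ≤ stepF f a' b' N x := by
  have hN' : (0:ℝ) < N := by exact_mod_cast hN
  have hh : 0 < (b' - a') / N := div_pos (by linarith) hN'
  set y := (x - a') / ((b' - a') / N) with hy
  have hy0 : 0 ≤ y := div_nonneg (by linarith [hx.1]) hh.le
  have hxy : x = a' + y * ((b' - a') / N) := by rw [hy, div_mul_cancel₀ _ hh.ne']; ring
  have hyN : y < N := by
    rw [hy, div_lt_iff₀ hh, mul_div_cancel₀ _ hN'.ne']; linarith [hx.2]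
  set i := ⌊y⌋₊ with hi
  have hi1 : (i:ℝ) ≤ y := Nat.floor_le hy0
  have hi2 : y < i + 1 := Nat.lt_floor_add_one y
  have hiN : i < N := by exact_mod_cast hi1.trans_lt hyN
  have h1 : gr a' b' N i ≤ x := by
    rw [hxy]; unfold gr; gcongr
  have h2 : x < gr a' b' N (i + 1) := by
    rw [hxy]; unfold gr; push_cast; gcongr
  refine ⟨_, _, h1, h2, by rw [gr_succ]; ring, ?_⟩
  unfold stepF
  refine le_trans ?_ (Finset.single_le_sum (fun j _ => bot_le) (Finset.mem_range.2 hiN))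
  rw [indicator_of_mem (show x ∈ Ico _ _ from ⟨h1, h2⟩)]

lemma fatouF (hf : ConvexOn ℝ (Icc a b) f) (ha : a < a') (hab : a' < b') (hb : b' < b) :
    ∫⁻ x in Ico a' b', ENNReal.ofReal (cst * kap f x) ≤ liminf (fun N : ℕ => ENNReal.ofReal (gsum f a' b' N)) atTop := by
  have hsub : Icc a' b' ⊆ Ioo a b := fun x hx => ⟨ha.trans_le hx.1, hx.2.trans_lt hb⟩
  calc ∫⁻ x in Ico a' b', ENNReal.ofReal (cst * kap f x) ≤ ∫⁻ x in Ico a' b', liminf (fun N => stepF f a' b' N x) atTop := by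
        refine lintegral_mono_ae ?_
        rw [ae_restrict_iff' measurableSet_Ico]
        filter_upwards [rd_good hf] with x hx hxm
        have hxI := hsub (Ico_subset_Icc_self hxm)
        obtain ⟨A, hA0, hA⟩ := hx hxI
        obtain ⟨k0, k1⟩ := kap_spec hA0 hA
        refine le_of_forall_lt fun c hc => ?_
        have hc' : c ≠ ⊤ := (hc.trans ENNReal.ofReal_lt_top).ne
        obtain ⟨d, hcd, hd⟩ := exists_between hc
        have hd' : d ≠ ⊤ := (hd.trans ENNReal.ofReal_lt_top).ne
        refine hcd.trans_le (le_liminf_of_le (by isBoundedDefault) ?_)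
        set y := d.toReal with hy
        have hy0 : 0 ≤ y := ENNReal.toReal_nonneg
        have hyd : d = ENNReal.ofReal y := (ENNReal.ofReal_toReal hd').symm
        have hys : y < cst * kap f x := by
          rw [hyd] at hd
          exact (ENNReal.ofReal_lt_ofReal_iff_of_nonneg hy0).1 hd
        have hyA : y ^ 3 < A := by
          have : y ^ 3 < (cst * kap f x) ^ 3 := by gcongr
          rw [mul_pow, cst_cube] at this
          linarith
        obtain ⟨η, hη, hcell⟩ := cell_low hf hxI hA (by positivity) hyA
        have hlim : Tendsto (fun N : ℕ => (b' - a') / N) atTop (nhds 0) := tendsto_const_div_atTop_nhds_zero_nat _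
        filter_upwards [hlim.eventually (gt_mem_nhds hη), eventually_gt_atTop 0] with N hN hN0
        have hN' : (0:ℝ) < N := by exact_mod_cast hN0
        have hh : 0 < (b' - a') / N := div_pos (by linarith) hN'
        obtain ⟨u, v, hu, hv, huv, hst⟩ := stepF_ge (f := f) hN0 hab hxm
        refine le_trans ?_ hst
        rw [hyd]
        apply ENNReal.ofReal_le_ofReal
        have hc := hcell u v hu hv.le (by linarith) (by linarith) (by linarith)
        rw [huv] at hc
        set h := (b' - a') / N
        have hT : 0 ≤ cT f u v := by
          have : 0 ≤ y ^ 3 * h ^ 3 := by positivity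
          linarith
        rw [le_div_iff₀ hh]
        have hcube : (2 * cT f u v ^ ((1:ℝ)/3)) ^ 3 = 8 * cT f u v := by
          rw [mul_pow, ← Real.rpow_natCast (_ ^ _) 3, ← Real.rpow_mul hT]
          norm_num
        refine le_of_pow_le_pow_left₀ (n := 3) (by norm_num) (by positivity) ?_
        rw [hcube, mul_pow]; exact hc
    _ ≤ liminf (fun N => ∫⁻ x in Ico a' b', stepF f a' b' N x) atTop := lintegral_liminf_le fun N => stepF_meas N
    _ ≤ liminf (fun N : ℕ => ENNReal.ofReal (gsum f a' b' N)) atTop := by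
        refine liminf_le_liminf ?_
        filter_upwards [eventually_gt_atTop 0] with N hN
        rw [← stepF_int hf ha hab hb hN]
        exact setLIntegral_le_lintegral _ _

lemma enn_liminf_add (u v : ℕ → ENNReal) : liminf u atTop + liminf v atTop ≤ liminf (fun n => u n + v n) atTop := by
  simp only [liminf_eq_iSup_iInf_of_nat]
  rw [ENNReal.iSup_add_iSup_of_monotone]
  · refine iSup_mono fun n => le_iInf₂ fun i hi => add_le_add (iInf₂_le i hi) (iInf₂_le i hi)
  · exact fun m n hmn => le_iInf₂ fun i hi => iInf₂_le i (hmn.trans hi)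
  · exact fun m n hmn => le_iInf₂ fun i hi => iInf₂_le i (hmn.trans hi)

lemma gsum_nonneg (hf : ConvexOn ℝ (Icc a b) f) (ha : a < a') (hab : a' < b') (hb : b' < b) (N : ℕ) : 0 ≤ gsum f a' b' N := by
  have hsub : Icc a' b' ⊆ Ioo a b := fun x hx => ⟨ha.trans_le hx.1, hx.2.trans_lt hb⟩
  refine Finset.sum_nonneg fun i hi => ?_
  have hi := Finset.mem_range.1 hi
  have := cT_nonneg hf (hsub (gr_mem hab.le hi.le)) (hsub (gr_mem hab.le hi)) (gr_mono hab.le N (Nat.le_succ i))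
  positivity

lemma part_a (h : IsBody S a b H f g) (hS : IsCompact S) (hSK : S ⊆ K) {ε : ℝ} (hε : 0 < ε) :
    ∃ (ι : Type) (_ : Fintype ι) (t : ι → Tri), Cfg K t ∧ affinePerimeter S - ε ≤ ∑ i, 2 * (t i).T ^ ((1:ℝ)/3) := by
  obtain ⟨hfin, -, hAP⟩ := part_e h hS
  have hB := h.1
  have hlt := hB.hab
  set μ : Set ℝ → ENNReal := fun s => ∫⁻ x in s, ENNReal.ofReal (cst * kap f x) + ENNReal.ofReal (cst * kap (fun x => - g x) x) with hμ
  have htot : ENNReal.ofReal (affinePerimeter S) ≤ μ (Ioo a b) := by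
    rw [hAP]
    change ENNReal.ofReal (cst * _) ≤ _
    rw [ENNReal.ofReal_mul cst_pos.le, ENNReal.ofReal_toReal hfin]
    unfold kint
    rw [← lintegral_const_mul']
    · refine lintegral_mono fun x => ?_
      have c0 := cst_pos
      change ENNReal.ofReal cst * _ ≤ _
      rw [← ENNReal.ofReal_mul c0.le, mul_add]
      exact ENNReal.ofReal_add_le
    · simp
  rcases le_or_gt (affinePerimeter S - ε) 0 with h0 | h0
  · refine ⟨Empty, inferInstance, fun i => i.elim, ⟨fun i => i.elim, fun i => i.elim⟩, by simpa using h0⟩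
  set d : ℕ → ℝ := fun n => (b - a) / (n + 3) with hd
  have hd0 : ∀ n, 0 < d n := fun n => div_pos (by linarith) (by positivity)
  have hd1 : ∀ n, d n ≤ (b - a) / 3 := fun n => by
    refine div_le_div_of_nonneg_left (by linarith) (by norm_num) ?_
    have : (0:ℝ) ≤ n := by positivity
    linarith
  have hdanti : Antitone d := fun m n hmn => by
    refine div_le_div_of_nonneg_left (by linarith) (by positivity) ?_
    have : (m:ℝ) ≤ n := by exact_mod_cast hmn
    linarith
  have hdlim : Tendsto d atTop (nhds 0) := by
    have := (tendsto_const_div_atTop_nhds_zero_nat (b - a)).comp (tendsto_add_atTop_nat 3)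
    refine this.congr fun n => ?_
    simp [hd]
  have hU : Ioo a b = ⋃ n, Ico (a + d n) (b - d n) := by
    ext x
    simp only [mem_iUnion]
    constructor
    · intro hx
      have h1 := hdlim.eventually (gt_mem_nhds (show 0 < min (x - a) (b - x) from lt_min (by linarith [hx.1]) (by linarith [hx.2])))
      obtain ⟨n, hn⟩ := h1.exists
      exact ⟨n, by linarith [min_le_left (x - a) (b - x)], by linarith [min_le_right (x - a) (b - x)]⟩
    · rintro ⟨n, hn⟩
      exact ⟨by linarith [hn.1, hd0 n], by linarith [hn.2, hd0 n]⟩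
  have hdir : Directed (· ⊆ ·) fun n => Ico (a + d n) (b - d n) :=
    Monotone.directed_le (f := fun n => Ico (a + d n) (b - d n)) fun m n hmn => Ico_subset_Ico (by linarith [hdanti hmn]) (by linarith [hdanti hmn])
  have hsup : μ (Ioo a b) = ⨆ n, μ (Ico (a + d n) (b - d n)) := by
    simp only [hμ]
    rw [hU, setLIntegral_iUnion_of_directed _ hdir]
  have hlt2 : ENNReal.ofReal (affinePerimeter S - ε) < ⨆ n, μ (Ico (a + d n) (b - d n)) := by
    rw [← hsup]
    refine lt_of_lt_of_le ?_ htot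
    exact (ENNReal.ofReal_lt_ofReal_iff_of_nonneg h0.le).2 (by linarith)
  obtain ⟨n, hn⟩ := lt_iSup_iff.1 hlt2
  have d1 := hd0 n
  have d2 := hd1 n
  have hfl : μ (Ico (a + d n) (b - d n)) ≤ liminf (fun N : ℕ => ENNReal.ofReal (gsum f (a + d n) (b - d n) N) + ENNReal.ofReal (gsum (fun x => - g x) (a + d n) (b - d n) N)) atTop := by
    simp only [hμ]
    rw [lintegral_add_left (((measurable_kap f).const_mul _).ennreal_ofReal)]
    refine (add_le_add (fatouF hB.cf (by linarith) (by linarith) (by linarith)) (fatouF hB.neg.cf (by linarith) (by linarith) (by linarith))).trans ?_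
    exact enn_liminf_add _ _
  have hev := eventually_lt_of_lt_liminf (hn.trans_le hfl)
  obtain ⟨N, hN1, ι, hι, t, hcfg, hsum⟩ := (hev.and (cfg_exists h hSK (a' := a + d n) (b' := b - d n) (by linarith) (by linarith) (by linarith))).exists
  refine ⟨ι, hι, t, hcfg, ?_⟩
  rw [hsum]
  rw [← ENNReal.ofReal_add (gsum_nonneg hB.cf (by linarith) (by linarith) (by linarith) N) (gsum_nonneg hB.neg.cf (by linarith) (by linarith) (by linarith) N)] at hN1
  exact ((ENNReal.ofReal_lt_ofReal_iff_of_nonneg h0.le).1 hN1).le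

end seven
end

noncomputable section

section eight
variable {S K : Set (E 2)}

lemma AP_degenerate (hc : IsCompact S) (hconv : Convex ℝ S) (hIntr : interior S = ∅) :
    Tendsto (fun δ : ℝ => ((volume S).toReal - (volume (floatingBody S δ)).toReal) / δ ^ ((2:ℝ)/3)) (nhdsWithin 0 (Ioi 0)) (nhds 0) := by
  have h0 : volume S = 0 := by
    have := hconv.addHaar_frontier (volume : Measure (E 2))
    rw [frontier, hIntr, sdiff_empty, hc.isClosed.closure_eq] at this
    exact this
  have h1 : ∀ δ, volume (floatingBody S δ) = 0 := fun δ => measure_mono_null (fun x hx => hx.1) h0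
  simp [h0, h1]

lemma AP_lim (hc : IsCompact S) (hconv : Convex ℝ S) :
    ∃ l, Tendsto (fun δ : ℝ => ((volume S).toReal - (volume (floatingBody S δ)).toReal) / δ ^ ((2:ℝ)/3)) (nhdsWithin 0 (Ioi 0)) (nhds l) ∧
      affinePerimeter S = cst * l := by
  have hex : ∃ l, Tendsto (fun δ : ℝ => ((volume S).toReal - (volume (floatingBody S δ)).toReal) / δ ^ ((2:ℝ)/3)) (nhdsWithin 0 (Ioi 0)) (nhds l) := by
    rcases (interior S).eq_empty_or_nonempty with h | h
    · exact ⟨0, AP_degenerate hc hconv h⟩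
    · obtain ⟨a, b, H, f, g, hb⟩ := exists_body hc hconv h
      exact ⟨_, (part_e hb hc).2.1⟩
  obtain ⟨l, hl⟩ := hex
  refine ⟨l, hl, ?_⟩
  unfold affinePerimeter cst
  rw [hl.limUnder_eq]

lemma AP_zero (hc : IsCompact S) (hconv : Convex ℝ S) (hIntr : interior S = ∅) : affinePerimeter S = 0 := by
  unfold affinePerimeter
  rw [(AP_degenerate hc hconv hIntr).limUnder_eq, mul_zero]

lemma AP_bound (hKc : IsCompact K) : ∃ C, 0 ≤ C ∧ ∀ S, S ⊆ K → Convex ℝ S → IsCompact S → affinePerimeter S ≤ C := by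
  obtain ⟨R, hR⟩ := hKc.isBounded.exists_norm_le
  set M : ENNReal := 2 * ENNReal.ofReal (2 * R) + 16 * (2 * ENNReal.ofReal (16 * (2 * R + 1) + 16 * R)) with hM
  have hMt : M ≠ ⊤ := (ENNReal.add_lt_top.2 ⟨ENNReal.mul_lt_top (by simp) ENNReal.ofReal_lt_top, ENNReal.mul_lt_top (by simp) (ENNReal.mul_lt_top (by simp) (by simp))⟩).ne
  refine ⟨cst * M.toReal, mul_nonneg cst_pos.le ENNReal.toReal_nonneg, fun S hSK hconv hc => ?_⟩
  rcases (interior S).eq_empty_or_nonempty with h | h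
  · rw [AP_zero hc hconv h]; exact mul_nonneg cst_pos.le ENNReal.toReal_nonneg
  · obtain ⟨a, b, H, f, g, hb⟩ := exists_body hc hconv h
    have hmem : ∀ x y, mkE x y ∈ S → |x| ≤ R ∧ |y| ≤ R := by
      intro x y hxy
      have h1 := hR _ (hSK hxy)
      have h2 := abs_coord_le (mkE x y) 0
      have h3 := abs_coord_le (mkE x y) 1
      simp only [mkE_zero, mkE_one] at h2 h3
      exact ⟨h2.trans h1, h3.trans h1⟩
    have hf : ∀ x ∈ Icc a b, mkE x (f x) ∈ S := fun x hx => (hb.2 _ _).2 ⟨hx, le_rfl, hb.1.le x hx⟩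
    have hg : ∀ x ∈ Icc a b, mkE x (g x) ∈ S := fun x hx => (hb.2 _ _).2 ⟨hx, hb.1.le x hx, le_rfl⟩
    have hb' : IsBody S a b R f g := ⟨⟨hb.1.hab, hb.1.cf, hb.1.cg, hb.1.le, hb.1.lt, fun x hx => (hmem _ _ (hf x hx)).2, fun x hx => (hmem _ _ (hg x hx)).2⟩, hb.2⟩
    have ha1 := abs_le.1 (hmem _ _ (hf a ⟨le_rfl, hb.1.hab.le⟩)).1
    have hb1 := abs_le.1 (hmem _ _ (hf b ⟨hb.1.hab.le, le_rfl⟩)).1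
    rw [(part_e hb' hc).2.2]
    change cst * _ ≤ _
    refine mul_le_mul_of_nonneg_left (ENNReal.toReal_mono hMt ?_) cst_pos.le
    refine (wet_lim hb' hc).1.trans ?_
    rw [hM]
    gcongr
    linarith

lemma low_zero (hKconv : Convex ℝ K) (hKint : (interior K).Nonempty) (harea : volume K = 1) :
    ∀ ε > 0, ∀ᶠ n : ℕ in atTop, - ε ≤ (n:ℝ)^(-(1:ℝ)/3) * Real.log (EQ K n) := by
  intro ε hε
  obtain ⟨o, ho⟩ := hKint
  obtain ⟨r, hr, hball⟩ := Metric.isOpen_iff.1 isOpen_interior o ho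
  have hm : ∀ u v : ℝ, |u| + |v| < r → mkE (o 0 + u) (o 1 + v) ∈ K := by
    intro u v h
    apply interior_subset; apply hball
    rw [Metric.mem_ball, dist_eq_norm]
    have : mkE (o 0 + u) (o 1 + v) - o = mkE u v := by apply E2_ext <;> simp
    rw [this]
    exact (norm_mkE_le u v).trans_lt h
  set t : Unit → Tri := fun _ => ⟨mkE (o 0 + 0) (o 1 + -(r/2)), mkE (o 0 + -(r/2)) (o 1 + 0), mkE (o 0 + 0) (o 1 + 0), (1, 0), (0, 1)⟩ with ht
  have hcfg : Cfg K t := by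
    refine ⟨fun i => ⟨⟨?_, ?_, ?_, ?_, ?_⟩, ?_, ?_, ?_⟩, fun i j hij => absurd (Subsingleton.elim i j) hij⟩
    · simp [ht, lc]
    · simp [ht, lc]
    · simp [ht, Tri.a, lc]; exact hr
    · simp [ht, Tri.b, lc]; exact hr
    · simp [ht, dt]
    · apply hm; rw [abs_zero, abs_neg, abs_of_pos (by linarith)]; linarith
    · apply hm; rw [abs_zero, abs_neg, abs_of_pos (by linarith)]; linarith
    · apply hm; simpa using hr
  filter_upwards [lower_c hKconv harea hcfg ε hε] with n hn
  refine le_trans ?_ hn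
  have : 0 ≤ ∑ i, (2 * (t i).T) ^ ((1:ℝ)/3) := Finset.sum_nonneg fun i _ => by
    have := ((hcfg.1 i).1).T_pos
    positivity
  linarith

lemma k_eq {T : ℝ} (hT : 0 ≤ T) : 3 * (2 * T) ^ ((1:ℝ)/3) = 3 * (2:ℝ) ^ (-(2:ℝ)/3) * (2 * T ^ ((1:ℝ)/3)) := by
  rw [Real.mul_rpow (by norm_num) hT]
  have : (2:ℝ) ^ ((1:ℝ)/3) = (2:ℝ) ^ (-(2:ℝ)/3) * 2 := by
    conv_rhs => rw [← Real.rpow_one (2:ℝ)]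
    rw [← Real.rpow_mul (by norm_num), ← Real.rpow_add (by norm_num)]
    norm_num
  rw [this]; ring

lemma cst_mul : cst * (3/2 : ℝ) ^ ((2:ℝ)/3) = 2 := by
  have h0 : 0 < cst * (3/2 : ℝ) ^ ((2:ℝ)/3) := mul_pos cst_pos (by positivity)
  have h3 : (cst * (3/2 : ℝ) ^ ((2:ℝ)/3)) ^ 3 = 2 ^ 3 := by
    rw [mul_pow, cst_cube, ← Real.rpow_natCast (_ ^ _) 3, ← Real.rpow_mul (by norm_num)]
    have : ((2:ℝ)/3 * ((3:ℕ):ℝ)) = ((2:ℕ):ℝ) := by norm_num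
    rw [this, Real.rpow_natCast]
    norm_num
  exact (pow_left_inj₀ h0.le (by norm_num) (by norm_num)).1 h3

lemma main_limit (hKc : IsCompact K) (hKconv : Convex ℝ K) (hKint : (interior K).Nonempty) (harea : volume K = 1) :
    Tendsto (fun n : ℕ => (n:ℝ)^(-(1:ℝ)/3) * Real.log (EQ K n)) atTop (nhds (3 * (2:ℝ)^(-(2:ℝ)/3) * maxAffinePerimeter K)) := by
  obtain ⟨C, hC0, hC⟩ := AP_bound hKc
  set k : ℝ := 3 * (2:ℝ)^(-(2:ℝ)/3) with hk
  have hk0 : 0 < k := by positivity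
  set U : Set ℝ := {a | ∃ S : Set (E 2), S ⊆ K ∧ Convex ℝ S ∧ IsCompact S ∧ a = affinePerimeter S} with hU
  have hbdd : BddAbove U := ⟨C, by rintro a ⟨S, h1, h2, h3, rfl⟩; exact hC S h1 h2 h3⟩
  have h0U : (0:ℝ) ∈ U := ⟨∅, empty_subset _, convex_empty, isCompact_empty, (AP_zero isCompact_empty convex_empty interior_empty).symm⟩
  have hmax : maxAffinePerimeter K = sSup U := rfl
  rw [hmax]
  have hA0 : 0 ≤ sSup U := le_csSup hbdd h0U
  have hlow : ∀ ε > 0, ∀ᶠ n : ℕ in atTop, k * sSup U - ε ≤ (n:ℝ)^(-(1:ℝ)/3) * Real.log (EQ K n) := by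
    intro ε hε
    have hε' : 0 < ε / (3 * k) := by positivity
    have hk1 : k * (ε / (3 * k)) = ε / 3 := by field_simp
    obtain ⟨_, ⟨S, h1, h2, h3, rfl⟩, h4⟩ := exists_lt_of_lt_csSup ⟨0, h0U⟩ (sub_lt_self (sSup U) hε')
    have h5 := mul_le_mul_of_nonneg_left h4.le hk0.le
    rw [mul_sub, hk1] at h5
    rcases (interior S).eq_empty_or_nonempty with h | h
    · rw [AP_zero h3 h2 h, mul_zero] at h5
      filter_upwards [low_zero hKconv hKint harea (ε / 3) (by positivity)] with n hn
      linarith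
    · obtain ⟨a, b, H, f, g, hb⟩ := exists_body h3 h2 h
      obtain ⟨ι, hι, t, hcfg, hs⟩ := part_a hb h3 h1 hε'
      have h6 := mul_le_mul_of_nonneg_left hs hk0.le
      rw [mul_sub, hk1, Finset.mul_sum, Finset.sum_congr rfl fun i _ => (k_eq (hcfg.1 i).1.T_pos.le).symm, ← Finset.mul_sum] at h6
      rcases isEmpty_or_nonempty ι with he | he
      · rw [Finset.univ_eq_empty, Finset.sum_empty, mul_zero] at h6
        filter_upwards [low_zero hKconv hKint harea (ε / 3) (by positivity)] with n hn
        linarith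
      · filter_upwards [lower_c hKconv harea hcfg (ε / 3) (by positivity)] with n hn
        linarith
  have hup : ∀ ε > 0, ∀ᶠ n : ℕ in atTop, (n:ℝ)^(-(1:ℝ)/3) * Real.log (EQ K n) ≤ k * sSup U + ε := by
    refine part_b hKc hKconv hKint harea (mul_nonneg hk0.le hA0) ?_
    intro ι hι t hcfg
    rw [Finset.mul_sum, Finset.sum_congr rfl fun i _ => k_eq (hcfg.1 i).1.T_pos.le, ← Finset.mul_sum]
    refine mul_le_mul_of_nonneg_left ?_ hk0.le
    have hSc : IsCompact (arcHull t) := arcHull_compact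
    have hSv : Convex ℝ (arcHull t) := arcHull_convex
    have hSK := arcHull_subset hKconv hKc.isClosed hcfg
    refine le_trans ?_ (le_csSup hbdd ⟨arcHull t, hSK, hSv, hSc, rfl⟩)
    obtain ⟨l, hl, hAP⟩ := AP_lim hSc hSv
    rw [hAP, ← Finset.mul_sum, ← cst_mul, mul_assoc]
    refine mul_le_mul_of_nonneg_left ?_ cst_pos.le
    refine le_of_forall_pos_le_add fun ε hε => ?_
    have := ge_of_tendsto hl (part_d hcfg ε hε)
    linarith
  rw [Metric.tendsto_nhds]
  intro ε hε
  filter_upwards [hlow (ε / 2) (by positivity), hup (ε / 2) (by positivity)] with n h1 h2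
  rw [Real.dist_eq, abs_lt]
  constructor <;> linarith

end eight

end

/-- Theorem 1.2: for every planar convex body `K` of unit area,
`n^{-1/3} · log E|Q(X_n)| → 3 · 2^{-2/3} · A(K)`. -/
theorem expected_number_of_polygons (K : Set (E 2)) (hKc : IsCompact K) (hKconv : Convex ℝ K)
    (hKint : (interior K).Nonempty) (harea : volume K = 1) :
    Tendsto (fun n : ℕ => (n : ℝ) ^ (-(1 : ℝ) / 3) *
        Real.log (∫ x, (numPolytopes 2 n x : ℝ) ∂(sampleMeasure 2 n K))) atTop
      (nhds (3 * (2 : ℝ) ^ (-(2 : ℝ) / 3) * maxAffinePerimeter K)) := by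
  exact main_limit hKc hKconv hKint harea
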